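/- Centralizer of the translation class: let Ψ be an orientation preserving homeomorphism of ℝ² with Ψ(ℤ₁) = ℤ₁ and Ψ(ℤ₂) = ℤ₂ such that Ψ∘T∘Ψ⁻¹ is isotopic to T relative to ℤ₁ ∪ ℤ₂. Then there exists a homeomorphism Ψ′ of ℝ² with Ψ′∘T = T∘Ψ′, Ψ′(ℤ₁) = ℤ₁ and Ψ′(ℤ₂) = ℤ₂, such that Ψ is isotopic to Ψ′ relative to ℤ₁ ∪ ℤ₂; in other words, every mapping class commuting with that of T is the mapping class of a homeomorphism that commutes with T. -/

import Mathlib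

open Set

/-- The plane. -/
abbrev Plane : Type := ℝ × ℝ

/-- `f` is (the underlying function of) a homeomorphism of the plane. -/
def IsHomeoFun (f : Plane → Plane) : Prop :=
  ∃ e : Plane ≃ₜ Plane, ∀ x, e x = f x

/-- `g` and `g'` are isotopic relative to `O` : there is a continuous family
`F (t, ·)`, `t ∈ [0,1]`, of homeomorphisms of the plane going from `g` to `g'`
and agreeing with `g` on `O` for all times. -/
def IsotopicRel (g g' : Plane → Plane) (O : Set Plane) : Prop :=
  ∃ F : ℝ × Plane → Plane, Continuous F ∧
    (∀ t ∈ Icc (0:ℝ) 1, IsHomeoFun fun x => F (t, x)) ∧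
    (∀ x, F (0, x) = g x) ∧
    (∀ x, F (1, x) = g' x) ∧
    (∀ t ∈ Icc (0:ℝ) 1, ∀ x ∈ O, F (t, x) = g x)

/-- A homeomorphism of the plane is orientation preserving iff it is isotopic
to the identity. -/
def OrientationPreserving (h : Plane ≃ₜ Plane) : Prop :=
  IsotopicRel id (⇑h) (∅ : Set Plane)

/-- A Brouwer homeomorphism: orientation preserving and fixed point free. -/
def IsBrouwer (h : Plane ≃ₜ Plane) : Prop :=
  OrientationPreserving h ∧ ∀ x, h x ≠ x

/-- The orbit of a point under a homeomorphism. -/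
def horbit (h : Plane ≃ₜ Plane) (x : Plane) : Set Plane :=
  {y | ∃ n : ℤ, y = (h.toEquiv ^ n) x}

/-- `ℤ₁ = ℤ × {1}`. -/
def Z1 : Set Plane := {p | ∃ n : ℤ, p = ((n : ℝ), 1)}

/-- `ℤ₂ = ℤ × {2}`. -/
def Z2 : Set Plane := {p | ∃ n : ℤ, p = ((n : ℝ), 2)}

/-- The shear homeomorphism `(x, y) ↦ (x + f y, y)`. -/
def shear (f : ℝ → ℝ) (hf : Continuous f) : Plane ≃ₜ Plane where
  toFun p := (p.1 + f p.2, p.2)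
  invFun p := (p.1 - f p.2, p.2)
  left_inv p := by simp
  right_inv p := by simp
  continuous_toFun := (continuous_fst.add (hf.comp continuous_snd)).prodMk continuous_snd
  continuous_invFun := (continuous_fst.sub (hf.comp continuous_snd)).prodMk continuous_snd

/-- The translation `T (x, y) = (x + 1, y)`. -/
def T : Plane ≃ₜ Plane := shear (fun _ => 1) continuous_const

/-- The twist `T₁ (x, y) = (x + 2 - y, y)`. -/
def T₁ : Plane ≃ₜ Plane := shear (fun y => 2 - y) (by continuity)

/-- The twist `T₂ (x, y) = (x + y - 1, y)`. -/
def T₂ : Plane ≃ₜ Plane := shear (fun y => y - 1) (by continuity)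

/-- The model Reeb homeomorphism `R₀ = T₁ ∘ T₂⁻¹`, `R₀ (x, y) = (x + 3 - 2y, y)`. -/
def R₀ : Plane ≃ₜ Plane := shear (fun y => 3 - 2 * y) (by continuity)

/-- The Euclidean norm on the plane. -/
noncomputable def planeNorm (p : Plane) : ℝ := Real.sqrt (p.1 ^ 2 + p.2 ^ 2)

/-- An angle function for a fixed point free map `h'` along a curve `γ`. -/
def IsAngleFunction (h' : Plane → Plane) (γ : ℝ → Plane) (θ : ℝ → ℝ) : Prop :=
  ContinuousOn θ (Icc 0 1) ∧
    ∀ t ∈ Icc (0:ℝ) 1,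
      h' (γ t) - γ t =
        planeNorm (h' (γ t) - γ t) • (Real.cos (θ t), Real.sin (θ t))

/-- The conjugate `Φ ∘ h ∘ Φ⁻¹`. -/
def conjH (Φ h : Plane ≃ₜ Plane) : Plane ≃ₜ Plane := Φ.symm.trans (h.trans Φ)

/-- An admissible straightening `Φ` for `(h, O₁, O₂)` : an orientation preserving
homeomorphism sending `O₁, O₂` to `ℤ₁, ℤ₂` such that `Φ ∘ h ∘ Φ⁻¹` is isotopic
relative to `ℤ₁ ∪ ℤ₂` to a homeomorphism translating each line `ℝ × {i}` by `±1`. -/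
def AdmissibleStraightening (h : Plane ≃ₜ Plane) (O₁ O₂ : Set Plane)
    (Φ : Plane ≃ₜ Plane) : Prop :=
  OrientationPreserving Φ ∧ Φ '' O₁ = Z1 ∧ Φ '' O₂ = Z2 ∧
    ∃ ε₁ ε₂ : ℝ, (ε₁ = 1 ∨ ε₁ = -1) ∧ (ε₂ = 1 ∨ ε₂ = -1) ∧
      ∃ g : Plane ≃ₜ Plane,
        (∀ x : ℝ, g (x, 1) = (x + ε₁, 1)) ∧
        (∀ x : ℝ, g (x, 2) = (x + ε₂, 2)) ∧
        IsotopicRel (⇑(conjH Φ h)) (⇑g) (Z1 ∪ Z2)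

/-- A flow on the plane. -/
def IsFlow (φ : ℝ → Plane → Plane) : Prop :=
  Continuous (fun p : ℝ × Plane => φ p.1 p.2) ∧
    (∀ x, φ 0 x = x) ∧ ∀ s t x, φ (s + t) x = φ s (φ t x)

/-- A topological line in the plane: the image of a proper injective continuous
map from `ℝ` to the plane. -/
def IsTopLine (L : Set Plane) : Prop :=
  ∃ f : ℝ → Plane, Continuous f ∧ Function.Injective f ∧ IsProperMap f ∧ range f = L

namespace PlaneTC
open Topology Filter Metric

/-- A family of homeomorphisms of `ℂ` which is jointly continuous. -/
def JC {Y : Type*} [TopologicalSpace Y] (h : Y → ℂ ≃ₜ ℂ) : Prop :=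
  Continuous fun p : Y × ℂ => h p.1 p.2

section JC
variable {Y Z : Type*} [TopologicalSpace Y] [TopologicalSpace Z]

lemma mul_app (f g : ℂ ≃ₜ ℂ) (z : ℂ) : (f * g) z = f (g z) := rfl
lemma one_app (z : ℂ) : (1 : ℂ ≃ₜ ℂ) z = z := rfl
lemma inv_app_self (f : ℂ ≃ₜ ℂ) (z : ℂ) : f⁻¹ (f z) = z := f.symm_apply_apply z
lemma app_inv_self (f : ℂ ≃ₜ ℂ) (z : ℂ) : f (f⁻¹ z) = z := f.apply_symm_apply z
lemma inv_app_eq {f : ℂ ≃ₜ ℂ} {z w : ℂ} : f⁻¹ z = w ↔ z = f w := f.toEquiv.symm_apply_eq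
lemma inv_fix {f : ℂ ≃ₜ ℂ} {z : ℂ} (h : f z = z) : f⁻¹ z = z := inv_app_eq.2 h.symm

lemma JC.app {h : Y → ℂ ≃ₜ ℂ} (hh : JC h) {f : Z → Y} (hf : Continuous f) {g : Z → ℂ}
    (hg : Continuous g) : Continuous fun z => h (f z) (g z) :=
  Continuous.comp hh (hf.prodMk hg)

lemma JC.comp {h : Y → ℂ ≃ₜ ℂ} (hh : JC h) {f : Z → Y} (hf : Continuous f) :
    JC fun z => h (f z) := hh.app (hf.comp continuous_fst) continuous_snd

lemma JC.mul {h k : Y → ℂ ≃ₜ ℂ} (hh : JC h) (hk : JC k) : JC fun y => h y * k y :=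
  hh.app continuous_fst hk

lemma JC.const (f : ℂ ≃ₜ ℂ) : JC fun _ : Y => f := f.continuous.comp continuous_snd

lemma JC.inv {h : Y → ℂ ≃ₜ ℂ} (hh : JC h) : JC fun y => (h y)⁻¹ := by
  refine continuous_iff_continuousAt.2 ?_
  rintro ⟨y0, w0⟩
  rw [ContinuousAt, Metric.tendsto_nhds]
  intro ε hε
  set x0 := (h y0)⁻¹ w0 with hx0
  have hw0 : h y0 x0 = w0 := app_inv_self _ _
  obtain ⟨δ, hδ, hS⟩ : ∃ δ > 0, ∀ s ∈ sphere x0 ε, δ < dist (h y0 s) w0 := by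
    have hc : IsCompact ((h y0) '' sphere x0 ε) := (isCompact_sphere x0 ε).image (h y0).continuous
    have hn : w0 ∉ (h y0) '' sphere x0 ε := by
      rintro ⟨s, hs, hsw⟩
      have : s = x0 := (h y0).injective (hsw.trans hw0.symm)
      rw [this, mem_sphere, dist_self] at hs
      exact hε.ne hs
    obtain ⟨δ, hδ, hd⟩ := Metric.isOpen_iff.1 hc.isClosed.isOpen_compl w0 hn
    refine ⟨δ / 2, by positivity, fun s hs => ?_⟩
    by_contra hlt
    exact hd (mem_ball.2 (by linarith)) (mem_image_of_mem _ hs)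
  have e1 : ∀ᶠ y in 𝓝 y0, ∀ s ∈ sphere x0 ε, δ < dist (h y s) w0 := by
    refine (isCompact_sphere x0 ε).eventually_forall_of_forall_eventually fun s hs => ?_
    exact (isOpen_lt continuous_const ((hh : Continuous _).dist continuous_const)).mem_nhds
      (show (y0, s) ∈ {p : Y × ℂ | δ < dist (h p.1 p.2) w0} from hS s hs)
  have e2 : ∀ᶠ y in 𝓝 y0, h y x0 ∈ ball w0 δ := by
    have : Continuous fun y => h y x0 := hh.app continuous_id continuous_const
    exact this.continuousAt (isOpen_ball.mem_nhds (by simp [hw0, hδ]))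
  rw [nhds_prod_eq]
  filter_upwards [(e1.and e2).prod_mk (isOpen_ball.mem_nhds (mem_ball_self hδ (x := w0)))]
  rintro ⟨y, w⟩ ⟨⟨h1, h2⟩, h3⟩
  have hpre : IsPreconnected (((h y)⁻¹ : ℂ ≃ₜ ℂ) '' ball w0 δ) :=
    (convex_ball w0 δ).isPreconnected.image _ (h y)⁻¹.continuous.continuousOn
  have hsub : ((h y)⁻¹ : ℂ ≃ₜ ℂ) '' ball w0 δ ⊆ ball x0 ε := by
    refine hpre.subset_left_of_subset_union isOpen_ball
      (isClosed_closedBall (x := x0) (ε := ε)).isOpen_compl ?_ ?_ ?_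
    · exact disjoint_compl_right.mono_left ball_subset_closedBall
    · rintro _ ⟨v, hv, rfl⟩
      by_contra hcon
      rw [mem_union, not_or, mem_compl_iff, not_not, mem_closedBall, mem_ball, not_lt] at hcon
      have := h1 _ (le_antisymm hcon.2 hcon.1)
      rw [app_inv_self] at this
      exact absurd (mem_ball.1 hv) (not_lt.2 this.le)
    · exact ⟨x0, ⟨_, h2, inv_app_self _ _⟩, mem_ball_self hε⟩
  exact hsub ⟨w, h3, rfl⟩

/-- A continuous family of bijections with individually continuous inverses. -/
lemma exists_family {f g : Y → ℂ → ℂ} (hf : Continuous fun p : Y × ℂ => f p.1 p.2)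
    (hg : ∀ y, Continuous (g y)) (h1 : ∀ y z, g y (f y z) = z) (h2 : ∀ y z, f y (g y z) = z) :
    ∃ h : Y → ℂ ≃ₜ ℂ, JC h ∧ ∀ y z, h y z = f y z :=
  ⟨fun y => ⟨⟨f y, g y, h1 y, h2 y⟩, hf.comp (by fun_prop : Continuous fun z => (y, z)), hg y⟩,
    hf, fun _ _ => rfl⟩

end JC

section Extension
variable {Y : Type*} [TopologicalSpace Y]

open Classical in
/-- Transplantation of a self-map of the source of `σ` to the target, extended by the identity. -/
noncomputable def transplant (σ : OpenPartialHomeomorph ℂ ℂ) (f : ℂ → ℂ) (z : ℂ) : ℂ :=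
  if z ∈ σ.target then σ (f (σ.symm z)) else z

lemma transplant_of_mem {σ : OpenPartialHomeomorph ℂ ℂ} {f : ℂ → ℂ} {z : ℂ} (hz : z ∈ σ.source) :
    transplant σ f (σ z) = σ (f z) := by
  rw [transplant, if_pos (σ.map_source hz), σ.left_inv hz]

lemma transplant_of_notMem {σ : OpenPartialHomeomorph ℂ ℂ} {f : ℂ → ℂ} {z : ℂ}
    (hz : z ∉ σ.target) : transplant σ f z = z := if_neg hz

lemma transplant_transplant {σ : OpenPartialHomeomorph ℂ ℂ} {f g : ℂ → ℂ}
    (hf : MapsTo f σ.source σ.source) (hgf : ∀ z, g (f z) = z) (z : ℂ) :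
    transplant σ g (transplant σ f z) = z := by
  by_cases hz : z ∈ σ.target
  · have := σ.map_target hz
    rw [← σ.right_inv hz, transplant_of_mem this, transplant_of_mem (hf this), hgf]
  · rw [transplant_of_notMem hz, transplant_of_notMem hz]

lemma continuous_transplant {σ : OpenPartialHomeomorph ℂ ℂ} {f : Y → ℂ → ℂ}
    (hf : Continuous fun p : Y × ℂ => f p.1 p.2) (hs : ∀ y, MapsTo (f y) σ.source σ.source)
    (H : ∀ ε > 0, ∃ Q ⊆ σ.source, IsCompact Q ∧
      ∀ y, ∀ z ∈ σ.source \ Q, dist (σ (f y z)) (σ z) < ε) :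
    Continuous fun p : Y × ℂ => transplant σ (f p.1) p.2 := by
  refine continuous_iff_continuousAt.2 ?_
  rintro ⟨y0, z0⟩
  by_cases hz : z0 ∈ σ.target
  · have hev : (fun p : Y × ℂ => σ (f p.1 (σ.symm p.2))) =ᶠ[𝓝 (y0, z0)]
        fun p : Y × ℂ => transplant σ (f p.1) p.2 := by
      have : ∀ᶠ p : Y × ℂ in 𝓝 (y0, z0), p.2 ∈ σ.target :=
        (σ.open_target.preimage continuous_snd).mem_nhds hz
      filter_upwards [this] with p hp
      rw [transplant, if_pos hp]
    refine ContinuousAt.congr ?_ hev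
    have c1 : ContinuousAt (fun p : Y × ℂ => σ.symm p.2) (y0, z0) :=
      (σ.continuousAt_symm hz).comp (f := Prod.snd) (x := (y0, z0)) continuous_snd.continuousAt
    have c2 : ContinuousAt (fun p : Y × ℂ => f p.1 (σ.symm p.2)) (y0, z0) :=
      ContinuousAt.comp (g := fun p : Y × ℂ => f p.1 p.2) (x := (y0, z0)) hf.continuousAt
        (f := fun p : Y × ℂ => (p.1, σ.symm p.2)) (continuous_fst.continuousAt.prodMk c1)
    exact (σ.continuousAt (hs y0 (σ.map_target hz))).comp
      (f := fun p : Y × ℂ => f p.1 (σ.symm p.2)) c2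
  · rw [ContinuousAt, transplant_of_notMem (f := f (y0, z0).1) hz, Metric.tendsto_nhds]
    intro ε hε
    obtain ⟨Q, hQs, hQ, hd⟩ := H (ε / 2) (by positivity)
    have hc : IsClosed (σ '' Q) := (hQ.image_of_continuousOn (σ.continuousOn.mono hQs)).isClosed
    have hn : z0 ∉ σ '' Q := by
      rintro ⟨x, hx, rfl⟩
      exact hz (σ.map_source (hQs hx))
    have e1 : ∀ᶠ p : Y × ℂ in 𝓝 (y0, z0), p.2 ∈ (σ '' Q)ᶜ :=
      (hc.isOpen_compl.preimage continuous_snd).mem_nhds hn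
    have e2 : ∀ᶠ p : Y × ℂ in 𝓝 (y0, z0), p.2 ∈ ball z0 (ε / 2) :=
      (isOpen_ball.preimage continuous_snd).mem_nhds (mem_ball_self (by positivity))
    filter_upwards [e1, e2] with p h1 h2
    by_cases hp : p.2 ∈ σ.target
    · have hps := σ.map_target hp
      have hpQ : σ.symm p.2 ∉ Q := fun h => h1 ⟨_, h, σ.right_inv hp⟩
      have := hd p.1 _ ⟨hps, hpQ⟩
      rw [transplant, if_pos hp]
      rw [σ.right_inv hp] at this
      linarith [dist_triangle (σ (f p.1 (σ.symm p.2))) p.2 z0, mem_ball.1 h2]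
    · rw [transplant_of_notMem hp]
      linarith [mem_ball.1 h2]

/-- Conjugating a family by an open embedding and extending by the identity. -/
lemma exists_transplant (σ : OpenPartialHomeomorph ℂ ℂ) {K : Y → ℂ ≃ₜ ℂ} (hK : JC K)
    (hs : ∀ y z, K y z ∈ σ.source ↔ z ∈ σ.source)
    (H : ∀ ε > 0, ∃ Q ⊆ σ.source, IsCompact Q ∧
      ∀ y, ∀ z ∈ σ.source \ Q, dist (σ (K y z)) (σ z) < ε) :
    ∃ k : Y → ℂ ≃ₜ ℂ, JC k ∧ (∀ y, ∀ z ∈ σ.source, k y (σ z) = σ (K y z)) ∧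
      ∀ y, ∀ z ∉ σ.target, k y z = z := by
  have hs' : ∀ y z, (K y)⁻¹ z ∈ σ.source ↔ z ∈ σ.source := fun y z => by
    rw [← hs y, app_inv_self]
  obtain ⟨k, hk, hkt⟩ := exists_family (f := fun y => transplant σ (K y))
    (g := fun y => transplant σ ((K y)⁻¹ : ℂ ≃ₜ ℂ))
    (continuous_transplant (f := fun y => K y) hK (fun y z hz => (hs y z).2 hz) H)
    (fun y => by
      have := continuous_transplant (Y := Unit) (σ := σ) (f := fun _ => ((K y)⁻¹ : ℂ ≃ₜ ℂ))
        (((K y)⁻¹ : ℂ ≃ₜ ℂ).continuous.comp continuous_snd) (fun _ z hz => (hs' y z).2 hz) (by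
          intro ε hε
          obtain ⟨Q, hQs, hQ, hd⟩ := H ε hε
          refine ⟨K y '' Q, ?_, hQ.image (K y).continuous, ?_⟩
          · rintro _ ⟨x, hx, rfl⟩
            exact (hs y x).2 (hQs hx)
          · rintro _ z ⟨hz, hzQ⟩
            have := hd y ((K y)⁻¹ z) ⟨(hs' y z).2 hz, fun h => hzQ ⟨_, h, app_inv_self _ _⟩⟩
            rwa [app_inv_self, dist_comm] at this)
      exact this.comp (by fun_prop : Continuous fun z : ℂ => ((), z)))
    (fun y z => transplant_transplant (fun z hz => (hs y z).2 hz) (inv_app_self _) z)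
    (fun y z => transplant_transplant (fun z hz => (hs' y z).2 hz) (app_inv_self _) z)
  refine ⟨k, hk, fun y z hz => ?_, fun y z hz => ?_⟩
  · rw [hkt, transplant_of_mem hz]
  · rw [hkt, transplant_of_notMem hz]

end Extension
end PlaneTC

namespace PlaneTC
open Topology Filter Metric unitInterval

/-- Adding to the identity a contraction yields a homeomorphism. -/
lemma exists_homeo_of_contraction {g : ℂ → ℂ} {c : NNReal} (hc : c < 1) (hg : LipschitzWith c g) :
    ∃ e : ℂ ≃ₜ ℂ, ∀ z, e z = z + g z := by
  have h : ApproximatesLinearOn (fun z => z + g z)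
      ((ContinuousLinearEquiv.refl ℂ ℂ : ℂ ≃L[ℂ] ℂ) : ℂ →L[ℂ] ℂ) univ c := by
    intro x _ y _
    have := hg.dist_le_mul x y
    rw [dist_eq_norm, dist_eq_norm] at this
    refine le_of_eq_of_le ?_ this
    congr 1
    change (x + g x) - (y + g y) - (x - y) = _
    ring
  refine ⟨h.toHomeomorph _ (Or.inr ?_), fun z => rfl⟩
  refine hc.trans_le ?_
  rw [show (ContinuousLinearEquiv.refl ℂ ℂ).symm = ContinuousLinearEquiv.refl ℂ ℂ from rfl]
  have := ContinuousLinearMap.norm_id (𝕜 := ℂ) (E := ℂ)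
  have h2 : ‖((ContinuousLinearEquiv.refl ℂ ℂ : ℂ ≃L[ℂ] ℂ) : ℂ →L[ℂ] ℂ)‖₊ = 1 := by
    ext; exact this
  rw [h2, inv_one]

/-- The bump used to push a point. -/
noncomputable def bump (r : ℝ) (p x : ℂ) : ℝ := max 0 (1 - ‖x - p‖ / r)

lemma exists_push {Y : Type*} [TopologicalSpace Y] {r : ℝ} (hr : 0 < r) {p q : Y → ℂ}
    (hp : Continuous p) (hq : Continuous q) (hv : ∀ y, ‖q y - p y‖ < r) :
    ∃ h : Y → ℂ ≃ₜ ℂ, JC h ∧ (∀ y, h y (p y) = q y) ∧ (∀ y, ∀ x ∉ ball (p y) r, h y x = x) ∧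
      ∀ y, q y = p y → h y = 1 := by
  have key : ∀ y, ∃ e : ℂ ≃ₜ ℂ, ∀ x, e x = x + bump r (p y) x * (q y - p y) := by
    intro y
    refine exists_homeo_of_contraction (c := ‖q y - p y‖₊ / r.toNNReal) ?_ ?_
    · rw [div_lt_one (Real.toNNReal_pos.2 hr)]
      rw [Real.lt_toNNReal_iff_coe_lt]
      exact hv y
    · refine LipschitzWith.of_dist_le_mul fun x z => ?_
      rw [dist_eq_norm, ← sub_mul, norm_mul, ← Complex.ofReal_sub, Complex.norm_real, mul_comm]
      have h1 : ‖bump r (p y) x - bump r (p y) z‖ ≤ dist x z / r := by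
        rw [Real.norm_eq_abs]
        refine (abs_max_sub_max_le_max _ _ _ _).trans ?_
        rw [sub_self, abs_zero, max_eq_right (abs_nonneg _)]
        rw [show 1 - ‖x - p y‖ / r - (1 - ‖z - p y‖ / r) = (‖z - p y‖ - ‖x - p y‖) / r by ring,
          abs_div, abs_of_pos hr]
        gcongr
        refine (abs_norm_sub_norm_le _ _).trans ?_
        rw [sub_sub_sub_cancel_right, ← dist_eq_norm, dist_comm]
      calc _ ≤ ‖q y - p y‖ * (dist x z / r) := by gcongr
        _ = _ := by
          push_cast
          rw [Real.coe_toNNReal _ hr.le]; ring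
  choose h hh using key
  refine ⟨h, ?_, fun y => ?_, fun y x hx => ?_, fun y hy => ?_⟩
  · unfold JC
    simp_rw [hh, bump]
    fun_prop
  · rw [hh]; simp [bump]
  · rw [hh]
    have : bump r (p y) x = 0 := by
      rw [mem_ball, not_lt, dist_eq_norm] at hx
      refine max_eq_left ?_
      rw [sub_nonpos, le_div_iff₀ hr]; linarith
    simp [this]
  · ext x; rw [hh, hy, one_app]; simp

/-- A point may be moved along a family of paths inside an open set by homeomorphisms supported
there. -/
lemma exists_drag {Y : Type*} [TopologicalSpace Y] [CompactSpace Y] {U : Set ℂ} (hU : IsOpen U)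
    {Γ : I → Y → ℂ} (hΓ : Continuous fun p : I × Y => Γ p.1 p.2) (hΓU : ∀ s y, Γ s y ∈ U) {o : ℂ}
    (ho : ∀ y, Γ 0 y = o) :
    ∃ G : Y → ℂ ≃ₜ ℂ, JC G ∧ (∀ y, G y o = Γ 1 y) ∧ (∀ y, ∀ x ∉ U, G y x = x) ∧
      ∀ y, (∀ s, Γ s y = o) → G y = 1 := by
  set f : I × Y → ℂ := fun p => Γ p.1 p.2 with hf
  obtain ⟨ρ, hρ, hρU⟩ := (isCompact_range hΓ).exists_thickening_subset_open hU
    (by rintro _ ⟨p, rfl⟩; exact hΓU _ _)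
  have hball : ∀ s y, ball (Γ s y) ρ ⊆ U := fun s y x hx =>
    hρU (mem_thickening_iff.2 ⟨_, ⟨(s, y), rfl⟩, hx⟩)
  obtain ⟨n, hn, hclose⟩ : ∃ n : ℕ, 0 < n ∧ ∀ y, ∀ s t : I, dist s t ≤ 1 / n →
      ‖Γ t y - Γ s y‖ < ρ := by
    by_contra! hcon
    choose y s t hst hd using fun n : ℕ => hcon (n + 1) n.succ_pos
    obtain ⟨a, -, φ, hφ, ha⟩ := (isCompact_univ (X := I)).tendsto_subseq (x := s) (by simp)
    have hdist : Tendsto (fun n => dist (s (φ n)) (t (φ n))) atTop (𝓝 0) := by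
      refine squeeze_zero (fun _ => dist_nonneg) (fun n => hst (φ n)) ?_
      have := (tendsto_one_div_add_atTop_nhds_zero_nat (𝕜 := ℝ)).comp hφ.tendsto_atTop
      refine this.congr fun n => by simp
    have ht : Tendsto (fun n => t (φ n)) atTop (𝓝 a) := (tendsto_iff_of_dist hdist).1 ha
    have hu : ∀ᶠ s in 𝓝 a, ∀ y ∈ (univ : Set Y), dist (Γ s y) (Γ a y) < ρ / 2 := by
      refine isCompact_univ.eventually_forall_of_forall_eventually fun y _ => ?_
      have hc : Continuous fun p : I × Y => dist (Γ p.1 p.2) (Γ a p.2) :=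
        hΓ.dist (hΓ.comp (continuous_const.prodMk continuous_snd))
      exact (isOpen_lt hc continuous_const).mem_nhds (by simp [hρ])
    obtain ⟨n, h1, h2⟩ := ((ha.eventually hu).and (ht.eventually hu)).exists
    have := hd (φ n)
    rw [← dist_eq_norm] at this
    have h1' : dist (Γ (s (φ n)) (y (φ n))) (Γ a (y (φ n))) < ρ / 2 := h1 _ trivial
    linarith [h2 (y (φ n)) trivial,
      dist_triangle_right (Γ (t (φ n)) (y (φ n))) (Γ (s (φ n)) (y (φ n))) (Γ a (y (φ n)))]
  set c : ℕ → I := fun k => projIcc 0 1 zero_le_one (k / n : ℝ) with hc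
  have main : ∀ k : ℕ, ∃ G : Y → ℂ ≃ₜ ℂ, JC G ∧ (∀ y, G y o = Γ (c k) y) ∧
      (∀ y, ∀ x ∉ U, G y x = x) ∧ ∀ y, (∀ s, Γ s y = o) → G y = 1 := by
    intro k
    induction k with
    | zero =>
      refine ⟨fun _ => 1, JC.const 1, fun y => ?_, fun _ _ _ => rfl, fun _ _ => rfl⟩
      have : c 0 = 0 := by simp [hc]
      rw [this, ho]; rfl
    | succ k ih =>
      obtain ⟨G, hG, hGo, hGU, hG1⟩ := ih
      have hcont : ∀ s, Continuous (Γ s) := fun s => hΓ.comp (by fun_prop : Continuous fun y => (s, y))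
      obtain ⟨h, hh, hh1, hh2, hh3⟩ := exists_push hρ (hcont (c k)) (hcont (c (k + 1)))
        (fun y => hclose y _ _ (by
          refine (abs_projIcc_sub_projIcc (zero_le_one (α := ℝ))).trans ?_
          push_cast
          rw [← sub_div, abs_div, Nat.abs_cast]
          simp))
      refine ⟨fun y => h y * G y, hh.mul hG, fun y => ?_, fun y x hx => ?_, fun y hy => ?_⟩
      · rw [mul_app, hGo, hh1]
      · rw [mul_app, hGU y x hx, hh2 y x fun h => hx (hball _ _ h)]
      · change h y * G y = 1
        rw [hG1 y hy, hh3 y (by rw [hy, hy]), mul_one]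
  obtain ⟨G, h1, h2, h3⟩ := main n
  refine ⟨G, h1, fun y => ?_, h3⟩
  have : c n = 1 := by
    simp only [hc]
    rw [div_self (by positivity)]
    exact projIcc_right _
  rw [h2, this]

end PlaneTC

namespace PlaneTC
open FreeGroup

/-- Letters of words in the free group on `ℤ`. -/
abbrev Ltr := ℤ × Bool
/-- The free group on `ℤ`. -/
abbrev F := FreeGroup ℤ

/-- The value of `φ` on the initial window of length `L`. -/
def win (φ : List Ltr → ℤ) (L : ℕ) (l : List Ltr) : ℤ := if L ≤ l.length then φ (l.take L) else 0

/-- The sum of `φ` over all windows of length `L` of a word. -/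
def cnt (φ : List Ltr → ℤ) (L : ℕ) : List Ltr → ℤ
  | [] => 0
  | a :: l => win φ L (a :: l) + cnt φ L l

variable {φ : List Ltr → ℤ} {L : ℕ} {C : ℤ}

lemma abs_win_le (hφ : ∀ l, |φ l| ≤ C) (l : List Ltr) : |win φ L l| ≤ C := by
  unfold win
  split_ifs
  · exact hφ _
  · simpa using (abs_nonneg _).trans (hφ [])

lemma abs_cnt_le (hφ : ∀ l, |φ l| ≤ C) (l : List Ltr) : |cnt φ L l| ≤ C * l.length := by
  induction l with
  | nil => simp [cnt]
  | cons a l ih =>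
    rw [cnt, List.length_cons]
    push_cast
    linarith [abs_add_le (win φ L (a :: l)) (cnt φ L l), abs_win_le (L := L) hφ (a :: l)]

lemma abs_cnt_append_le (hφ : ∀ l, |φ l| ≤ C) (A B : List Ltr) :
    |cnt φ L (A ++ B) - cnt φ L A - cnt φ L B| ≤ 2 * C * min A.length L := by
  have hC : 0 ≤ C := (abs_nonneg _).trans (hφ [])
  induction A with
  | nil => simp [cnt]
  | cons a A ih =>
    rw [List.cons_append, cnt, cnt]
    by_cases hL : L ≤ (a :: A).length
    · have : win φ L (a :: (A ++ B)) = win φ L (a :: A) := by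
        rw [← List.cons_append, win, win, if_pos hL, if_pos (hL.trans (by simp)),
          List.take_append_of_le_length hL]
      rw [this]
      refine le_trans (le_of_eq ?_) (ih.trans ?_)
      · congr 1; ring
      · gcongr
        simp
    · have h1 := abs_win_le (L := L) hφ (a :: (A ++ B))
      have h2 := abs_win_le (L := L) hφ (a :: A)
      rw [List.length_cons] at hL ⊢
      rw [min_eq_left (by omega)] at ih ⊢
      push_cast
      rw [abs_le] at *
      constructor <;> linarith

/-- The counting quasi-morphism on the free group. -/
def qm (φ : List Ltr → ℤ) (L : ℕ) (g : F) : ℤ := cnt φ L g.toWord - cnt φ L g⁻¹.toWord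

lemma qm_inv (g : F) : qm φ L g⁻¹ = -qm φ L g := by simp [qm]

lemma abs_qm_le (hφ : ∀ l, |φ l| ≤ C) (g : F) : |qm φ L g| ≤ 2 * C * g.norm := by
  have h1 := abs_cnt_le (L := L) hφ g.toWord
  have h2 := abs_cnt_le (L := L) hφ g⁻¹.toWord
  have h3 : (g⁻¹.toWord.length : ℤ) = g.toWord.length := by
    have := norm_inv_eq (x := g)
    exact_mod_cast this
  rw [h3] at h2
  change |_| ≤ 2 * C * (g.toWord.length : ℤ)
  rw [qm]
  rw [abs_le] at *
  constructor <;> linarith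

lemma exists_cancel (G : List Ltr) : ∀ H : List Ltr, IsReduced G → IsReduced H →
    ∃ A X B, G = A ++ X ∧ H = invRev X ++ B ∧ IsReduced (A ++ B) := by
  induction G using List.reverseRecOn with
  | nil => exact fun H _ hH => ⟨[], [], H, rfl, rfl, hH⟩
  | append_singleton G x ih =>
    intro H hG hH
    cases H with
    | nil => exact ⟨G ++ [x], [], [], by simp, by simp, by simpa using hG⟩
    | cons y H =>
      by_cases hxy : x.1 = y.1 → x.2 = y.2
      · refine ⟨G ++ [x], [], y :: H, by simp, by simp, ?_⟩
        refine List.isChain_append.2 ⟨hG, hH, ?_⟩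
        simpa using hxy
      · push Not at hxy
        obtain ⟨A, X, B, rfl, rfl, h⟩ := ih H (List.isChain_append.1 hG).1 (List.IsChain.tail hH)
        refine ⟨A, X ++ [x], B, by simp, ?_, h⟩
        rw [invRev_append]
        have : invRev [x] = [y] := by
          obtain ⟨x1, x2⟩ := x
          obtain ⟨y1, y2⟩ := y
          simp only at hxy
          obtain ⟨rfl, h2⟩ := hxy
          simp only [invRev, List.map_cons, List.map_nil, List.reverse_singleton]
          cases x2 <;> cases y2 <;> simp_all
        rw [this]; rfl

lemma toWord_mul_cases (g h : F) : ∃ A X B, g.toWord = A ++ X ∧ h.toWord = invRev X ++ B ∧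
    (g * h).toWord = A ++ B := by
  obtain ⟨A, X, B, h1, h2, h3⟩ := exists_cancel g.toWord h.toWord isReduced_toWord isReduced_toWord
  refine ⟨A, X, B, h1, h2, ?_⟩
  have : g * h = mk (A ++ B) := by
    rw [← mk_toWord (x := g), ← mk_toWord (x := h), h1, h2, ← mul_mk, ← mul_mk, ← mul_mk, ← inv_mk]
    group
  rw [this, toWord_mk, h3.reduce_eq]

/-- The defect bound of the counting quasi-morphisms. -/
lemma abs_qm_mul_le (hφ : ∀ l, |φ l| ≤ C) (g h : F) :
    |qm φ L (g * h) - qm φ L g - qm φ L h| ≤ 12 * C * L := by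
  have hC : 0 ≤ C := (abs_nonneg _).trans (hφ [])
  obtain ⟨A, X, B, h1, h2, h3⟩ := toWord_mul_cases g h
  have key : ∀ A B, |cnt φ L (A ++ B) - cnt φ L A - cnt φ L B| ≤ 2 * C * L := fun A B =>
    (abs_cnt_append_le hφ A B).trans (by gcongr; simp)
  rw [qm, qm, qm, toWord_inv, toWord_inv, toWord_inv, h1, h2, h3]
  simp only [invRev_append, invRev_invRev]
  have k1 := key A B
  have k2 := key A X
  have k3 := key (invRev X) B
  have k4 := key (invRev B) (invRev A)
  have k5 := key (invRev X) (invRev A)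
  have k6 := key (invRev B) X
  rw [abs_le] at *
  constructor <;> linarith

lemma abs_qm_conj_le (hφ : ∀ l, |φ l| ≤ C) {g h : F} (hgh : IsConj g h) :
    |qm φ L g - qm φ L h| ≤ 24 * C * L := by
  obtain ⟨c, rfl⟩ := isConj_iff.1 hgh
  have h1 := abs_qm_mul_le (L := L) hφ (c * g) c⁻¹
  have h2 := abs_qm_mul_le (L := L) hφ c g
  rw [qm_inv] at h1
  rw [abs_le] at *
  constructor <;> linarith

end PlaneTC

namespace PlaneTC
open FreeGroup hiding map_one map_inv map_mul

/-- The index shift on the free group on `ℤ`. -/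
def sh (n : ℤ) : F ≃* F := freeGroupCongr (Equiv.addRight n)

@[simp] lemma sh_of (n i : ℤ) : sh n (of i) = of (i + n) := by simp [sh]

lemma hom_ext_of {G : Type*} [Group G] {f g : F →* G} (h : ∀ i, f (of i) = g (of i)) (x : F) :
    f x = g x := by
  rw [FreeGroup.ext_hom f g h]

lemma sh_sh (m n : ℤ) (g : F) : sh m (sh n g) = sh (n + m) g :=
  hom_ext_of (f := (sh m).toMonoidHom.comp (sh n).toMonoidHom) (g := (sh (n + m)).toMonoidHom)
    (fun i => by simp [add_assoc]) g

@[simp] lemma sh_zero (g : F) : sh 0 g = g :=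
  hom_ext_of (f := (sh 0).toMonoidHom) (g := MonoidHom.id F) (fun i => by simp) g

/-- The shift of letters. -/
def shL (n : ℤ) (x : Ltr) : Ltr := (x.1 + n, x.2)

lemma sh_mk (n : ℤ) (l : List Ltr) : sh n (mk l) = mk (l.map (shL n)) := by
  simp only [sh, freeGroupCongr, FreeGroup.map.mk, MulEquiv.coe_mk, Equiv.coe_fn_mk]
  rfl

lemma isReduced_map_shL {n : ℤ} {l : List Ltr} (h : IsReduced l) : IsReduced (l.map (shL n)) := by
  rw [FreeGroup.IsReduced, List.isChain_map]
  refine h.imp fun a b hab => ?_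
  simpa [shL] using hab

lemma toWord_sh (n : ℤ) (g : F) : (sh n g).toWord = g.toWord.map (shL n) := by
  conv_lhs => rw [← mk_toWord (x := g), sh_mk, toWord_mk]
  exact (isReduced_map_shL isReduced_toWord).reduce_eq

lemma norm_sh (n : ℤ) (g : F) : (sh n g).norm = g.norm := by
  rw [FreeGroup.norm, toWord_sh, List.length_map]; rfl

lemma cnt_map {φ : List Ltr → ℤ} {L : ℕ} {f : Ltr → Ltr} (h : ∀ l, φ (l.map f) = φ l)
    (l : List Ltr) : cnt φ L (l.map f) = cnt φ L l := by
  induction l with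
  | nil => rfl
  | cons a l ih =>
    rw [List.map_cons, cnt, cnt, ih, ← List.map_cons, win, win, List.length_map, ← List.map_take, h]

lemma qm_sh {φ : List Ltr → ℤ} {L : ℕ} {n : ℤ} (h : ∀ l, φ (l.map (shL n)) = φ l) (g : F) :
    qm φ L (sh n g) = qm φ L g := by
  rw [qm, qm, ← map_inv, toWord_sh, toWord_sh, cnt_map h, cnt_map h]

open Classical in
/-- The endomorphism killing the generators outside `W`. -/
noncomputable def kill (W : Set ℤ) : F →* F := FreeGroup.lift fun i => if i ∈ W then of i else 1

lemma kill_of_mem {W : Set ℤ} {i : ℤ} (h : i ∈ W) : kill W (of i) = of i := by simp [kill, h]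
lemma kill_of_notMem {W : Set ℤ} {i : ℤ} (h : i ∉ W) : kill W (of i) = 1 := by simp [kill, h]

lemma norm_kill_le (W : Set ℤ) (g : F) : (kill W g).norm ≤ g.norm := by
  have key : ∀ l : List Ltr, (kill W (mk l)).norm ≤ l.length := by
    intro l
    induction l with
    | nil => simp [← one_eq_mk]
    | cons a l ih =>
      rw [← List.singleton_append, ← mul_mk, map_mul, List.length_append]
      refine (FreeGroup.norm_mul_le _ _).trans (add_le_add ?_ ih)
      have h1 : (kill W (of a.1)).norm ≤ 1 := by
        by_cases h : a.1 ∈ W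
        · rw [kill_of_mem h, norm_of]
        · rw [kill_of_notMem h]; simp
      obtain ⟨i, _ | _⟩ := a
      · have : mk [(i, false)] = (of i)⁻¹ := rfl
        rw [this, map_inv, norm_inv_eq]; exact h1
      · exact h1
  conv_lhs => rw [← mk_toWord (x := g)]
  exact key _

/-- The subgroup generated by the letters with index in `W`. -/
def span (W : Set ℤ) : Subgroup F := Subgroup.closure (of '' W)

lemma of_mem_span {W : Set ℤ} {i : ℤ} (h : i ∈ W) : of i ∈ span W :=
  Subgroup.subset_closure (mem_image_of_mem _ h)

lemma span_mono {V W : Set ℤ} (h : V ⊆ W) : span V ≤ span W :=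
  Subgroup.closure_mono (image_mono h)

lemma kill_of_mem_span {W : Set ℤ} {g : F} (h : g ∈ span W) : kill W g = g := by
  induction h using Subgroup.closure_induction with
  | mem x hx => obtain ⟨i, hi, rfl⟩ := hx; exact kill_of_mem hi
  | one => exact map_one _
  | mul x y _ _ hx hy => rw [map_mul, hx, hy]
  | inv x _ hx => rw [_root_.map_inv, hx]

lemma sh_mem_span {W V : Set ℤ} {n : ℤ} (hVW : ∀ i ∈ W, i + n ∈ V) {g : F} (h : g ∈ span W) :
    sh n g ∈ span V := by
  induction h using Subgroup.closure_induction with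
  | mem x hx => obtain ⟨i, hi, rfl⟩ := hx; rw [sh_of]; exact of_mem_span (hVW i hi)
  | one => rw [map_one]; exact one_mem _
  | mul x y _ _ hx hy => rw [map_mul]; exact mul_mem hx hy
  | inv x _ hx => rw [map_inv]; exact inv_mem hx

lemma exists_mem_span (g : F) : ∃ M : ℕ, g ∈ span (Icc (-M) M) := by
  induction g using FreeGroup.induction_on with
  | C1 => exact ⟨0, one_mem _⟩
  | of i => exact ⟨i.natAbs, of_mem_span (by rw [mem_Icc]; omega)⟩
  | inv_of i h => obtain ⟨M, hM⟩ := h; exact ⟨M, inv_mem hM⟩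
  | mul x y hx hy =>
    obtain ⟨M, hM⟩ := hx
    obtain ⟨N, hN⟩ := hy
    refine ⟨M + N, mul_mem (span_mono ?_ hM) (span_mono ?_ hN)⟩ <;>
    · intro i; simp only [mem_Icc]; push_cast; omega

/-- Twisted powers `g · S g · S² g ⋯`. -/
def tp (g : F) : ℕ → F
  | 0 => 1
  | k + 1 => g * sh 2 (tp g k)

lemma tp_add (g : F) (m k : ℕ) : tp g (m + k) = tp g m * sh (2 * m) (tp g k) := by
  induction m with
  | zero => simp [tp]
  | succ m ih =>
    rw [Nat.succ_add, tp, tp, ih, map_mul, sh_sh, mul_assoc]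
    push_cast
    ring_nf

lemma tp_conj (κ g : F) (k : ℕ) : tp (κ * g * (sh 2 κ)⁻¹) k = κ * tp g k * (sh (2 * k) κ)⁻¹ := by
  induction k with
  | zero => simp [tp]
  | succ k ih =>
    rw [tp, tp, ih, map_mul, map_mul, map_inv, sh_sh]
    push_cast
    rw [show (2 * (k : ℤ) + 2) = 2 * (k + 1) by ring]
    group

lemma tp_one (k : ℕ) : tp 1 k = 1 := by
  induction k with
  | zero => rfl
  | succ k ih => simp [tp, ih]

lemma tp_mem_span {g : F} {M : ℕ} (h : g ∈ span (Icc (-M) M)) (k : ℕ) :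
    tp g k ∈ span (Icc (-M) (2 * k + M)) := by
  induction k with
  | zero => exact one_mem _
  | succ k ih =>
    rw [tp]
    refine mul_mem (span_mono ?_ h) (sh_mem_span ?_ ih) <;>
    · intro i; simp only [mem_Icc]; push_cast; omega

/-- The word `e_a e_{a+1} ⋯ e_{a+n-1}`. -/
def seg : ℤ → ℕ → F
  | _, 0 => 1
  | a, n + 1 => of a * seg (a + 1) n

lemma sh_seg (m a : ℤ) (n : ℕ) : sh m (seg a n) = seg (a + m) n := by
  induction n generalizing a with
  | zero => exact map_one _
  | succ n ih => rw [seg, seg, map_mul, sh_of, ih, add_right_comm]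

lemma seg_add (a : ℤ) (m n : ℕ) : seg a (m + n) = seg a m * seg (a + m) n := by
  induction m generalizing a with
  | zero => simp [seg]
  | succ m ih =>
    rw [Nat.succ_add, seg, seg, ih, mul_assoc]
    push_cast
    rw [add_right_comm, add_assoc a]

lemma norm_seg_le (a : ℤ) (n : ℕ) : (seg a n).norm ≤ n := by
  induction n generalizing a with
  | zero => simp [seg]
  | succ n ih =>
    rw [seg]
    have h1 := FreeGroup.norm_mul_le (of a) (seg (a + 1) n)
    have h2 := ih (a + 1)
    rw [norm_of] at h1
    omega

lemma tp_seg (k : ℕ) : tp (of 0 * of 1) k = seg 0 (2 * k) := by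
  induction k with
  | zero => rfl
  | succ k ih => rw [tp, ih, Nat.mul_succ, sh_seg, seg, seg, mul_assoc]; rfl

lemma hom_tp {θ : F →* F} {ω : F} (hθ : ∀ g, θ (sh 2 g) = ω * sh 2 (θ g) * ω⁻¹) (g : F) (k : ℕ) :
    θ (tp g k) = tp (θ g * ω) k * (tp ω k)⁻¹ := by
  induction k with
  | zero => simp [tp]
  | succ k ih =>
    rw [tp, tp, tp, map_mul, hθ, ih, map_mul, map_inv]
    group

section Growth
variable {φ : List Ltr → ℤ} {L : ℕ} {C : ℤ}

lemma qm_mul_near (hφ : ∀ l, |φ l| ≤ C) {g h : F} {n : ℕ} (hn : g.norm ≤ n) :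
    |qm φ L (g * h) - qm φ L h| ≤ 12 * C * L + 2 * C * n ∧
    |qm φ L (h * g) - qm φ L h| ≤ 12 * C * L + 2 * C * n := by
  have hC : 0 ≤ C := (abs_nonneg _).trans (hφ [])
  have h1 := abs_qm_mul_le (L := L) hφ g h
  have h2 := abs_qm_mul_le (L := L) hφ h g
  have h3 : |qm φ L g| ≤ 2 * C * n := (abs_qm_le hφ g).trans (by gcongr)
  rw [abs_le] at h1 h2 h3
  constructor <;> rw [abs_le] <;> constructor <;> linarith

lemma qm_kill_tp (hφ : ∀ l, |φ l| ≤ C) (hS : ∀ n l, φ (l.map (shL n)) = φ l) {p : F} {M : ℕ}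
    (hp : p ∈ span (Icc (-M) M)) {D m : ℕ} (hm : M + D + 1 ≤ m) (k : ℕ) :
    |qm φ L (kill (Ico (D : ℤ) (2 * (k + 2 * m : ℕ) - D)) (tp p (k + 2 * m))) - qm φ L (tp p k)| ≤
      2 * (12 * C * L + 2 * C * (tp p m).norm) := by
  set W : Set ℤ := Ico (D : ℤ) (2 * (k + 2 * m : ℕ) - D) with hW
  have e1 : tp p (k + 2 * m) = tp p m * (sh (2 * m) (tp p k) * sh (2 * k + 2 * m) (tp p m)) := by
    rw [show k + 2 * m = m + (k + m) by ring, tp_add, tp_add, map_mul, sh_sh]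
  have e2 : kill W (sh (2 * m) (tp p k)) = sh (2 * m) (tp p k) := by
    refine kill_of_mem_span (sh_mem_span ?_ (tp_mem_span hp k))
    intro i
    simp only [hW, mem_Icc, mem_Ico]
    push_cast
    omega
  rw [e1, map_mul, map_mul, e2]
  have n1 : (kill W (tp p m)).norm ≤ (tp p m).norm := norm_kill_le _ _
  have n2 : (kill W (sh (2 * k + 2 * m) (tp p m))).norm ≤ (tp p m).norm :=
    (norm_kill_le _ _).trans (norm_sh _ _).le
  have h1 := (qm_mul_near (L := L) hφ (h := sh (2 * m) (tp p k) *
    kill W (sh (2 * k + 2 * m) (tp p m))) n1).1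
  have h2 := (qm_mul_near (L := L) hφ (h := sh (2 * m) (tp p k)) n2).2
  rw [qm_sh (hS _) (tp p k)] at h2
  rw [abs_le] at *
  constructor <;> linarith

/-- Comparison of growth rates of twisted powers. -/
lemma growth_compare (hφ : ∀ l, |φ l| ≤ C) (hS : ∀ n l, φ (l.map (shL n)) = φ l)
    {κ μ ν p q : F} {D : ℕ}
    (H : ∀ k : ℕ, D ≤ k → IsConj (kill (Ico (D : ℤ) (2 * k - D))
      (κ * tp p k * sh (2 * k) μ * (tp q k)⁻¹ * ν)) (seg D (2 * k - 2 * D))) :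
    ∃ B : ℤ, ∀ k, |qm φ L (tp p k) - qm φ L (tp q k) - qm φ L (seg 0 (2 * k))| ≤ B := by
  obtain ⟨M₁, hM₁⟩ := exists_mem_span p
  obtain ⟨M₂, hM₂⟩ := exists_mem_span q
  obtain ⟨m, hm₁, hm₂⟩ : ∃ m, M₁ + D + 1 ≤ m ∧ M₂ + D + 1 ≤ m :=
    ⟨M₁ + M₂ + D + 1, by omega, by omega⟩
  refine ⟨2 * (12 * C * L + 2 * C * (tp p m).norm) + 2 * (12 * C * L + 2 * C * (tp q m).norm) +
    24 * C * L + 4 * (12 * C * L) + 2 * C * κ.norm + 2 * C * μ.norm + 2 * C * ν.norm +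
    (12 * C * L + 2 * C * (4 * m - 2 * D : ℕ)), fun k => ?_⟩
  set K := k + 2 * m with hK
  set W : Set ℤ := Ico (D : ℤ) (2 * (K : ℕ) - D) with hW
  have a1 := qm_kill_tp (L := L) hφ hS hM₁ hm₁ k
  have a2 := qm_kill_tp (L := L) hφ hS hM₂ hm₂ k
  have a3 := abs_qm_conj_le (L := L) hφ (H K (by omega))
  rw [← hK, ← hW] at a1 a2
  rw [← hW] at a3
  simp only [map_mul, map_inv] at a3
  have b1 := (qm_mul_near (L := L) hφ (h := kill W κ * kill W (tp p K) * kill W (sh (2 * K) μ) *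
    (kill W (tp q K))⁻¹) (norm_kill_le W ν)).2
  have b2 := abs_qm_mul_le (L := L) hφ
    (kill W κ * kill W (tp p K) * kill W (sh (2 * K) μ)) (kill W (tp q K))⁻¹
  have b3 := (qm_mul_near (L := L) hφ (h := kill W κ * kill W (tp p K))
    ((norm_kill_le W (sh (2 * K) μ)).trans (norm_sh _ μ).le)).2
  have b4 := (qm_mul_near (L := L) hφ (h := kill W (tp p K)) (norm_kill_le W κ)).1
  have c1 : seg D (2 * K - 2 * D) =
      sh D (seg 0 (2 * k)) * seg (D + (2 * k : ℕ)) (4 * m - 2 * D) := by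
    rw [sh_seg, zero_add, ← seg_add]
    congr 1; omega
  have b5 := (qm_mul_near (L := L) hφ (h := sh D (seg 0 (2 * k)))
    (norm_seg_le (D + (2 * k : ℕ)) (4 * m - 2 * D))).2
  rw [← c1, qm_sh (hS _)] at b5
  rw [qm_inv] at b2
  rw [abs_le] at *
  constructor <;> linarith

end Growth
end PlaneTC

namespace PlaneTC
open FreeGroup hiding map_one map_inv map_mul IsReduced norm_mul_le norm

/-- Twisted powers of words. -/
def lp (l : List Ltr) : ℕ → List Ltr
  | 0 => []
  | k + 1 => l ++ (lp l k).map (shL 2)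

lemma mk_lp (l : List Ltr) (k : ℕ) : mk (lp l k) = tp (mk l) k := by
  induction k with
  | zero => rfl
  | succ k ih => rw [lp, tp, ← ih, sh_mk, mul_mk]

lemma lp_succ_cons (a : Ltr) (t : List Ltr) (k : ℕ) :
    lp (a :: t) (k + 1) = a :: (t ++ (lp (a :: t) k).map (shL 2)) := rfl

lemma isChain_lp {R : Ltr → Ltr → Prop} (hR : ∀ x y, R x y → R (shL 2 x) (shL 2 y)) {a : Ltr}
    {t : List Ltr} (h : List.IsChain R ((a :: t) ++ [shL 2 a])) (k : ℕ) :
    List.IsChain R (lp (a :: t) k) := by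
  rw [List.isChain_append] at h
  obtain ⟨h1, -, h2⟩ := h
  induction k with
  | zero => exact List.isChain_nil
  | succ k ih =>
    rw [lp, List.isChain_append]
    refine ⟨h1, ?_, fun x hx y hy => h2 x hx y ?_⟩
    · rw [List.isChain_map]
      exact ih.imp hR
    · cases k with
      | zero => simp [lp] at hy
      | succ k => rw [lp_succ_cons] at hy; simpa using hy

/-- A word all of whose twisted powers are reduced. -/
def TR (l : List Ltr) : Prop :=
  ∃ a t, l = a :: t ∧ FreeGroup.IsReduced ((a :: t) ++ [shL 2 a])

lemma TR.toWord_tp {l : List Ltr} (h : TR l) (k : ℕ) : (tp (mk l) k).toWord = lp l k := by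
  obtain ⟨a, t, rfl, h⟩ := h
  rw [← mk_lp, toWord_mk]
  refine FreeGroup.IsReduced.reduce_eq (isChain_lp ?_ h k)
  simp [shL]

lemma exists_twisted_reduction (u : F) :
    ∃ κ p, u = κ * p * (sh 2 κ)⁻¹ ∧ (p = 1 ∨ TR p.toWord) := by
  obtain ⟨κ, -, hκ⟩ := WellFounded.has_min (measure fun κ : F => FreeGroup.norm (κ⁻¹ * u * sh 2 κ)).wf univ
    ⟨1, trivial⟩
  set p := κ⁻¹ * u * sh 2 κ with hp
  refine ⟨κ, p, by rw [hp]; group, ?_⟩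
  by_contra! hcon
  obtain ⟨hp1, hTR⟩ := hcon
  obtain ⟨a, t, hat⟩ : ∃ a t, p.toWord = a :: t := List.exists_cons_of_ne_nil (by simpa using hp1)
  have hred : FreeGroup.IsReduced (a :: t) := hat ▸ isReduced_toWord
  have hnot : ¬ FreeGroup.IsReduced ((a :: t) ++ [shL 2 a]) := fun h => hTR ⟨a, t, hat, h⟩
  rw [FreeGroup.IsReduced, List.isChain_append] at hnot
  have hex : ∃ z ∈ (a :: t).getLast?, z.1 = a.1 + 2 ∧ z.2 ≠ a.2 := by
    by_contra! hc
    refine hnot ⟨hred, List.isChain_singleton _, fun x hx y hy hxy => ?_⟩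
    obtain rfl : shL 2 a = y := by simpa using hy
    exact hc x hx hxy
  obtain ⟨z, hz, hz1, hz2⟩ := hex
  have ht : t ≠ [] := by
    rintro rfl
    obtain rfl : a = z := by simpa using hz
    exact hz2 rfl
  obtain ⟨t', z', rfl⟩ : ∃ t' z', t = t' ++ [z'] := ⟨_, _, (List.dropLast_append_getLast ht).symm⟩
  obtain rfl : z' = z := by
    rw [← List.cons_append, List.getLast?_append] at hz
    simpa using hz
  refine hκ (κ * mk [a]) trivial ?_
  change FreeGroup.norm _ < FreeGroup.norm _
  have e : (κ * mk [a])⁻¹ * u * sh 2 (κ * mk [a]) = mk t' := by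
    have e1 : (κ * mk [a])⁻¹ * u * sh 2 (κ * mk [a]) = (mk [a])⁻¹ * p * sh 2 (mk [a]) := by
      rw [hp, map_mul]; group
    have e2 : p = mk [a] * mk t' * mk [z'] := by
      rw [mul_mk, mul_mk, ← mk_toWord (x := p), hat]; simp
    have e3 : mk [z'] = (sh 2 (mk [a]))⁻¹ := by
      rw [sh_mk, inv_mk]
      congr 1
      obtain ⟨z1, z2⟩ := z'
      obtain ⟨a1, a2⟩ := a
      simp only at hz1 hz2
      simp only [invRev, shL, List.map_cons, List.map_nil, List.reverse_singleton, hz1]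
      cases z2 <;> cases a2 <;> simp_all
    rw [e1, e2, e3]; group
  rw [e]
  refine norm_mk_le.trans_lt ?_
  rw [show FreeGroup.norm p = p.toWord.length from rfl, hat]
  simp

/-! ### Total index variation -/

/-- The clamped index difference of a pair of letters. -/
def diffφ (B : ℤ) : List Ltr → ℤ
  | [x, y] => max (-B) (min B (y.1 - x.1))
  | _ => 0

lemma abs_diffφ_le {B : ℤ} (hB : 0 ≤ B) (l : List Ltr) : |diffφ B l| ≤ B := by
  unfold diffφ
  split
  · rw [abs_le]; omega
  · simpa using hB

lemma diffφ_map {B n : ℤ} (l : List Ltr) : diffφ B (l.map (shL n)) = diffφ B l := by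
  rcases l with _ | ⟨x, _ | ⟨y, _ | ⟨z, l⟩⟩⟩ <;> simp [diffφ, shL]

lemma cnt_diffφ {B : ℤ} {a : Ltr} {t : List Ltr}
    (h : List.IsChain (fun x y : Ltr => |y.1 - x.1| ≤ B) (a :: t)) :
    cnt (diffφ B) 2 (a :: t) = ((a :: t).getLast (by simp)).1 - a.1 := by
  induction t generalizing a with
  | nil => simp [cnt, win]
  | cons b t ih =>
    rw [List.isChain_cons_cons] at h
    rw [cnt, ih h.2, List.getLast_cons_cons]
    have := abs_le.1 h.1
    simp only [win, List.length_cons, List.take_succ_cons, List.take_zero, diffφ]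
    rw [if_pos (by omega)]
    omega

lemma qm_diffφ {B : ℤ} {g : F} {l : List Ltr} (hg : g.toWord = l) (hl : l ≠ [])
    (h : List.IsChain (fun x y : Ltr => |y.1 - x.1| ≤ B) l) :
    qm (diffφ B) 2 g = 2 * ((l.getLast hl).1 - (l.head hl).1) := by
  obtain ⟨a, t, rfl⟩ := List.exists_cons_of_ne_nil hl
  have h' : List.IsChain (fun x y : Ltr => |y.1 - x.1| ≤ B) (invRev (a :: t)) := by
    rw [invRev, List.isChain_reverse, List.isChain_map]
    refine h.imp fun x y hxy => ?_
    rwa [abs_sub_comm]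
  have hne : invRev (a :: t) ≠ [] := by simp [invRev]
  obtain ⟨b, s, hs⟩ := List.exists_cons_of_ne_nil hne
  have e1 : (invRev (a :: t)).head hne = ((a :: t).getLast hl |>.1, !((a :: t).getLast hl).2) := by
    simp only [invRev, List.head_reverse, List.getLast_map]
  have e2 : (invRev (a :: t)).getLast hne = (a.1, !a.2) := by
    simp [invRev]
  have := cnt_diffφ (hs ▸ h')
  rw [qm, toWord_inv, hg, cnt_diffφ h, hs, this]
  simp only [hs] at e1 e2
  rw [e2]
  rw [List.head_cons] at e1 ⊢
  rw [e1]
  ring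

lemma exists_getLast_lp (a : Ltr) (t : List Ltr) (k : ℕ) :
    ((lp (a :: t) (k + 1)).getLast (by simp [lp])).1 =
      ((a :: t).getLast (by simp)).1 + 2 * k := by
  induction k with
  | zero => simp [lp]
  | succ k ih =>
    have : ((lp (a :: t) (k + 1)).map (shL 2)) ≠ [] := by simp [lp]
    simp only [lp.eq_2 (a :: t) (k + 1)]
    rw [List.getLast_append_of_ne_nil _ this, List.getLast_map]
    rw [shL, ih]
    push_cast; ring

lemma TR.qm_growth {l : List Ltr} (h : TR l) : ∃ B₀ : ℤ, ∀ B ≥ B₀, ∃ A : ℤ, ∀ k : ℕ,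
    |qm (diffφ B) 2 (tp (mk l) k) - 4 * k| ≤ A := by
  have hb : ∀ m : List Ltr, ∃ B₀ : ℤ, ∀ x ∈ m, |x.1| ≤ B₀ := by
    intro m
    induction m with
    | nil => exact ⟨0, by simp⟩
    | cons a m ih =>
      obtain ⟨B, hB⟩ := ih
      refine ⟨max |a.1| B, fun x hx => ?_⟩
      rcases List.mem_cons.1 hx with rfl | hx
      · exact le_max_left _ _
      · exact (hB x hx).trans (le_max_right _ _)
  have hTR := h
  obtain ⟨a, t, rfl, h⟩ := h
  obtain ⟨B₀, hB₀⟩ := hb ((a :: t) ++ [shL 2 a])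
  refine ⟨2 * B₀, fun B hB => ?_⟩
  have hch : List.IsChain (fun x y : Ltr => |y.1 - x.1| ≤ B) ((a :: t) ++ [shL 2 a]) := by
    refine List.Pairwise.isChain (List.pairwise_of_forall_mem_list ?_)
    intro x hx y hy
    have h1 := abs_le.1 (hB₀ x hx)
    have h2 := abs_le.1 (hB₀ y hy)
    rw [abs_le]; constructor <;> linarith
  refine ⟨|2 * (((a :: t).getLast (by simp)).1 - a.1) - 4|, fun k => ?_⟩
  cases k with
  | zero => simp [tp, qm, cnt]
  | succ k =>
    rw [qm_diffφ (hTR.toWord_tp _) (by simp [lp]) (isChain_lp (by simp [shL]) hch _),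
      exists_getLast_lp]
    have : (lp (a :: t) (k + 1)).head (by simp [lp]) = a := by simp [lp_succ_cons]
    rw [this]
    refine le_of_eq ?_
    congr 1
    push_cast; ring

lemma qm_growth_of (p : F) (hp : p = 1 ∨ TR p.toWord) : ∃ ε : ℤ, 0 ≤ ε ∧ ε ≤ 1 ∧ (ε = 0 → p = 1) ∧
    ∃ B₀ : ℤ, ∀ B ≥ B₀, ∃ A : ℤ, ∀ k : ℕ,
    |qm (diffφ B) 2 (tp p k) - 4 * ε * k| ≤ A := by
  rcases hp with rfl | hp
  · exact ⟨0, le_rfl, zero_le_one, fun _ => rfl, 0, fun B _ => ⟨0, fun k => by simp [tp_one, qm]⟩⟩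
  · refine ⟨1, zero_le_one, le_rfl, fun h => absurd h one_ne_zero, ?_⟩
    have := hp.qm_growth
    rw [mk_toWord] at this
    simpa using this

lemma TR_seg : TR (of 0 * of 1 : F).toWord :=
  ⟨(0, true), [(1, true)], by decide, by simp [FreeGroup.IsReduced, shL]⟩

/-- In a growth comparison, the second twisted power is trivial. -/
lemma eq_one_of_growth {p q : F} (hp : p = 1 ∨ TR p.toWord) (hq : q = 1 ∨ TR q.toWord)
    (H : ∀ (φ : List Ltr → ℤ) (L : ℕ) (C : ℤ), (∀ l, |φ l| ≤ C) →
      (∀ n l, φ (l.map (shL n)) = φ l) →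
      ∃ B : ℤ, ∀ k, |qm φ L (tp p k) - qm φ L (tp q k) - qm φ L (seg 0 (2 * k))| ≤ B) : q = 1 := by
  obtain ⟨ε, h0, h1, -, B₁, hB₁⟩ := qm_growth_of p hp
  obtain ⟨δ, d0, d1, hδ, B₂, hB₂⟩ := qm_growth_of q hq
  obtain ⟨B₃, hB₃⟩ := TR_seg.qm_growth
  set B := |B₁| + |B₂| + |B₃| with hB
  have p1 := abs_nonneg B₁
  have p2 := abs_nonneg B₂
  have p3 := abs_nonneg B₃
  have q1 := le_abs_self B₁
  have q2 := le_abs_self B₂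
  have q3 := le_abs_self B₃
  obtain ⟨A₁, hA₁⟩ := hB₁ B (by linarith)
  obtain ⟨A₂, hA₂⟩ := hB₂ B (by linarith)
  obtain ⟨A₃, hA₃⟩ := hB₃ B (by linarith)
  obtain ⟨A, hA⟩ := H (diffφ B) 2 B (abs_diffφ_le (by positivity)) fun n l => diffφ_map l
  refine hδ (le_antisymm ?_ d0)
  by_contra! hpos
  obtain rfl : δ = 1 := by omega
  set k : ℕ := (A₁ + A₂ + A₃ + A + 1).toNat
  have hk : A₁ + A₂ + A₃ + A + 1 ≤ k := Int.self_le_toNat _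
  have e1 := abs_le.1 (hA₁ k)
  have e2 := abs_le.1 (hA₂ k)
  have e3 := hA₃ k
  rw [mk_toWord, tp_seg] at e3
  have e3 := abs_le.1 e3
  have e4 := abs_le.1 (hA k)
  have hk0 : (0 : ℤ) ≤ k := by positivity
  have : ε * k ≤ k := by nlinarith
  linarith

end PlaneTC

namespace PlaneTC
open FreeGroup hiding map_one map_inv map_mul IsReduced norm_mul_le norm

lemma win_nonneg {φ : List Ltr → ℤ} (hφ : ∀ l, 0 ≤ φ l) (L : ℕ) (l : List Ltr) : 0 ≤ win φ L l := by
  unfold win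
  split
  · exact hφ _
  · exact le_rfl

lemma cnt_nonneg {φ : List Ltr → ℤ} (hφ : ∀ l, 0 ≤ φ l) (L : ℕ) (l : List Ltr) : 0 ≤ cnt φ L l := by
  induction l with
  | nil => exact le_rfl
  | cons a t ih => exact add_nonneg (win_nonneg hφ _ _) ih

lemma cnt_le_append {φ : List Ltr → ℤ} (hφ : ∀ l, 0 ≤ φ l) (L : ℕ) (A R : List Ltr) :
    cnt φ L R ≤ cnt φ L (A ++ R) := by
  induction A with
  | nil => exact le_rfl
  | cons a t ih =>
    exact ih.trans (le_add_of_nonneg_left (win_nonneg hφ _ _))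

lemma exists_infix_of_cnt_ne_zero {φ : List Ltr → ℤ} {L : ℕ} {l : List Ltr} (h : cnt φ L l ≠ 0) :
    ∃ v, v <:+: l ∧ φ v ≠ 0 := by
  induction l with
  | nil => exact absurd rfl h
  | cons a t ih =>
    by_cases ht : cnt φ L t = 0
    · rw [cnt, ht, add_zero, win] at h
      split at h
      · exact ⟨_, ⟨[], _, List.take_append_drop _ _⟩, h⟩
      · exact absurd rfl h
    · obtain ⟨v, hv, hv'⟩ := ih ht
      exact ⟨v, hv.trans (List.suffix_cons a t).isInfix, hv'⟩

open Classical in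
/-- The indicator of the translates of a word. -/
noncomputable def pat (P w : List Ltr) : ℤ := if ∃ n, w = P.map (shL n) then 1 else 0

lemma pat_nonneg (P w : List Ltr) : 0 ≤ pat P w := by unfold pat; split <;> simp
lemma abs_pat_le (P w : List Ltr) : |pat P w| ≤ 1 := by unfold pat; split <;> simp

lemma shL_shL (m n : ℤ) (x : Ltr) : shL m (shL n x) = shL (n + m) x := by
  simp [shL, add_assoc]

lemma map_shL_shL (m n : ℤ) (l : List Ltr) : (l.map (shL n)).map (shL m) = l.map (shL (n + m)) := by
  rw [List.map_map]
  exact List.map_congr_left fun x _ => shL_shL m n x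

lemma map_shL_zero (l : List Ltr) : l.map (shL 0) = l := by
  rw [show shL 0 = id by ext x <;> simp [shL], List.map_id]

lemma pat_map (P : List Ltr) (n : ℤ) (w : List Ltr) : pat P (w.map (shL n)) = pat P w := by
  unfold pat
  congr 1
  refine propext ⟨fun ⟨m, hm⟩ => ⟨m - n, ?_⟩, fun ⟨m, hm⟩ => ⟨m + n, ?_⟩⟩
  · have := congrArg (List.map (shL (-n))) hm
    rwa [map_shL_shL, map_shL_shL, add_neg_cancel, map_shL_zero, ← sub_eq_add_neg] at this
  · rw [hm, map_shL_shL]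

lemma le_cnt_lp (a : Ltr) (t : List Ltr) (k : ℕ) :
    (k : ℤ) ≤ cnt (pat (a :: t ++ [shL 2 a])) (t.length + 2) (lp (a :: t) (k + 1)) := by
  set P := a :: t ++ [shL 2 a] with hP
  induction k with
  | zero => simpa using cnt_nonneg (pat_nonneg P) _ _
  | succ k ih =>
    set R := (lp (a :: t) (k + 1)).map (shL 2) with hR
    have e : lp (a :: t) (k + 1 + 1) = a :: (t ++ R) := rfl
    have h1 : (k : ℤ) ≤ cnt (pat P) (t.length + 2) (t ++ R) := by
      refine (ih.trans (le_of_eq ?_)).trans (cnt_le_append (pat_nonneg P) _ t R)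
      exact (cnt_map (pat_map P 2) _).symm
    have h2 : win (pat P) (t.length + 2) (a :: (t ++ R)) = 1 := by
      obtain ⟨R', hR'⟩ : ∃ R', R = shL 2 a :: R' := ⟨_, by rw [hR, lp_succ_cons, List.map_cons]⟩
      have : (a :: (t ++ R)).take (t.length + 2) = P := by
        rw [hR', hP]
        simp [List.take_append]
      rw [win, if_pos (by simp [hR']), this, pat, if_pos ⟨0, (map_shL_zero P).symm⟩]
    rw [e, cnt, h2]
    push_cast
    linarith

lemma lp_getElem? (l : List Ltr) (k i : ℕ) {x y : Ltr} (hx : (lp l k)[i]? = some x)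
    (hy : (lp l k)[i + l.length]? = some y) : y = shL 2 x := by
  induction k generalizing i x y with
  | zero => simp [lp] at hx
  | succ k ih =>
    rw [lp, List.getElem?_append_right (by omega), Nat.add_sub_cancel, List.getElem?_map] at hy
    obtain ⟨y', hy', rfl⟩ := Option.map_eq_some_iff.1 hy
    congr 1
    by_cases hi : i < l.length
    · rw [lp, List.getElem?_append_left hi] at hx
      cases k with
      | zero => simp [lp] at hy'
      | succ k =>
        rw [lp, List.getElem?_append_left hi, hx] at hy'
        exact (Option.some_injective _ hy').symm
    · push Not at hi
      obtain ⟨j, rfl⟩ := Nat.exists_eq_add_of_le' hi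
      rw [lp, List.getElem?_append_right (by omega), Nat.add_sub_cancel, List.getElem?_map] at hx
      obtain ⟨x', hx', rfl⟩ := Option.map_eq_some_iff.1 hx
      exact ih j hx' hy'

lemma cnt_invRev_lp (a : Ltr) (t : List Ltr) (k : ℕ) :
    cnt (pat (a :: t ++ [shL 2 a])) (t.length + 2) (invRev (lp (a :: t) k)) = 0 := by
  by_contra h
  obtain ⟨v, hv, hv'⟩ := exists_infix_of_cnt_ne_zero h
  obtain ⟨n, rfl⟩ : ∃ n, v = (a :: t ++ [shL 2 a]).map (shL n) := by
    by_contra hc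
    exact hv' (if_neg hc)
  obtain ⟨s, r, hsr⟩ := hv
  have := congrArg invRev hsr
  rw [invRev_invRev, invRev_append, invRev_append] at this
  set q : Ltr → Ltr := fun x => (x.1, !x.2)
  have e : invRev ((a :: t ++ [shL 2 a]).map (shL n)) =
      q (shL n (shL 2 a)) :: ((t.map (shL n)).map q).reverse ++ [q (shL n a)] := by
    simp [invRev, q]
  rw [e] at this
  have h1 : (lp (a :: t) k)[(invRev r).length]? = some (q (shL n (shL 2 a))) := by
    rw [← this]; simp
  have h2 : (lp (a :: t) k)[(invRev r).length + (a :: t).length]? = some (q (shL n a)) := by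
    rw [← this]
    rw [List.getElem?_append_right (by omega), Nat.add_sub_cancel_left]
    simp
  have := congrArg Prod.fst (lp_getElem? _ _ _ h1 h2)
  simp [q, shL] at this
  omega

lemma exists_of_growth {l : List Ltr} (hl : TR l)
    (H : ∀ (φ : List Ltr → ℤ) (L : ℕ) (C : ℤ), (∀ l, |φ l| ≤ C) →
      (∀ n l, φ (l.map (shL n)) = φ l) →
      ∃ B : ℤ, ∀ k, |qm φ L (tp (mk l) k) - qm φ L (seg 0 (2 * k))| ≤ B) :
    ∃ b, l = [(b, true), (b + 1, true)] := by
  have hTR := hl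
  obtain ⟨a, t, rfl, -⟩ := hl
  set P := a :: t ++ [shL 2 a] with hP
  obtain ⟨B, hB⟩ := H (pat P) (t.length + 2) 1 (abs_pat_le P) (pat_map P)
  set k := B.toNat + 1
  have hk : B + 1 ≤ k := by have := Int.self_le_toNat B; push_cast [k]; omega
  have h1 := abs_le.1 (hB (k + 1))
  rw [qm, toWord_inv, hTR.toWord_tp, cnt_invRev_lp, sub_zero] at h1
  have h2 := le_cnt_lp a t k
  have h3 : cnt (pat P) (t.length + 2) (seg 0 (2 * (k + 1))).toWord ≠ 0 := by
    intro h
    have := cnt_nonneg (pat_nonneg P) (t.length + 2) (seg 0 (2 * (k + 1)))⁻¹.toWord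
    rw [qm, h] at h1
    linarith
  obtain ⟨v, hv, hv'⟩ := exists_infix_of_cnt_ne_zero h3
  obtain ⟨n, rfl⟩ : ∃ n, v = P.map (shL n) := by
    by_contra hc
    exact hv' (if_neg hc)
  let R : Ltr → Ltr → Prop := fun x y => x.2 = true ∧ y.1 = x.1 + 1 ∧ y.2 = true
  have hR : List.IsChain R (seg 0 (2 * (k + 1))).toWord := by
    rw [← tp_seg, show (of 0 * of 1 : F) = mk [(0, true), (1, true)] from rfl]
    rw [TR.toWord_tp ((show (of 0 * of 1 : F).toWord = [(0, true), (1, true)] by decide) ▸ TR_seg)]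
    refine isChain_lp ?_ ?_ _
    · rintro x y ⟨h1, h2, h3⟩
      refine ⟨h1, ?_, h3⟩
      simp only [shL, h2]; ring
    · simp [R, shL]
  obtain ⟨u, w, huw⟩ := hv
  have hR' := (huw ▸ hR).left_of_append.right_of_append
  rw [List.isChain_map] at hR'
  replace hR' : List.IsChain R P := by
    refine hR'.imp ?_
    rintro x y ⟨h1, h2, h3⟩
    refine ⟨h1, ?_, h3⟩
    simp only [shL] at h2; omega
  rw [hP] at hR'
  rcases t with _ | ⟨b, _ | ⟨c, t⟩⟩
  · simp [R, shL] at hR'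
  · obtain ⟨a1, a2⟩ := a
    obtain ⟨b1, b2⟩ := b
    simp [R, shL] at hR'
    refine ⟨a1, ?_⟩
    simp [hR']
  · exfalso
    simp only [List.cons_append, List.isChain_cons_cons] at hR'
    obtain ⟨h1, h2, h3⟩ := hR'
    have h4 : List.IsChain (fun x y : Ltr => x.1 < y.1) (c :: (t ++ [shL 2 a])) :=
      h3.imp fun x y h => by have := h.2.1; omega
    have : IsTrans Ltr (fun x y : Ltr => x.1 < y.1) := ⟨fun _ _ _ => lt_trans⟩
    have h5 := (List.pairwise_cons.1 (List.isChain_iff_pairwise.1 h4)).1 (shL 2 a) (by simp)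
    have := h1.2.1
    have := h2.2.1
    simp only [shL] at h5
    omega

end PlaneTC

namespace PlaneTC
open FreeGroup hiding map_one map_inv map_mul IsReduced norm_mul_le norm

/-- Algebraic half twist exchanging `2n` and `2n+1`. -/
def A0 : F →* F :=
  FreeGroup.lift fun i => if Even i then of i * of (i + 1) * (of i)⁻¹ else of (i - 1)
/-- Inverse of `A0`. -/
def A0' : F →* F :=
  FreeGroup.lift fun i => if Even i then of (i + 1) else (of i)⁻¹ * of (i - 1) * of i
/-- Algebraic half twist exchanging `2n-1` and `2n`. -/
def A1 : F →* F :=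
  FreeGroup.lift fun i => if Even i then of (i - 1) else of i * of (i + 1) * (of i)⁻¹
/-- Inverse of `A1`. -/
def A1' : F →* F :=
  FreeGroup.lift fun i => if Even i then (of i)⁻¹ * of (i - 1) * of i else of (i + 1)

/-- The hypotheses on the automorphism induced by a homeomorphism whose class commutes with
the translation class. -/
structure Adm (θ : F →* F) (π : ℤ → ℤ) (ω : F) : Prop where
  per : ∀ i, π (i + 2) = π i + 2
  conj : ∀ i, ∃ v, θ (of i) = v * of (π i) * v⁻¹
  comm : ∀ g, θ (sh 2 g) = ω * sh 2 (θ g) * ω⁻¹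
  star : ∀ (c : ℤ) (m : ℕ) (a : ℤ) (n : ℕ),
    (∀ i, π i ∈ Ico c (c + m) → i ∈ Ico a (a + n)) →
    IsConj (kill (Ico c (c + m)) (θ (seg a n))) (seg c m)

variable {θ : F →* F} {π : ℤ → ℤ} {ω : F}

lemma abs_sub_le_of_per (h : ∀ i, π (i + 2) = π i + 2) (i : ℤ) :
    |π i - i| ≤ max |π 0| |π 1 - 1| := by
  have key : ∀ r (n : ℕ), π (r + 2 * n) = π r + 2 * n ∧ π (r - 2 * n) = π r - 2 * n := by
    intro r n
    induction n with
    | zero => simp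
    | succ n ih =>
      constructor
      · rw [show r + 2 * ((n + 1 : ℕ) : ℤ) = r + 2 * n + 2 by push_cast; ring, h, ih.1]
        push_cast; ring
      · have := h (r - 2 * ((n + 1 : ℕ) : ℤ))
        rw [show r - 2 * ((n + 1 : ℕ) : ℤ) + 2 = r - 2 * n by push_cast; ring, ih.2] at this
        push_cast at this ⊢
        linarith
  have key' : ∀ r n : ℤ, π (r + 2 * n) = π r + 2 * n := by
    intro r n
    obtain ⟨m, rfl | rfl⟩ := n.eq_nat_or_neg
    · exact (key r m).1
    · have := (key r m).2
      rw [mul_neg, ← sub_eq_add_neg, this]; ring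
  rcases Int.even_or_odd' i with ⟨n, rfl | rfl⟩
  · have := key' 0 n
    rw [zero_add] at this
    rw [this]
    simp
  · rw [add_comm (2 * n), key']
    rw [show π 1 + 2 * n - (1 + 2 * n) = π 1 - 1 by ring]
    exact le_max_right _ _

lemma Adm.growth (h : Adm θ π ω) {κ μ ν p q : F}
    (e : ∀ k, θ (seg 0 (2 * k)) = κ * tp p k * sh (2 * k) μ * (tp q k)⁻¹ * ν)
    (φ : List Ltr → ℤ) (L : ℕ) (C : ℤ) (hφ : ∀ l, |φ l| ≤ C)
    (hS : ∀ n l, φ (l.map (shL n)) = φ l) :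
    ∃ B : ℤ, ∀ k, |qm φ L (tp p k) - qm φ L (tp q k) - qm φ L (seg 0 (2 * k))| ≤ B := by
  set D : ℕ := (max |π 0| |π 1 - 1|).toNat with hD
  have hD' : ∀ i, |π i - i| ≤ D := fun i =>
    (abs_sub_le_of_per h.per i).trans (Int.self_le_toNat _)
  refine growth_compare (κ := κ) (μ := μ) (ν := ν) (D := D) hφ hS fun k hk => ?_
  rw [← e, show (2 * k - D : ℤ) = D + (2 * k - 2 * D : ℕ) by omega]
  refine h.star _ _ _ _ fun i hi => ?_
  have := abs_le.1 (hD' i)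
  simp only [mem_Ico] at hi ⊢
  push_cast
  omega

lemma Adm.exists_twist (h : Adm θ π ω) : ∃ lam, ω = lam * (sh 2 lam)⁻¹ := by
  obtain ⟨κ, p, hp, hp'⟩ := exists_twisted_reduction (θ (of 0 * of 1) * ω)
  obtain ⟨lam, q, hq, hq'⟩ := exists_twisted_reduction ω
  have e : ∀ k, θ (seg 0 (2 * k)) =
      κ * tp p k * sh (2 * k) (κ⁻¹ * lam) * (tp q k)⁻¹ * lam⁻¹ := by
    intro k
    rw [← tp_seg, hom_tp h.comm, hp, tp_conj]
    conv_lhs => rw [hq, tp_conj]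
    rw [map_mul, map_inv]
    group
  have := eq_one_of_growth hp' hq' (h.growth e)
  exact ⟨lam, by rw [this, mul_one] at hq; exact hq⟩

/-- `v` does not end in a letter of index `x`. -/
def NoEnd (v : F) (x : ℤ) : Prop := ∀ y ∈ v.toWord.getLast?, y.1 ≠ x

lemma exists_noEnd_step {v : F} {x : ℤ} (h : ¬ NoEnd v x) :
    ∃ v', v'.norm < v.norm ∧ v' * of x * v'⁻¹ = v * of x * v⁻¹ := by
  unfold NoEnd at h
  push Not at h
  obtain ⟨⟨y, b⟩, hy, rfl⟩ := h
  have hne : v.toWord ≠ [] := by rintro h; simp [h] at hy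
  obtain ⟨t, z, ht⟩ : ∃ t z, v.toWord = t ++ [z] :=
    ⟨_, _, (List.dropLast_append_getLast hne).symm⟩
  rw [ht] at hy
  obtain rfl : z = (y, b) := by simpa using hy
  have hv : v = mk t * mk [(y, b)] := by rw [mul_mk, ← ht, mk_toWord]
  refine ⟨mk t, ?_, ?_⟩
  · refine norm_mk_le.trans_lt ?_
    rw [FreeGroup.norm, ht]; simp
  · rw [hv]
    have : mk [(y, b)] * of y * (mk [(y, b)])⁻¹ = of y := by
      cases b
      · rw [show mk [(y, false)] = (of y : F)⁻¹ from rfl]; group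
      · rw [show mk [(y, true)] = (of y : F) from rfl]; group
    calc mk t * of y * (mk t)⁻¹ = mk t * (mk [(y, b)] * of y * (mk [(y, b)])⁻¹) * (mk t)⁻¹ := by
          rw [this]
      _ = _ := by group

lemma norm_junction {v r : F} {x : ℤ} {b : Bool} (hv : NoEnd v x) (hr : (x, b) ∈ r.toWord.head?) :
    (v * mk [(x, !b)] * r).norm < (v * r).norm := by
  obtain ⟨r', hr'⟩ : ∃ r', r.toWord = (x, b) :: r' := by
    cases h : r.toWord with
    | nil => simp [h] at hr
    | cons a t => rw [h] at hr; simp at hr; exact ⟨t, by rw [hr]⟩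
  have e1 : (v * r).toWord = v.toWord ++ r.toWord := by
    rw [toWord_mul]
    refine FreeGroup.IsReduced.reduce_eq ?_
    rw [FreeGroup.IsReduced, List.isChain_append]
    refine ⟨isReduced_toWord, isReduced_toWord, fun y hy z hz hyz => ?_⟩
    rw [hr'] at hz
    obtain rfl : (x, b) = z := by simpa using hz
    exact absurd hyz (hv y hy)
  have e2 : v * mk [(x, !b)] * r = v * mk r' := by
    have : r = mk [(x, b)] * mk r' := by rw [mul_mk, ← mk_toWord (x := r), hr']; rfl
    rw [this]
    have : mk [(x, !b)] = (mk [(x, b)])⁻¹ := by rw [inv_mk]; rfl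
    rw [this]; group
  rw [e2]
  have h1 := FreeGroup.norm_mul_le v (mk r')
  have h2 := norm_mk_le (L₁ := r')
  have h3 : (v * r).norm = v.norm + r.norm := by simp [FreeGroup.norm, e1]
  have h4 : r.norm = r'.length + 1 := by simp [FreeGroup.norm, hr']
  omega

lemma noEnd_sh {v : F} {x n : ℤ} (h : NoEnd v x) : NoEnd (sh n v) (x + n) := by
  intro y hy
  rw [toWord_sh, List.getLast?_map] at hy
  obtain ⟨z, hz, rfl⟩ := Option.map_eq_some_iff.1 hy
  have := h z hz
  simpa [shL] using this

lemma eq_one_of_sh {v : F} (h : sh 2 v = v) : v = 1 := by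
  have := congrArg toWord h
  rw [toWord_sh] at this
  cases hw : v.toWord with
  | nil => exact toWord_eq_nil_iff.1 hw
  | cons a t =>
    rw [hw] at this
    simp [shL] at this
    have := congrArg Prod.fst this.1
    simp at this

lemma head?_inv {g : F} {x : ℤ} {b : Bool} (h : (x, b) ∈ g.toWord.getLast?) :
    (x, !b) ∈ g⁻¹.toWord.head? := by
  rw [toWord_inv, invRev, List.head?_reverse, List.getLast?_map, Option.mem_def.1 h]
  rfl

/-- The word of a conjugated pair is twisted reduced unless one of four reductions applies. -/
lemma tr_of {x y : ℤ} {r0 r1 : F} (h1 : (x, false) ∉ r0.toWord.head?)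
    (h2 : (y, false) ∉ r0.toWord.getLast?) (h3 : (y, false) ∉ r1.toWord.head?)
    (h4 : (x + 2, false) ∉ r1.toWord.getLast?) :
    TR ((x, true) :: (r0.toWord ++ (y, true) :: r1.toWord)) := by
  refine ⟨_, _, rfl, ?_⟩
  have aux : ∀ {x y : ℤ} {r : F} {t : List Ltr}, (x, false) ∉ r.toWord.head? →
      (y, false) ∉ r.toWord.getLast? → FreeGroup.IsReduced ((y, true) :: t) →
      FreeGroup.IsReduced ((x, true) :: (r.toWord ++ (y, true) :: t)) := by
    intro x y r t h1 h2 h3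
    rw [← List.cons_append, FreeGroup.IsReduced, List.isChain_append]
    refine ⟨?_, h3, ?_⟩
    · rw [List.isChain_cons]
      refine ⟨?_, isReduced_toWord⟩
      rintro ⟨z, b⟩ hz rfl
      cases b
      · exact absurd hz h1
      · rfl
    · rintro ⟨z, b⟩ hz w hw hzw
      obtain rfl : (y, true) = w := by simpa using hw
      simp only at hzw
      subst hzw
      cases b
      · cases h : r.toWord with
        | nil => rw [h] at hz; simp at hz
        | cons a s =>
          rw [h] at hz h2
          rw [List.getLast?_cons_cons] at hz
          exact absurd hz h2
      · rfl
  have : (x, true) :: (r0.toWord ++ (y, true) :: r1.toWord) ++ [shL 2 (x, true)] =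
      (x, true) :: (r0.toWord ++ (y, true) :: (r1.toWord ++ (x + 2, true) :: [])) := by
    simp [shL]
  rw [this]
  exact aux h1 h2 (aux h3 h4 (List.isChain_singleton _))

/-- Data carried along the reduction of an automorphism commuting with the shift. -/
structure Red (θ' ψ : F →* F) (x y : ℤ) (v0 v1 : F) : Prop where
  comm : ∀ g, ψ (sh 2 g) = sh 2 (ψ g)
  h0 : ψ (of 0) = v0 * of x * v0⁻¹
  h1 : ψ (of 1) = v1 * of y * v1⁻¹
  twist : ∃ β, ψ (of 0 * of 1) = β * θ' (of 0 * of 1) * (sh 2 β)⁻¹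

lemma Red.h2 {θ' ψ : F →* F} {x y : ℤ} {v0 v1 : F} (h : Red θ' ψ x y v0 v1) :
    ψ (of 2) = sh 2 v0 * of (x + 2) * (sh 2 v0)⁻¹ := by
  have := h.comm (of 0)
  rw [h.h0] at this
  simpa using this

lemma Red.hneg {θ' ψ : F →* F} {x y : ℤ} {v0 v1 : F} (h : Red θ' ψ x y v0 v1) :
    ψ (of (-1)) = sh (-2) v1 * of (y - 2) * (sh (-2) v1)⁻¹ := by
  have := h.comm (of (-1))
  rw [sh_of, show (-1 + 2 : ℤ) = 1 by norm_num, h.h1] at this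
  have := congrArg (sh (-2)) this
  rw [sh_sh] at this
  simpa [sub_eq_add_neg] using this.symm

lemma comm_A {A : F →* F} (h : ∀ i, A (sh 2 (of i)) = sh 2 (A (of i))) (g : F) :
    A (sh 2 g) = sh 2 (A g) :=
  hom_ext_of (f := A.comp (sh 2).toMonoidHom) (g := (sh 2).toMonoidHom.comp A) h g

lemma A0_comm (g : F) : A0 (sh 2 g) = sh 2 (A0 g) := by
  refine comm_A (fun i => ?_) g
  by_cases h : Even i <;> simp [A0, h] <;> ring_nf
lemma A0'_comm (g : F) : A0' (sh 2 g) = sh 2 (A0' g) := by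
  refine comm_A (fun i => ?_) g
  by_cases h : Even i <;> simp [A0', h] <;> ring_nf
lemma A1_comm (g : F) : A1 (sh 2 g) = sh 2 (A1 g) := by
  refine comm_A (fun i => ?_) g
  by_cases h : Even i <;> simp [A1, h] <;> ring_nf
lemma A1'_comm (g : F) : A1' (sh 2 g) = sh 2 (A1' g) := by
  refine comm_A (fun i => ?_) g
  by_cases h : Even i <;> simp [A1', h] <;> ring_nf

lemma Red.step {θ' ψ A : F →* F} {x y x' y' : ℤ} {v0 v1 v0' v1' : F} (h : Red θ' ψ x y v0 v1)
    (hA : ∀ g, A (sh 2 g) = sh 2 (A g)) (h0 : ψ (A (of 0)) = v0' * of x' * v0'⁻¹)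
    (h1 : ψ (A (of 1)) = v1' * of y' * v1'⁻¹) (α : F)
    (hα : A (of 0 * of 1) = α * (of 0 * of 1) * (sh 2 α)⁻¹) :
    Red θ' (ψ.comp A) x' y' v0' v1' where
  comm g := by rw [MonoidHom.comp_apply, hA, h.comm]; rfl
  h0 := h0
  h1 := h1
  twist := by
    obtain ⟨β, hβ⟩ := h.twist
    refine ⟨ψ α * β, ?_⟩
    rw [MonoidHom.comp_apply, hα, map_mul, map_mul ψ α, map_inv, h.comm, hβ, map_mul (sh 2)]
    group

lemma Red.reduce {Good : (F →* F) → Prop} (hA0 : ∀ s, Good s → Good (s.comp A0))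
    (hA0' : ∀ s, Good s → Good (s.comp A0')) (hA1 : ∀ s, Good s → Good (s.comp A1))
    (hA1' : ∀ s, Good s → Good (s.comp A1')) {θ' : F →* F}
    (H : ∀ l, TR l → (∃ β, FreeGroup.mk l = β * θ' (of 0 * of 1) * (sh 2 β)⁻¹) →
      ∃ b, l = [(b, true), (b + 1, true)]) (n : ℕ) :
    ∀ (s : F →* F) (x y : ℤ) (v0 v1 : F), Good s → Red θ' (θ'.comp s) x y v0 v1 →
      v0.norm + v1.norm < n → ∃ s, Good s ∧ ∃ b, ∀ i, θ' (s (of i)) = of (i + b) := by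
  induction n with
  | zero => intro s x y v0 v1 _ _ h; omega
  | succ n ih =>
    intro s x y v0 v1 hs hr hn
    by_cases c0 : NoEnd v0 x
    swap
    · obtain ⟨v', hv, hv'⟩ := exists_noEnd_step c0
      exact ih s x y v' v1 hs ⟨hr.comm, by rw [hr.h0, hv'], hr.h1, hr.twist⟩ (by omega)
    by_cases c1 : NoEnd v1 y
    swap
    · obtain ⟨v', hv, hv'⟩ := exists_noEnd_step c1
      exact ih s x y v0 v' hs ⟨hr.comm, hr.h0, by rw [hr.h1, hv'], hr.twist⟩ (by omega)
    set r0 := v0⁻¹ * v1 with hr0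
    set r1 := v1⁻¹ * sh 2 v0 with hr1
    by_cases d1 : (x, false) ∈ r0.toWord.head?
    · have := norm_junction c0 d1
      rw [hr0, mul_inv_cancel_left] at this
      refine ih (s.comp A0) y x (v0 * of x * (v0⁻¹ * v1)) v0 (hA0 s hs)
        (hr.step A0_comm ?_ ?_ 1 ?_) (by change (v0 * of x * (v0⁻¹ * v1)).norm < _ at this; omega)
      · have : A0 (of 0) = of 0 * of 1 * (of 0)⁻¹ := by simp [A0]
        rw [this, map_mul, map_mul, map_inv, hr.h0, hr.h1]; group
      · have : A0 (of 1) = of 0 := by simp [A0]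
        rw [this, hr.h0]
      · simp [A0]
    by_cases d2 : (y, false) ∈ r0.toWord.getLast?
    · have := norm_junction c1 (head?_inv d2)
      have e : v1 * r0⁻¹ = v0 := by rw [hr0]; group
      rw [e, hr0] at this
      refine ih (s.comp A0') y x v1 (v1 * (of y)⁻¹ * (v0⁻¹ * v1)⁻¹) (hA0' s hs)
        (hr.step A0'_comm ?_ ?_ 1 ?_)
        (by change (v1 * (of y)⁻¹ * (v0⁻¹ * v1)⁻¹).norm < _ at this; omega)
      · have : A0' (of 0) = of 1 := by simp [A0']
        rw [this, hr.h1]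
      · have : A0' (of 1) = (of 1)⁻¹ * of 0 * of 1 := by simp [A0']
        rw [this, map_mul, map_mul, map_inv, hr.h0, hr.h1]; group
      · simp [A0']; group
    by_cases d3 : (y, false) ∈ r1.toWord.head?
    · have := norm_junction c1 d3
      rw [hr1, mul_inv_cancel_left, norm_sh] at this
      have h2 := norm_sh (-2) v1
      refine ih (s.comp A1) (y - 2) (x + 2) (sh (-2) v1) (v1 * of y * (v1⁻¹ * sh 2 v0)) (hA1 s hs)
        (hr.step A1_comm ?_ ?_ (of (-1) * (of 0)⁻¹) ?_)
        (by change (v1 * of y * (v1⁻¹ * sh 2 v0)).norm < _ at this; omega)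
      · have : A1 (of 0) = of (-1) := by simp [A1]
        rw [this, hr.hneg]
      · have : A1 (of 1) = of 1 * of 2 * (of 1)⁻¹ := by simp [A1]
        rw [this, map_mul, map_mul, map_inv, hr.h2, hr.h1]; group
      · simp [A1]; group
    by_cases d4 : (x + 2, false) ∈ r1.toWord.getLast?
    · have := norm_junction (noEnd_sh (n := 2) c0) (head?_inv d4)
      have e : sh 2 v0 * r1⁻¹ = v1 := by rw [hr1]; group
      rw [e, hr1] at this
      have h2 := norm_sh (-2) (sh 2 v0 * (of (x + 2))⁻¹ * (v1⁻¹ * sh 2 v0)⁻¹)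
      have h3 := norm_sh 2 v0
      refine ih (s.comp A1') (y - 2) (x + 2)
        (sh (-2) (sh 2 v0 * (of (x + 2))⁻¹ * (v1⁻¹ * sh 2 v0)⁻¹)) (sh 2 v0) (hA1' s hs)
        (hr.step A1'_comm ?_ ?_ ((of 0)⁻¹ * of (-1)) ?_)
        (by change (sh 2 v0 * (of (x + 2))⁻¹ * (v1⁻¹ * sh 2 v0)⁻¹).norm < _ at this; omega)
      · have : A1' (of 0) = (of 0)⁻¹ * of (-1) * of 0 := by simp [A1']
        rw [this, map_mul, map_mul, map_inv, hr.h0, hr.hneg]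
        simp only [map_mul, map_inv, sh_sh, sh_of]
        simp
        group
      · have : A1' (of 1) = of 2 := by simp [A1']
        rw [this, hr.h2]
      · simp [A1']; group
    obtain ⟨β, hβ⟩ := hr.twist
    obtain ⟨b, hb⟩ := H _ (tr_of d1 d2 d3 d4) ⟨v0⁻¹ * β, by
      have e : FreeGroup.mk ((x, true) :: (r0.toWord ++ (y, true) :: r1.toWord)) =
          of x * (r0 * (of y * r1)) := by
        conv_rhs => rw [← mk_toWord (x := r0), ← mk_toWord (x := r1)]
        simp only [of, mul_mk]
        rfl
      rw [e, hr0, hr1, map_mul (sh 2)]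
      rw [map_mul, hr.h0, hr.h1] at hβ
      have : β * θ' (of 0 * of 1) = v0 * of x * v0⁻¹ * (v1 * of y * v1⁻¹) * sh 2 β := by
        rw [hβ]; group
      rw [mul_assoc v0⁻¹ β, this, map_inv]; group⟩
    have hlen := congrArg List.length hb
    simp at hlen
    have z0 : r0.toWord = [] := List.length_eq_zero_iff.1 (by omega)
    have z1 : r1.toWord = [] := List.length_eq_zero_iff.1 (by omega)
    rw [z0, z1] at hb
    simp at hb
    obtain ⟨rfl, rfl⟩ := hb
    have w0 := toWord_eq_nil_iff.1 z0
    have w1 := toWord_eq_nil_iff.1 z1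
    rw [hr0, inv_mul_eq_one] at w0
    rw [hr1, inv_mul_eq_one, ← w0] at w1
    have := eq_one_of_sh w1.symm
    subst this
    subst w0
    refine ⟨s, hs, x, ?_⟩
    have k0 : θ' (s (of 0)) = of (0 + x) := by simpa using hr.h0
    have k1 : θ' (s (of 1)) = of (1 + x) := by simpa [add_comm] using hr.h1
    have kS : ∀ i, θ' (s (of (i + 2))) = sh 2 (θ' (s (of i))) := fun i => by
      simpa using hr.comm (of i)
    have key : ∀ i : ℤ, θ' (s (of i)) = of (i + x) → ∀ n : ℕ, θ' (s (of (i + 2 * n))) = of (i + 2 * n + x) ∧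
        θ' (s (of (i - 2 * n))) = of (i - 2 * n + x) := by
      intro i hi n
      induction n with
      | zero => simpa using hi
      | succ n ih =>
        constructor
        · rw [show i + 2 * ((n + 1 : ℕ) : ℤ) = i + 2 * n + 2 by push_cast; ring, kS, ih.1, sh_of]
          ring_nf
        · refine (sh 2).injective ?_
          rw [← kS, sh_of, show i - 2 * ((n + 1 : ℕ) : ℤ) + 2 = i - 2 * n by push_cast; ring, ih.2]
          push_cast; ring_nf
    intro i
    rcases Int.even_or_odd' i with ⟨m, rfl | rfl⟩ <;> obtain ⟨k, rfl | rfl⟩ := m.eq_nat_or_neg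
    · simpa using (key 0 k0 k).1
    · simpa using (key 0 k0 k).2
    · rw [add_comm (2 * (k : ℤ)) 1]; exact (key 1 k1 k).1
    · rw [mul_neg, add_comm (-(2 * (k : ℤ))) 1, ← sub_eq_add_neg]; exact (key 1 k1 k).2

/-- An admissible endomorphism is, up to half twists and conjugation, a shift of the generators. -/
theorem Adm.exists_shift (h : Adm θ π ω) {Good : (F →* F) → Prop} (h1 : Good (MonoidHom.id F))
    (hA0 : ∀ s, Good s → Good (s.comp A0))
    (hA0' : ∀ s, Good s → Good (s.comp A0')) (hA1 : ∀ s, Good s → Good (s.comp A1))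
    (hA1' : ∀ s, Good s → Good (s.comp A1')) :
    ∃ s, Good s ∧ ∃ lam b, ∀ i, θ (s (of i)) = lam * of (i + b) * lam⁻¹ := by
  obtain ⟨lam, hlam⟩ := h.exists_twist
  set θ' : F →* F := (MulAut.conj lam⁻¹).toMonoidHom.comp θ with hθ'
  have e' : ∀ g, θ' g = lam⁻¹ * θ g * lam := fun g => by simp [hθ']
  have hc : ∀ g, θ' (sh 2 g) = sh 2 (θ' g) := by
    intro g
    rw [e', e', h.comm, hlam, map_mul, map_mul, map_inv]; group
  have H : ∀ l, TR l → (∃ β, FreeGroup.mk l = β * θ' (of 0 * of 1) * (sh 2 β)⁻¹) →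
      ∃ b, l = [(b, true), (b + 1, true)] := by
    rintro l hl ⟨β, hβ⟩
    refine exists_of_growth hl fun φ L C hφ hS => ?_
    have e : ∀ k, θ (seg 0 (2 * k)) =
        (lam * β⁻¹) * tp (FreeGroup.mk l) k * sh (2 * k) β * (tp 1 k)⁻¹ * lam⁻¹ := by
      intro k
      have h1 := hom_tp (θ := θ') (ω := 1) (fun g => by simp [hc]) (of 0 * of 1) k
      rw [tp_one, inv_one, mul_one, mul_one, tp_seg, e'] at h1
      rw [hβ, tp_conj, tp_one, ← h1]
      group
    obtain ⟨B, hB⟩ := h.growth e φ L C hφ hS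
    refine ⟨B, fun k => ?_⟩
    have := hB k
    rwa [tp_one, show qm φ L 1 = 0 by simp [qm], sub_zero] at this
  obtain ⟨v0, hv0⟩ := h.conj 0
  obtain ⟨v1, hv1⟩ := h.conj 1
  obtain ⟨s, hs, b, hb⟩ := Red.reduce hA0 hA0' hA1 hA1' H _ (MonoidHom.id F) (π 0) (π 1)
    (lam⁻¹ * v0) (lam⁻¹ * v1) h1 ⟨hc, by rw [MonoidHom.comp_id, e', hv0]; group, by rw [MonoidHom.comp_id, e', hv1]; group,
      1, by simp⟩ (Nat.lt_succ_self _)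
  refine ⟨s, hs, lam, b, fun i => ?_⟩
  rw [← hb, e']; group

end PlaneTC

namespace PlaneTC
open FreeGroup (of)
open Topology unitInterval

/-- The positive words `e₀ ⋯ e₋₁`-type coordinates: `pw i * (pw (i+1))⁻¹ = e_i`, `pw 0 = 1`. -/
noncomputable def pw (i : ℤ) : F := if 0 ≤ i then (seg 0 i.toNat)⁻¹ else seg i (-i).toNat

lemma seg_succ (a : ℤ) (n : ℕ) : seg a (n + 1) = seg a n * of (a + n) := by
  rw [seg_add]
  simp [seg]

lemma seg_succ' (a : ℤ) (n : ℕ) : seg a (n + 1) = of a * seg (a + 1) n := by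
  rw [add_comm, seg_add]
  simp [seg]

lemma pw_zero : pw 0 = 1 := by simp [pw, seg]

lemma pw_rec (i : ℤ) : pw i = of i * pw (i + 1) := by
  rcases lt_trichotomy i (-1) with h | rfl | h
  · rw [pw, pw, if_neg (by omega), if_neg (by omega),
      show (-i).toNat = (-(i + 1)).toNat + 1 by omega, seg_succ']
  · simp [pw, seg]
  · rw [pw, pw, if_pos (by omega), if_pos (by omega),
      show (i + 1).toNat = i.toNat + 1 by omega, seg_succ, mul_inv_rev, ← mul_assoc,
      show (0 : ℤ) + i.toNat = i by omega, mul_inv_cancel, one_mul]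

lemma pw_induction {P : ℤ → Prop} (h0 : P 0) (h1 : ∀ i, P i → P (i + 1))
    (h2 : ∀ i, P (i + 1) → P i) (i : ℤ) : P i := by
  induction i using Int.induction_on with
  | zero => exact h0
  | succ n ih => exact h1 _ ih
  | pred n ih => exact h2 _ (by simpa using ih)

lemma sh_pw (n i : ℤ) : sh n (pw i) = pw (i + n) * (pw n)⁻¹ := by
  induction i using pw_induction with
  | h0 => simp [pw_zero]
  | h1 i ih =>
    rw [pw_rec i, pw_rec (i + n), map_mul, sh_of, mul_assoc] at ih
    rw [mul_left_cancel ih]; ring_nf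
  | h2 i ih =>
    rw [pw_rec i, pw_rec (i + n), map_mul, sh_of, ih]
    simp [mul_assoc, add_right_comm]

lemma seg_eq_pw (a : ℤ) (n : ℕ) : seg a n = pw a * (pw (a + n))⁻¹ := by
  induction n with
  | zero => simp [seg]
  | succ n ih =>
    rw [seg_succ, ih, pw_rec (a + n)]
    push_cast
    simp [mul_assoc, add_assoc]

/-- The coordinate of the vertical strip containing `z`. -/
noncomputable def ph (z : ℂ) : F := pw ⌈z.re⌉

/-- The points off the upward slits. -/
def Up (W : Set ℤ) : Set ℂ := {z | 0 < z.im ∨ ∀ k ∈ W, z.re ≠ k}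
/-- The points off the downward slits... -/
def Lo (W : Set ℤ) : Set ℂ := {z | z.im < 0 ∨ ∀ k ∈ W, z.re ≠ k}
/-- The complement of the punctures. -/
def Av (W : Set ℤ) : Set ℂ := {z | ∀ k ∈ W, z ≠ (k : ℤ)}

variable {W V : Set ℤ}

lemma isOpen_re : IsOpen {z : ℂ | ∀ k ∈ W, z.re ≠ (k : ℤ)} := by
  have h : IsClosed (((↑) : ℤ → ℝ) '' W) :=
    Int.isClosedEmbedding_coe_real.isClosedMap _ (isClosed_discrete W)
  have := (h.preimage Complex.continuous_re).isOpen_compl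
  convert this using 1
  ext z
  simp only [mem_ofPred_eq, mem_compl_iff, mem_preimage, mem_image, not_exists, not_and]
  exact forall₂_congr fun k _ => by rw [ne_comm]

lemma isOpen_Up : IsOpen (Up W) :=
  (isOpen_lt continuous_const Complex.continuous_im).union isOpen_re

lemma isOpen_Lo : IsOpen (Lo W) :=
  (isOpen_lt Complex.continuous_im continuous_const).union isOpen_re

lemma Up_union_Lo : Up W ∪ Lo W = Av W := by
  ext z
  constructor
  · rintro ((h | h) | (h | h)) k hk rfl <;> first | exact h k hk (by simp) | simp at h
  · intro h
    rcases lt_trichotomy z.im 0 with h0 | h0 | h0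
    · exact Or.inr (Or.inl h0)
    · exact Or.inl (Or.inr fun k hk e => h k hk (Complex.ext (by simpa using e) (by simpa using h0)))
    · exact Or.inl (Or.inl h0)

lemma mem_re_of_mem {z : ℂ} (h1 : z ∈ Up W) (h2 : z ∈ Lo W) : ∀ k ∈ W, z.re ≠ (k : ℤ) := by
  rcases h1 with h1 | h1
  · rcases h2 with h2 | h2
    · linarith
    · exact h2
  · exact h1

lemma kill_ph_eventually {z : ℂ} (h : ∀ k ∈ W, z.re ≠ (k : ℤ)) :
    ∀ᶠ w in 𝓝 z, kill W (ph w) = kill W (ph z) := by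
  by_cases hz : ∃ k : ℤ, z.re = k
  · obtain ⟨k, hk⟩ := hz
    have hkW : k ∉ W := fun h' => h k h' hk
    have h1 : ∀ᶠ w : ℂ in 𝓝 z, w.re ∈ Ioo (k - 1 : ℝ) (k + 1) :=
      Complex.continuous_re.continuousAt.eventually_mem (Ioo_mem_nhds (by linarith) (by linarith))
    have h2 : kill W (pw k) = kill W (pw (k + 1)) := by
      rw [pw_rec k, map_mul, kill_of_notMem hkW, one_mul]
    filter_upwards [h1] with w hw
    have : ⌈z.re⌉ = k := by rw [hk]; simp
    rw [ph, ph, this]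
    rcases le_or_gt w.re k with h | h
    · rw [show ⌈w.re⌉ = k from Int.ceil_eq_iff.2 ⟨hw.1, h⟩]
    · rw [show ⌈w.re⌉ = k + 1 from Int.ceil_eq_iff.2 ⟨by push_cast; linarith, by push_cast; linarith [hw.2]⟩, h2]
  · have h1 : ∀ᶠ w : ℂ in 𝓝 z, w.re ∈ Ioo (⌈z.re⌉ - 1 : ℝ) ⌈z.re⌉ := by
      refine Complex.continuous_re.continuousAt.eventually_mem (Ioo_mem_nhds ?_ ?_)
      · linarith [Int.ceil_lt_add_one z.re]
      · exact lt_of_le_of_ne (Int.le_ceil _) fun h => hz ⟨_, h⟩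
    filter_upwards [h1] with w hw
    rw [ph, ph, show ⌈w.re⌉ = ⌈z.re⌉ from Int.ceil_eq_iff.2 ⟨hw.1, hw.2.le⟩]

variable {X : Type*} [TopologicalSpace X]

/-- `u` is a lift of `f` to the free covering of the complement of `W`. -/
def IsLift (W : Set ℤ) (f : X → ℂ) (u : X → F) : Prop := ∀ x,
  (f x ∈ Lo W → ∀ᶠ y in 𝓝 x, u y = u x) ∧
  (f x ∈ Up W → ∀ᶠ y in 𝓝 x, u y * kill W (ph (f y)) = u x * kill W (ph (f x)))

lemma IsLift.comp {Y : Type*} [TopologicalSpace Y] {f : X → ℂ} {u : X → F} (h : IsLift W f u)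
    {g : Y → X} (hg : Continuous g) : IsLift W (f ∘ g) (u ∘ g) := fun y =>
  ⟨fun hy => hg.continuousAt.eventually ((h (g y)).1 hy),
    fun hy => hg.continuousAt.eventually ((h (g y)).2 hy)⟩

lemma IsLift.mul_left {f : X → ℂ} {u : X → F} (h : IsLift W f u) (v : F) :
    IsLift W f (fun x => v * u x) := fun x =>
  ⟨fun hx => ((h x).1 hx).mono fun y hy => by simp only [hy],
    fun hx => ((h x).2 hx).mono fun y hy => by simp only [mul_assoc, hy]⟩

lemma isLift_const (z : ℂ) : IsLift W (fun _ : X => z) (fun _ => 1) := fun _ =>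
  ⟨fun _ => by simp, fun _ => by simp⟩

lemma isLift_of_Lo {f : X → ℂ} (hf : Continuous f) (h : ∀ x, f x ∈ Lo W) :
    IsLift W f (fun _ => 1) := fun x =>
  ⟨fun _ => by simp, fun hx => by
    filter_upwards [hf.continuousAt.eventually (kill_ph_eventually (mem_re_of_mem hx (h x)))]
      with y hy
    rw [hy]⟩

lemma isLift_of_Up {f : X → ℂ} (hf : Continuous f) (h : ∀ x, f x ∈ Up W) :
    IsLift W f (fun x => (kill W (ph (f x)))⁻¹) := fun x =>
  ⟨fun hx => by
    filter_upwards [hf.continuousAt.eventually (kill_ph_eventually (mem_re_of_mem (h x) hx))]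
      with y hy
    rw [hy], fun hx => by simp⟩

lemma IsLift.eq [PreconnectedSpace X] {f : X → ℂ} {u v : X → F} (hf : ∀ x, f x ∈ Av W)
    (hu : IsLift W f u) (hv : IsLift W f v) (x y : X) :
    (u x)⁻¹ * u y = (v x)⁻¹ * v y := by
  have h : IsLocallyConstant fun x => v x * (u x)⁻¹ := by
    refine (IsLocallyConstant.iff_eventually_eq _).2 fun x => ?_
    rcases Up_union_Lo (W := W) ▸ hf x with h | h
    · filter_upwards [(hu x).2 h, (hv x).2 h] with y h1 h2
      calc _ = (v y * kill W (ph (f y))) * (u y * kill W (ph (f y)))⁻¹ := by group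
        _ = _ := by rw [h1, h2]; group
    · filter_upwards [(hu x).1 h, (hv x).1 h] with y h1 h2
      rw [h1, h2]
  have := h.apply_eq_of_preconnectedSpace x y
  rw [← mul_right_inj (v x), ← mul_assoc, this]
  group

lemma kill_kill (h : W ⊆ V) (g : F) : kill W (kill V g) = kill W g := by
  change ((kill W).comp (kill V)) g = kill W g
  refine hom_ext_of (fun i => ?_) g
  by_cases hV : i ∈ V
  · simp [kill_of_mem hV]
  · simp [kill_of_notMem hV, kill_of_notMem fun h' => hV (h h')]

lemma Up_anti (h : W ⊆ V) : Up V ⊆ Up W := fun _ hz => hz.imp_right fun hz k hk => hz k (h hk)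
lemma Lo_anti (h : W ⊆ V) : Lo V ⊆ Lo W := fun _ hz => hz.imp_right fun hz k hk => hz k (h hk)
lemma Av_anti (h : W ⊆ V) : Av V ⊆ Av W := fun _ hz k hk => hz k (h hk)

lemma IsLift.kill (hVW : W ⊆ V) {f : X → ℂ} {u : X → F} (hf : Continuous f)
    (hfV : ∀ x, f x ∈ Av V) (h : IsLift V f u) : IsLift W f (fun x => kill W (u x)) := by
  intro x
  rcases Up_union_Lo (W := V) ▸ hfV x with hx | hx
  · have := (h x).2 hx
    have h2 : ∀ᶠ y in 𝓝 x, PlaneTC.kill W (u y) * PlaneTC.kill W (ph (f y)) =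
        PlaneTC.kill W (u x) * PlaneTC.kill W (ph (f x)) := by
      filter_upwards [this] with y hy
      have := congrArg (PlaneTC.kill W) hy
      simpa [kill_kill hVW] using this
    refine ⟨fun hl => ?_, fun _ => h2⟩
    filter_upwards [h2, hf.continuousAt.eventually
      (kill_ph_eventually (mem_re_of_mem (Up_anti hVW hx) hl))] with y h1 h3
    rw [h3] at h1
    exact mul_right_cancel h1
  · have h2 : ∀ᶠ y in 𝓝 x, PlaneTC.kill W (u y) = PlaneTC.kill W (u x) := by
      filter_upwards [(h x).1 hx] with y hy
      rw [hy]
    refine ⟨fun hl => h2, fun hu => ?_⟩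
    filter_upwards [h2, hf.continuousAt.eventually
      (kill_ph_eventually (mem_re_of_mem hu (Lo_anti hVW hx)))] with y h1 h3
    rw [h1, h3]

lemma kill_univ (g : F) : kill univ g = g := by
  change kill univ g = MonoidHom.id F g
  exact hom_ext_of (fun i => by simp [kill_of_mem (mem_univ i)]) g

lemma IsLift.sh (n : ℤ) {f : X → ℂ} {u : X → F} (h : IsLift univ f u) :
    IsLift univ (fun x => f x + n) (fun x => sh n (u x)) := by
  have hL : ∀ z : ℂ, z + n ∈ Lo univ → z ∈ Lo univ := fun z hz => by
    refine hz.imp (fun h => by simpa using h) fun h k _ e => h (k + n) trivial (by simp [e])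
  have hU : ∀ z : ℂ, z + n ∈ Up univ → z ∈ Up univ := fun z hz => by
    refine hz.imp (fun h => by simpa using h) fun h k _ e => h (k + n) trivial (by simp [e])
  have hp : ∀ z : ℂ, ph (z + n) = PlaneTC.sh n (ph z) * pw n := fun z => by
    rw [ph, ph, sh_pw]; simp
  refine fun x => ⟨fun hx => ((h x).1 (hL _ hx)).mono fun y hy => by simp only [hy],
    fun hx => ((h x).2 (hU _ hx)).mono fun y hy => ?_⟩
  simp only [kill_univ, hp] at hy ⊢
  rw [← mul_assoc, ← mul_assoc, ← map_mul, ← map_mul, hy]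

end PlaneTC

namespace PlaneTC
open FreeGroup (of)
open Topology unitInterval

variable {W V : Set ℤ} {X : Type*} [TopologicalSpace X]

local instance : TopologicalSpace F := ⊥
local instance : DiscreteTopology F := ⟨rfl⟩

/-- The coordinate change from the chart `i` to the chart `j`; `true` stands for `Up`. -/
noncomputable def chg (W : Set ℤ) (i j : Bool) (z : ℂ) (v : F) : F :=
  v * ((bif i then (kill W (ph z))⁻¹ else 1) * (bif j then kill W (ph z) else 1))

lemma chg_eq (i j : Bool) (z : ℂ) (v : F) :
    chg W i j z v = chg W i false z v * chg W false j z 1 := by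
  simp [chg, mul_assoc]

open Classical in
/-- The free covering of the complement of `W`. -/
noncomputable def core (W : Set ℤ) : FiberBundleCore Bool (Av W) F where
  baseSet i := Subtype.val ⁻¹' (bif i then Up W else Lo W)
  isOpen_baseSet i := by
    cases i
    · exact isOpen_Lo.preimage continuous_subtype_val
    · exact isOpen_Up.preimage continuous_subtype_val
  indexAt z := if (z : ℂ) ∈ Lo W then false else true
  mem_baseSet_at z := by
    have h := Up_union_Lo.symm.subset z.2
    by_cases h' : (z : ℂ) ∈ Lo W <;> simp_all
  coordChange i j z := chg W i j z
  coordChange_self i z _ v := by cases i <;> simp [chg]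
  continuousOn_coordChange i j := by
    rintro ⟨z, v⟩ hz
    refine ContinuousAt.continuousWithinAt ?_
    refine continuousAt_of_tendsto_nhds (y := chg W i j z v) ?_
    rw [nhds_discrete F, Filter.tendsto_pure, nhds_prod_eq, nhds_discrete F]
    have h0 : ∀ᶠ w : Av W in 𝓝 z, chg W i j w v = chg W i j z v := by
      by_cases hij : i = j
      · subst hij
        refine Filter.Eventually.of_forall fun w => ?_
        cases i <;> simp [chg]
      · have : ∀ k ∈ W, (z : ℂ).re ≠ (k : ℤ) := by
          cases i <;> cases j
          · exact absurd rfl hij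
          · exact mem_re_of_mem hz.1.2 hz.1.1
          · exact mem_re_of_mem hz.1.1 hz.1.2
          · exact absurd rfl hij
        filter_upwards [continuous_subtype_val.continuousAt.eventually (kill_ph_eventually this)]
          with w hw
        rw [chg, chg, hw]
    rw [Filter.prod_pure, Filter.eventually_map]
    exact h0
  coordChange_comp i j k z _ v := by
    cases i <;> cases j <;> cases k <;> simp [chg]

lemma exists_lift [SimplyConnectedSpace X] [LocallyPathConnectedSpace X] {f : X → ℂ}
    (hf : Continuous f) (hW : ∀ x, f x ∈ Av W) : ∃ u, IsLift W f u := by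
  classical
  have hcov : IsCoveringMap (core W).proj := FiberBundle.isCoveringMap (F := F) (E := (core W).Fiber)
  let f' : C(X, Av W) := ⟨fun x => ⟨f x, hW x⟩, by fun_prop⟩
  obtain ⟨x0⟩ : Nonempty X := inferInstance
  obtain ⟨G, ⟨-, hG⟩, -⟩ := hcov.existsUnique_continuousMap_lifts f' x0
    (⟨f' x0, (1 : F)⟩ : (core W).TotalSpace) rfl
  have hG' : ∀ x, (G x).proj = f' x := fun x => congrFun hG x
  have key : ∀ (i : Bool) x, f x ∈ (bif i then Up W else Lo W) → ∀ᶠ y in 𝓝 x,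
      ((core W).localTriv i (G y)).2 = ((core W).localTriv i (G x)).2 := by
    intro i x hx
    have h1 : G x ∈ ((core W).localTriv i).source := by
      rw [FiberBundleCore.mem_localTriv_source, hG']
      exact hx
    have h2 : ContinuousAt (fun y => ((core W).localTriv i (G y)).2) x :=
      continuous_snd.continuousAt.comp
        ((((core W).localTriv i).continuousAt h1).comp G.continuous.continuousAt)
    have h3 := h2.tendsto
    rw [nhds_discrete F, Filter.tendsto_pure] at h3
    exact h3
  have hval : ∀ (i : Bool) x, ((core W).localTriv i (G x)).2 =
      ((core W).localTriv false (G x)).2 * chg W false i (f x) 1 := by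
    intro i x
    rw [FiberBundleCore.localTriv_apply, FiberBundleCore.localTriv_apply]
    have : ((G x).proj : ℂ) = f x := by rw [hG']; rfl
    rw [← this]
    exact chg_eq _ i _ _
  refine ⟨fun x => ((core W).localTriv false (G x)).2, fun x => ⟨fun hx => key false x hx, fun hx => ?_⟩⟩
  filter_upwards [key true x hx] with y hy
  rw [hval, hval true x] at hy
  simpa [chg] using hy

lemma exists_lift_I {f : I → ℂ} (hf : Continuous f) (hW : ∀ x, f x ∈ Av W) :
    ∃ u, IsLift W f u := by
  obtain ⟨u, hu⟩ := exists_lift (X := ℝ) (f := fun t => f (projIcc 0 1 zero_le_one t))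
    (hf.comp continuous_projIcc) fun _ => hW _
  have := hu.comp (g := ((↑) : I → ℝ)) continuous_subtype_val
  exact ⟨_, by simpa [Function.comp_def] using this⟩

lemma exists_lift_II {f : I × I → ℂ} (hf : Continuous f) (hW : ∀ x, f x ∈ Av W) :
    ∃ u, IsLift W f u := by
  obtain ⟨u, hu⟩ := exists_lift (X := ℝ × ℝ) (f := fun t => f (projIcc 0 1 zero_le_one t.1,
    projIcc 0 1 zero_le_one t.2))
    (hf.comp ((continuous_projIcc.comp continuous_fst).prodMk
      (continuous_projIcc.comp continuous_snd))) fun _ => hW _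
  have := hu.comp (g := fun p : I × I => ((p.1 : ℝ), (p.2 : ℝ))) (by fun_prop)
  exact ⟨_, by simpa [Function.comp_def] using this⟩

open Classical in
/-- The word of a path in the complement of `W`. -/
noncomputable def wd (W : Set ℤ) (f : I → ℂ) : F :=
  if h : ∃ u, IsLift W f u then (h.choose 0)⁻¹ * h.choose 1 else 1

lemma IsLift.wd_eq {f : I → ℂ} {u : I → F} (h : IsLift W f u) (hf : ∀ t, f t ∈ Av W) :
    wd W f = (u 0)⁻¹ * u 1 := by
  have : ∃ u, IsLift W f u := ⟨u, h⟩
  rw [wd, dif_pos this]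
  exact this.choose_spec.eq hf h 0 1

lemma IsLift.wd_comp {f : X → ℂ} {u : X → F} (h : IsLift W f u) (hf : ∀ t, f t ∈ Av W)
    {c : I → X} (hc : Continuous c) : wd W (fun t => f (c t)) = (u (c 0))⁻¹ * u (c 1) :=
  (h.comp hc).wd_eq fun t => hf (c t)

lemma wd_square {H : I × I → ℂ} (hH : Continuous H) (hW : ∀ x, H x ∈ Av W) :
    wd W (fun t => H (0, t)) * wd W (fun s => H (s, 1)) =
      wd W (fun s => H (s, 0)) * wd W (fun t => H (1, t)) := by
  obtain ⟨u, hu⟩ := exists_lift_II hH hW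
  rw [hu.wd_comp hW (c := fun t => (0, t)) (by fun_prop),
    hu.wd_comp hW (c := fun t => (t, 1)) (by fun_prop),
    hu.wd_comp hW (c := fun t => (t, 0)) (by fun_prop),
    hu.wd_comp hW (c := fun t => (1, t)) (by fun_prop)]
  group

lemma wd_kill (h : W ⊆ V) {f : I → ℂ} (hf : Continuous f) (hV : ∀ x, f x ∈ Av V) :
    wd W f = kill W (wd V f) := by
  obtain ⟨u, hu⟩ := exists_lift_I hf hV
  rw [hu.wd_eq hV, (hu.kill h hf hV).wd_eq fun t => Av_anti h (hV t)]
  simp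

lemma wd_of_Lo {f : I → ℂ} (hf : Continuous f) (h : ∀ x, f x ∈ Lo W) : wd W f = 1 := by
  rw [(isLift_of_Lo hf h).wd_eq fun t => Up_union_Lo (W := W) ▸ Or.inr (h t)]
  simp

lemma wd_of_Up {f : I → ℂ} (hf : Continuous f) (h : ∀ x, f x ∈ Up W) :
    wd W f = kill W (ph (f 0) * (ph (f 1))⁻¹) := by
  rw [(isLift_of_Up hf h).wd_eq fun t => Up_union_Lo (W := W) ▸ Or.inl (h t)]
  simp

lemma wd_const {z : ℂ} (hz : z ∈ Av W) : wd W (fun _ => z) = 1 := by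
  rw [(isLift_const z).wd_eq fun t => hz]
  simp

lemma Av_univ_add (n : ℤ) {z : ℂ} (hz : z ∈ Av univ) : z + n ∈ Av univ := fun k _ h =>
  hz (k - n) trivial (by push_cast; rw [← h]; ring)

lemma wd_add (n : ℤ) {f : I → ℂ} (hf : Continuous f) (hW : ∀ x, f x ∈ Av univ) :
    wd univ (fun t => f t + n) = sh n (wd univ f) := by
  obtain ⟨u, hu⟩ := exists_lift_I hf hW
  rw [hu.wd_eq hW, (hu.sh n).wd_eq fun t => Av_univ_add n (hW t)]
  simp

variable {x y z : ℂ}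

lemma wd_trans {γ : Path x y} {δ : Path y z} (hγ : ∀ t, γ t ∈ Av W) (hδ : ∀ t, δ t ∈ Av W) :
    wd W (γ.trans δ) = wd W γ * wd W δ := by
  have h : ∀ t, γ.trans δ t ∈ Av W := fun t => by
    rw [Path.trans_apply]
    split_ifs
    · exact hγ _
    · exact hδ _
  obtain ⟨u, hu⟩ := exists_lift_I (γ.trans δ).continuous h
  rw [hu.wd_eq h]
  have h1 := hu.wd_comp h (c := fun t : I => ⟨t / 2, by have := t.2; constructor <;> linarith [t.2.1, t.2.2]⟩) (by fun_prop)
  have h2 := hu.wd_comp h (c := fun t : I => ⟨(1 + t) / 2, by have := t.2; constructor <;> linarith [t.2.1, t.2.2]⟩) (by fun_prop)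
  have e1 : (fun t : I => γ.trans δ ⟨t / 2, by have := t.2; constructor <;> linarith [t.2.1, t.2.2]⟩) = γ := by
    ext1 t
    rw [Path.trans_apply, dif_pos (by simp only; linarith [t.2.2])]
    congr 1
    ext
    simp only
    ring
  have e2 : (fun t : I => γ.trans δ ⟨(1 + t) / 2, by have := t.2; constructor <;> linarith [t.2.1, t.2.2]⟩) = δ := by
    ext1 t
    rw [Path.trans_apply]
    split_ifs with ht
    · simp only at ht
      have ht0 : t = 0 := le_antisymm (Subtype.coe_le_coe.1 (by simp; linarith)) t.2.1
      subst ht0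
      rw [δ.source]
      convert γ.target
      norm_num
    · congr 1
      ext
      simp only
      ring
  rw [e1] at h1
  rw [e2] at h2
  rw [h1, h2]
  have a1 : (⟨((0 : I) : ℝ) / 2, by norm_num⟩ : I) = 0 := by ext; simp
  have a2 : (⟨(1 + ((1 : I) : ℝ)) / 2, by norm_num⟩ : I) = 1 := by ext; norm_num
  have a3 : (⟨((1 : I) : ℝ) / 2, by norm_num⟩ : I) = ⟨(1 + ((0 : I) : ℝ)) / 2, by norm_num⟩ := by
    ext; norm_num
  simp only [a1, a2, a3]
  group

lemma wd_symm {γ : Path x y} (hγ : ∀ t, γ t ∈ Av W) : wd W γ.symm = (wd W γ)⁻¹ := by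
  obtain ⟨u, hu⟩ := exists_lift_I γ.continuous hγ
  have := hu.wd_comp hγ (c := σ) (by fun_prop)
  rw [show (γ.symm : I → ℂ) = fun t => γ (σ t) from rfl, this, hu.wd_eq hγ]
  simp

lemma wd_homotopy {γ δ : Path x y} (H : γ.Homotopy δ) (hH : ∀ p, H p ∈ Av W) :
    wd W γ = wd W δ := by
  have h := wd_square H.continuous hH
  have hx : x ∈ Av W := by simpa using hH (0, 0)
  have hy : y ∈ Av W := by simpa using hH (0, 1)
  simp only [H.apply_zero, H.apply_one, H.source, H.target, wd_const hx, wd_const hy] at h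
  simpa using h

end PlaneTC

namespace PlaneTC
open FreeGroup (of)
open Topology unitInterval

lemma exists_holonomy (X : Type) [TopologicalSpace X] [PathConnectedSpace X] :
    ∃ (G : Type) (_ : Group G) (φ : ∀ {x y : X}, Path x y → G),
      (∀ {x y z : X} (γ : Path x y) (δ : Path y z), φ (γ.trans δ) = φ γ * φ δ) ∧
      ∀ {x y : X} (γ δ : Path x y), φ γ = φ δ ↔ γ.Homotopic δ := by
  obtain ⟨b⟩ : Nonempty X := inferInstance
  let τ : ∀ x, Path.Homotopic.Quotient b x := fun x => .mk (PathConnectedSpace.somePath b x)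
  refine ⟨(FundamentalGroup X b)ᵐᵒᵖ, inferInstance,
    fun {x y} γ => MulOpposite.op (FundamentalGroup.fromPath
      (((τ x).trans (.mk γ)).trans (τ y).symm)), ?_, ?_⟩
  · intro x y z γ δ
    have h : ((τ x).trans (.mk (γ.trans δ))).trans (τ z).symm =
        (((τ x).trans (.mk γ)).trans (τ y).symm).trans (((τ y).trans (.mk δ)).trans (τ z).symm) := by
      simp only [Path.Homotopic.Quotient.mk_trans, Path.Homotopic.Quotient.trans_assoc]
      rw [← Path.Homotopic.Quotient.trans_assoc (τ y).symm, Path.Homotopic.Quotient.symm_trans,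
        Path.Homotopic.Quotient.refl_trans]
    exact congrArg (fun q => MulOpposite.op (FundamentalGroup.fromPath q)) h
  · intro x y γ δ
    rw [MulOpposite.op_inj, ← Path.Homotopic.Quotient.eq]
    refine ⟨fun h => ?_, fun h => by rw [h]⟩
    have h' := congrArg (fun q : Path.Homotopic.Quotient b b => ((τ x).symm.trans q).trans (τ y)) h
    simp only [Path.Homotopic.Quotient.trans_assoc, Path.Homotopic.Quotient.symm_trans,
      Path.Homotopic.Quotient.trans_refl] at h'
    rw [← Path.Homotopic.Quotient.trans_assoc, ← Path.Homotopic.Quotient.trans_assoc,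
      Path.Homotopic.Quotient.symm_trans, Path.Homotopic.Quotient.refl_trans,
      Path.Homotopic.Quotient.refl_trans] at h'
    exact h'

variable {W : Set ℤ}

/-- The domains `Up` and `Lo`, according to the sign `ε`. -/
def Hf (ε : ℝ) (W : Set ℤ) : Set ℂ := {z | 0 < ε * z.im ∨ ∀ k ∈ W, z.re ≠ k}

lemma Up_eq : Up W = Hf 1 W := by simp [Up, Hf]
lemma Lo_eq : Lo W = Hf (-1) W := by simp [Lo, Hf]

lemma Hf_simplyConnected {ε : ℝ} (hε : ε = 1 ∨ ε = -1) : SimplyConnectedSpace (Hf ε W) := by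
  have hε2 : ε * ε = 1 := by rcases hε with rfl | rfl <;> norm_num
  suffices ContractibleSpace (Hf ε W) from inferInstance
  rw [contractible_iff_id_nullhomotopic]
  let m : ℂ → I → ℂ := fun z s => z + ((s * (1 + |z.im|) * ε : ℝ) : ℂ) * Complex.I
  have him : ∀ z s, ε * (m z s).im = ε * z.im + s * (1 + |z.im|) := fun z s => by
    simp only [m, Complex.add_im, Complex.mul_im, Complex.ofReal_re, Complex.I_im, Complex.I_re,
      Complex.ofReal_im]
    linear_combination (s : ℝ) * (1 + |z.im|) * hε2
  have hre : ∀ z s, (m z s).re = z.re := fun z s => by simp [m]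
  have habs : ∀ z : ℂ, -|z.im| ≤ ε * z.im := fun z => by
    rcases hε with rfl | rfl
    · simpa using neg_abs_le z.im
    · simpa using le_abs_self z.im
  have hm : ∀ z s, z ∈ Hf ε W → m z s ∈ Hf ε W := fun z s hz => by
    refine hz.imp (fun h => ?_) fun h => by rwa [hre]
    rw [him]
    have := s.2.1
    positivity
  have hm1 : ∀ z, 0 < ε * (m z 1).im := fun z => by
    rw [him]
    have := habs z
    simp
    linarith
  let n : ℂ → I → ℂ := fun z s => ((1 - s : ℝ) : ℂ) * m z 1 + ((s * ε : ℝ) : ℂ) * Complex.I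
  have hn : ∀ z s, n z s ∈ Hf ε W := fun z s => by
    left
    have h1 : ε * (n z s).im = (1 - s) * (ε * (m z 1).im) + s := by
      simp only [n, Complex.add_im, Complex.mul_im, Complex.ofReal_re, Complex.I_im, Complex.I_re,
        Complex.ofReal_im]
      linear_combination (s : ℝ) * hε2
    rw [h1]
    rcases eq_or_lt_of_le s.2.2 with h | h
    · rw [h]; norm_num
    · have := hm1 z
      have := s.2.1
      have : 0 < 1 - (s : ℝ) := by linarith
      positivity
  refine ⟨⟨(ε : ℂ) * Complex.I, Or.inl (by simp [hε2])⟩, ?_⟩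
  let M : C(Hf ε W, Hf ε W) := ⟨fun z => ⟨m z 1, hm _ _ z.2⟩, by fun_prop⟩
  have h1 : (ContinuousMap.id (Hf ε W)).Homotopic M := ⟨{
    toFun := fun p => ⟨m p.2 p.1, hm _ _ p.2.2⟩
    continuous_toFun := by fun_prop
    map_zero_left := fun z => by ext; simp [m]
    map_one_left := fun z => rfl }⟩
  refine h1.trans ⟨{
    toFun := fun p => ⟨n p.2 p.1, hn _ _⟩
    continuous_toFun := by fun_prop
    map_zero_left := fun z => by ext; simp [n, M]
    map_one_left := fun z => by ext; simp [n] }⟩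

lemma Hf_subset_Av {ε : ℝ} (hε : ε = 1 ∨ ε = -1) : Hf ε W ⊆ Av W := by
  rw [← Up_union_Lo]
  rcases hε with rfl | rfl
  · rw [← Up_eq]; exact subset_union_left
  · rw [← Lo_eq]; exact subset_union_right

lemma path_lift {S : Set ℂ} {x y : ℂ} (γ : Path x y) (h : ∀ t, γ t ∈ S) (hx : x ∈ S) (hy : y ∈ S) :
    ∃ δ : Path (⟨x, hx⟩ : S) ⟨y, hy⟩, ∀ t, (δ t : ℂ) = γ t :=
  ⟨⟨⟨fun t => ⟨γ t, h t⟩, by fun_prop⟩, by simp, by simp⟩, fun t => rfl⟩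

lemma Hf_holonomy {ε : ℝ} (hε : ε = 1 ∨ ε = -1) {G : Type} [Group G]
    (φ : ∀ {x y : Av W}, Path x y → G)
    (hφ : ∀ {x y z : Av W} (γ : Path x y) (δ : Path y z), φ (γ.trans δ) = φ γ * φ δ)
    (hφ2 : ∀ {x y : Av W} (γ δ : Path x y), γ.Homotopic δ → φ γ = φ δ)
    (b : Av W) (hb : (b : ℂ) ∈ Hf ε W) :
    ∃ a : Av W → G, a b = 1 ∧ ∀ (x y : Av W) (γ : Path x y), (∀ t, (γ t : ℂ) ∈ Hf ε W) →
      φ γ = (a x)⁻¹ * a y := by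
  classical
  have := Hf_simplyConnected (W := W) hε
  let i : C(Hf ε W, Av W) := ⟨fun z => ⟨z, Hf_subset_Av hε z.2⟩, by fun_prop⟩
  let A : Hf ε W → G := fun x => φ ((PathConnectedSpace.somePath ⟨b, hb⟩ x).map i.continuous)
  have hom : ∀ {x y : Hf ε W} (γ δ : Path x y), φ (γ.map i.continuous) = φ (δ.map i.continuous) :=
    fun γ δ => hφ2 _ _ ((SimplyConnectedSpace.paths_homotopic γ δ).map i)
  have hA : ∀ {x y : Hf ε W} (γ : Path x y), φ (γ.map i.continuous) = (A x)⁻¹ * A y := by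
    intro x y γ
    rw [eq_inv_mul_iff_mul_eq, ← hφ, ← Path.map_trans]
    exact hom _ _
  refine ⟨fun x => if h : (x : ℂ) ∈ Hf ε W then A ⟨x, h⟩ else 1, ?_, ?_⟩
  · beta_reduce
    rw [dif_pos hb]
    have := hA (Path.refl (⟨b, hb⟩ : Hf ε W))
    have h3 := hom (PathConnectedSpace.somePath ⟨b, hb⟩ ⟨b, hb⟩) (Path.refl (⟨b, hb⟩ : Hf ε W))
    rw [this] at h3
    change A ⟨b, hb⟩ = _ at h3
    rw [h3, inv_mul_cancel]
  · intro x y γ hγ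
    have hx : (x : ℂ) ∈ Hf ε W := by simpa using hγ 0
    have hy : (y : ℂ) ∈ Hf ε W := by simpa using hγ 1
    beta_reduce
    rw [dif_pos hx, dif_pos hy]
    let δ : Path (⟨x, hx⟩ : Hf ε W) ⟨y, hy⟩ := ⟨⟨fun t => ⟨γ t, hγ t⟩, by fun_prop⟩, by simp, by simp⟩
    exact hA δ

end PlaneTC

namespace PlaneTC
open FreeGroup (of)
open Topology unitInterval

variable {W : Set ℤ}

lemma isPathConnected_Av : IsPathConnected (Av W) := by
  have : Av W = (((↑) : ℤ → ℂ) '' W)ᶜ := by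
    ext z
    simp only [Av, mem_ofPred_eq, mem_compl_iff, mem_image, not_exists, not_and]
    exact forall₂_congr fun k _ => by rw [ne_comm]
  rw [this]
  exact ((to_countable W).image _).isPathConnected_compl_of_one_lt_rank (by simp)

instance : PathConnectedSpace (Av W) := isPathConnected_iff_pathConnectedSpace.1 isPathConnected_Av

/-- The point in the middle of the gap between `i - 1` and `i`. -/
noncomputable def gp (i : ℤ) : ℂ := ((i - 1 / 2 : ℝ) : ℂ)

lemma mem_Hf_of_ceil {i : ℤ} {z : ℂ} (h : ⌈z.re⌉ = i) (hz : ∀ k ∈ W, z.re ≠ (k : ℤ)) (ε : ℝ) (s : ℝ)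
    (hs : s ∈ Icc (0 : ℝ) 1) : gp i + s * (z - gp i) ∈ Hf ε W := by
  right
  intro k hk e
  have e : i - 1 / 2 + s * (z.re - (i - 1 / 2)) = k := by
    simpa [gp, ← Complex.ofReal_sub] using e
  have h1 := (Int.ceil_eq_iff.1 h).1
  have h2 := (Int.ceil_eq_iff.1 h).2
  have hk1 : (i : ℝ) - 1 < k := by
    rw [← e]
    nlinarith [hs.1, hs.2]
  have hk2 : (k : ℝ) ≤ i := by
    rw [← e]
    nlinarith [hs.1, hs.2]
  have hki : k = i := by
    have : i - 1 < k := by exact_mod_cast hk1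
    have : k ≤ i := by exact_mod_cast hk2
    omega
  subst hki
  have : z.re = k := by nlinarith [hs.1, hs.2]
  exact hz k hk this

lemma ceil_gp (i : ℤ) : ⌈(gp i).re⌉ = i := by
  rw [gp, Complex.ofReal_re, Int.ceil_eq_iff]
  constructor <;> linarith

lemma gp_re_ne (i k : ℤ) : (gp i).re ≠ k := fun h => by
  have h1 := ceil_gp i
  rw [h, Int.ceil_intCast] at h1
  subst h1
  simp [gp] at h

lemma gp_mem (i : ℤ) (ε : ℝ) : gp i ∈ Hf ε W := Or.inr fun k _ => gp_re_ne i k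

lemma gp_mem_Av (i : ℤ) : gp i ∈ Av W := Hf_subset_Av (Or.inl rfl) (gp_mem i 1)

lemma gp_seg_succ {i : ℤ} (hi : i ∉ W) (ε s : ℝ) (hs : s ∈ Icc (0 : ℝ) 1) :
    gp i + s * (gp (i + 1) - gp i) ∈ Hf ε W := by
  right
  intro k hk e
  have e : i - 1 / 2 + s = (k : ℝ) := by
    have : gp (i + 1) - gp i = 1 := by simp [gp]
    rw [this] at e
    simpa [gp] using e
  have h1 : (i : ℝ) - 1 < k := by linarith [hs.1]
  have h2 : (k : ℝ) < i + 1 := by linarith [hs.2]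
  have : i - 1 < k := by exact_mod_cast h1
  have : k < i + 1 := by exact_mod_cast h2
  exact hi ((show k = i by omega) ▸ hk)

lemma seg_path {S : Set ℂ} (hS : S ⊆ Av W) {x y : Av W}
    (h : ∀ s ∈ Icc (0 : ℝ) 1, (x : ℂ) + s * (y - x) ∈ S) : ∃ γ : Path x y,
    ∀ t, (γ t : ℂ) = x + (t : ℝ) * (y - x) :=
  ⟨⟨⟨fun t : I => ⟨x + (t : ℝ) * (y - x), hS (h t t.2)⟩, by fun_prop⟩, by simp, by simp⟩,
    fun t => rfl⟩

/-- A path avoiding `W` is determined up to homotopy avoiding `W` by its end points and word. -/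
theorem exists_homotopy {x y : ℂ} (γ δ : Path x y) (hγ : ∀ t, γ t ∈ Av W) (hδ : ∀ t, δ t ∈ Av W)
    (h : wd W γ = wd W δ) : ∃ H : γ.Homotopy δ, ∀ p, H p ∈ Av W := by
  have hx : x ∈ Av W := by simpa using hγ 0
  have hy : y ∈ Av W := by simpa using hγ 1
  obtain ⟨G, _, φ, hφ, hφ2⟩ := exists_holonomy (Av W)
  let q : ℤ → Av W := fun i => ⟨gp i, gp_mem_Av i⟩
  obtain ⟨a, ha1, ha⟩ := Hf_holonomy (W := W) (ε := -1) (Or.inr rfl) φ hφ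
    (fun γ δ => (hφ2 γ δ).2) (q 0) (gp_mem 0 _)
  obtain ⟨d, hd1, hd⟩ := Hf_holonomy (W := W) (ε := 1) (Or.inl rfl) φ hφ
    (fun γ δ => (hφ2 γ δ).2) (q 0) (gp_mem 0 _)
  let l : Av W → G := fun p => a p * (d p)⁻¹
  have hl : ∀ p p' : Av W, (∀ ε, ∀ s ∈ Icc (0 : ℝ) 1, (p : ℂ) + s * (p' - p) ∈ Hf ε W) →
      l p = l p' := by
    intro p p' hp
    obtain ⟨γ, hγ⟩ := seg_path (Hf_subset_Av (Or.inl rfl)) (hp 1)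
    have h1 := ha p p' γ fun t => by rw [hγ]; exact hp _ t t.2
    have h2 := hd p p' γ fun t => by rw [hγ]; exact hp _ t t.2
    rw [h1] at h2
    have h3 : a p' = a p * ((d p)⁻¹ * d p') := by rw [← h2]; group
    simp only [l, h3]
    group
  let Γ : F →* G := FreeGroup.lift fun i => l (q i) * (l (q (i + 1)))⁻¹
  have hΓ : ∀ i, Γ (pw i) = l (q i) := by
    intro i
    have e : ∀ i, Γ (pw i) = l (q i) * (l (q (i + 1)))⁻¹ * Γ (pw (i + 1)) := fun i => by
      rw [pw_rec, map_mul]; simp [Γ]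
    induction i using pw_induction with
    | h0 => simp [pw_zero, l, ha1, hd1]
    | h1 i ih => rw [e, mul_assoc, mul_eq_left, inv_mul_eq_one] at ih; exact ih.symm
    | h2 i ih => rw [e, ih]; group
  have hΓk : ∀ g, Γ (kill W g) = Γ g := fun g => by
    change (Γ.comp (kill W)) g = Γ g
    refine hom_ext_of (fun i => ?_) g
    by_cases hi : i ∈ W
    · simp [kill_of_mem hi]
    · have := hl (q i) (q (i + 1)) (gp_seg_succ hi)
      simp [kill_of_notMem hi, Γ, this]
  have hph : ∀ z : Av W, (∀ k ∈ W, (z : ℂ).re ≠ (k : ℤ)) → Γ (ph z) * d z = a z := by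
    intro z hz
    have h1 := hl (q ⌈(z : ℂ).re⌉) z (mem_Hf_of_ceil rfl hz)
    rw [ph, hΓ, h1]
    simp [l]
  have hUp : ∀ z, z ∈ Up W ↔ z ∈ Hf 1 W := fun z => by rw [Up_eq]
  have hLo : ∀ z, z ∈ Lo W ↔ z ∈ Hf (-1) W := fun z => by rw [Lo_eq]
  classical
  let c : F → Av W → G := fun v z => if (z : ℂ) ∈ Lo W then Γ v * a z else Γ (v * ph z) * d z
  have hcL : ∀ v (z : Av W), (z : ℂ) ∈ Lo W → c v z = Γ v * a z := fun v z hz => if_pos hz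
  have hcU : ∀ v (z : Av W), (z : ℂ) ∈ Up W → c v z = Γ (v * ph z) * d z := fun v z hz => by
    by_cases h : (z : ℂ) ∈ Lo W
    · rw [hcL _ _ h, map_mul, mul_assoc, hph _ (mem_re_of_mem hz h)]
    · exact if_neg h
  have hcast : ∀ {x y x' y' : Av W} (γ : Path x y) (hx : x' = x) (hy : y' = y),
      φ (γ.cast hx hy) = φ γ := by
    rintro x y _ _ γ rfl rfl
    rfl
  have main : ∀ {x y : Av W} (γ : Path x y) (u : I → F), IsLift W (fun t => (γ t : ℂ)) u →
      c (u 0) x * φ γ = c (u 1) y := by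
    intro x y γ u hu
    have hadd : ∀ t t', φ (γ.subpath 0 t') = φ (γ.subpath 0 t) * φ (γ.subpath t t') := fun t t' => by
      rw [← hφ]
      exact (hφ2 _ _).2 ⟨(Path.Homotopy.subpathTransSubpath γ 0 t t').symm⟩
    have hloc : IsLocallyConstant fun t => φ (γ.subpath 0 t) * (c (u t) (γ t))⁻¹ := by
      refine (IsLocallyConstant.iff_eventually_eq _).2 fun t => ?_
      have hcont : Continuous fun t => (γ t : ℂ) := by fun_prop
      have hev : ∀ {S : Set ℂ}, IsOpen S → (γ t : ℂ) ∈ S →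
          ∀ᶠ t' in 𝓝 t, ∀ s, (γ.subpath t t' s : ℂ) ∈ S := by
        intro S hS hz
        have h1 : (fun t => (γ t : ℂ)) ⁻¹' S ∈ 𝓝 t := hcont.continuousAt (hS.mem_nhds hz)
        have h2 := (tendsto_const_nhds (x := t)).uIcc (Filter.tendsto_id (α := I) (x := 𝓝 t))
        have h3 := (Filter.tendsto_smallSets_iff.1 h2) _ h1
        filter_upwards [h3] with t' ht' s
        have : γ.subpath t t' s ∈ range (γ.subpath t t') := mem_range_self s
        rw [Path.range_subpath] at this
        obtain ⟨r, hr, hr'⟩ := this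
        rw [← hr']
        exact ht' hr
      rcases Up_union_Lo.symm.subset (γ t).2 with h | h
      · filter_upwards [hev isOpen_Up h, (hu t).2 h] with t' h1 h2
        have h3 : ((γ t' : Av W) : ℂ) ∈ Up W := by simpa using h1 1
        rw [hcU _ _ h, hcU _ _ h3, hadd t t', hd _ _ _ fun s => (hUp _).1 (h1 s), ← hΓk (u t' * _),
          ← hΓk (u t * _)]
        have h4 := congrArg Γ h2
        simp only [map_mul, hΓk] at h4 ⊢
        rw [h4]
        group
      · filter_upwards [hev isOpen_Lo h, (hu t).1 h] with t' h1 h2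
        have h3 : ((γ t' : Av W) : ℂ) ∈ Lo W := by simpa using h1 1
        rw [hcL _ _ h, hcL _ _ h3, hadd t t', ha _ _ _ fun s => (hLo _).1 (h1 s), h2]
        group
    have h01 := hloc.apply_eq_of_preconnectedSpace 0 1
    have h0 : φ (γ.subpath 0 0) = 1 := by
      have := hadd 0 0
      simpa using this
    beta_reduce at h01
    rw [h0, Path.subpath_zero_one, hcast] at h01
    have e0 : γ 0 = x := γ.source
    have e1 : γ 1 = y := γ.target
    rw [e0, e1] at h01
    rw [one_mul, eq_mul_inv_iff_mul_eq, inv_mul_eq_iff_eq_mul] at h01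
    exact h01.symm
  obtain ⟨γ', hγ'⟩ := path_lift γ hγ hx hy
  obtain ⟨δ', hδ'⟩ := path_lift δ hδ hx hy
  obtain ⟨u, hu⟩ := exists_lift_I γ.continuous hγ
  obtain ⟨v, hv⟩ := exists_lift_I δ.continuous hδ
  have hv' := hv.mul_left (u 0 * (v 0)⁻¹)
  have m1 := main γ' u (by simpa only [hγ'] using hu)
  have m2 := main δ' _ (by simpa only [hδ'] using hv')
  rw [hu.wd_eq hγ, hv.wd_eq hδ] at h
  have h5 : u 0 * (v 0)⁻¹ * v 1 = u 1 := by
    rw [mul_assoc, ← h]; group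
  rw [inv_mul_cancel_right, h5, ← m1] at m2
  obtain ⟨H⟩ := (hφ2 _ _).1 (mul_left_cancel m2).symm
  refine ⟨⟨⟨⟨fun p => H p, by fun_prop⟩, fun t => ?_, fun t => ?_⟩, fun t s hs => ?_⟩, fun p => (H p).2⟩
  · simp [hγ']
  · simp [hδ']
  · rcases hs with rfl | rfl <;> simp

end PlaneTC

namespace PlaneTC
open FreeGroup (of)
open Topology unitInterval

variable {W : Set ℤ} {X : Type*} [TopologicalSpace X]

lemma IsLift.eq_of_Lo {f : X → ℂ} {u : X → F} (h : IsLift W f u) (hf : Continuous f) {S : Set X}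
    (hS : IsPreconnected S) (hL : ∀ x ∈ S, f x ∈ Lo W) {x y : X} (hx : x ∈ S) (hy : y ∈ S) :
    u x = u y := by
  have := isPreconnected_iff_preconnectedSpace.1 hS
  have h1 := h.comp (g := ((↑) : S → X)) continuous_subtype_val
  have h2 := h1.eq (fun x => Up_union_Lo (W := W) ▸ Or.inr (hL x x.2))
    (isLift_of_Lo (hf.comp continuous_subtype_val) fun x => hL x x.2) ⟨x, hx⟩ ⟨y, hy⟩
  simpa [inv_mul_eq_one] using h2

lemma IsLift.eq_of_Up {f : X → ℂ} {u : X → F} (h : IsLift W f u) (hf : Continuous f) {S : Set X}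
    (hS : IsPreconnected S) (hL : ∀ x ∈ S, f x ∈ Up W) {x y : X} (hx : x ∈ S) (hy : y ∈ S) :
    u x * PlaneTC.kill W (ph (f x)) = u y * PlaneTC.kill W (ph (f y)) := by
  have := isPreconnected_iff_preconnectedSpace.1 hS
  have h1 := h.comp (g := ((↑) : S → X)) continuous_subtype_val
  have h2 := h1.eq (fun x => Up_union_Lo (W := W) ▸ Or.inl (hL x x.2))
    (isLift_of_Up (hf.comp continuous_subtype_val) fun x => hL x x.2) ⟨x, hx⟩ ⟨y, hy⟩
  simp only [Function.comp_apply, inv_inv] at h2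
  rw [inv_mul_eq_iff_eq_mul] at h2
  rw [h2]
  group

/-- Paths in the open vertical strip around `o` have words in the letter `e_o`. -/
lemma wd_strip {f : I → ℂ} (hf : Continuous f) (hW : ∀ t, f t ∈ Av W) (o : ℤ)
    (ho : ∀ t, |(f t).re - o| < 1) : wd W f ∈ span {o} := by
  obtain ⟨u, hu⟩ := exists_lift_I hf hW
  have hp : ∀ t, ph (f t) * (pw (o + 1))⁻¹ ∈ span {o} := fun t => by
    have h := abs_lt.1 (ho t)
    rcases le_or_gt (f t).re o with h1 | h1
    · rw [ph, show ⌈(f t).re⌉ = o from Int.ceil_eq_iff.2 ⟨by linarith, h1⟩, pw_rec,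
        mul_inv_cancel_right]
      exact of_mem_span rfl
    · rw [ph, show ⌈(f t).re⌉ = o + 1 from Int.ceil_eq_iff.2 ⟨by push_cast; linarith,
        by push_cast; linarith⟩, mul_inv_cancel]
      exact one_mem _
  have hk : ∀ g ∈ span {o}, kill W g ∈ span {o} := fun g hg => by
    refine Subgroup.closure_induction (p := fun g _ => kill W g ∈ span {o}) ?_ (by simp)
      (fun x y _ _ hx hy => by rw [map_mul]; exact mul_mem hx hy)
      (fun x _ hx => by rw [map_inv]; exact inv_mem hx) hg
    rintro _ ⟨i, hi, rfl⟩
    by_cases h : i ∈ W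
    · rw [kill_of_mem h]; exact of_mem_span hi
    · rw [kill_of_notMem h]; exact one_mem _
  have hloc : IsLocallyConstant fun t => (QuotientGroup.mk (u t) : F ⧸ span {o}) := by
    refine (IsLocallyConstant.iff_eventually_eq _).2 fun t => ?_
    rcases Up_union_Lo.symm.subset (hW t) with h | h
    · filter_upwards [(hu t).2 h] with s hs
      rw [QuotientGroup.eq]
      have h1 : (u s)⁻¹ * u t = kill W ((ph (f s) * (pw (o + 1))⁻¹) *
          (ph (f t) * (pw (o + 1))⁻¹)⁻¹) := by
        have h2 : u t = u s * kill W (ph (f s)) * (kill W (ph (f t)))⁻¹ := by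
          rw [hs]; group
        rw [h2]
        simp only [map_mul, map_inv, mul_inv_rev, inv_inv]
        group
      rw [h1]
      exact hk _ (mul_mem (hp s) (inv_mem (hp t)))
    · filter_upwards [(hu t).1 h] with s hs
      rw [hs]
  have := hloc.apply_eq_of_preconnectedSpace 0 1
  rw [QuotientGroup.eq] at this
  rwa [hu.wd_eq hW]

lemma mem_span_singleton {o : ℤ} {g : F} : g ∈ span {o} ↔ ∃ m : ℤ, of o ^ m = g := by
  rw [span, image_singleton, Subgroup.mem_closure_singleton]

/-- The clockwise circle based at its lowest point. -/
noncomputable def circ (x ρ : ℝ) (t : ℝ) : ℂ :=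
  ⟨x - ρ * Real.sin (2 * Real.pi * t), -(ρ * Real.cos (2 * Real.pi * t))⟩

lemma circ_eq (x ρ t : ℝ) : circ x ρ t = ((x - ρ * Real.sin (2 * Real.pi * t) : ℝ) : ℂ) +
    ((-(ρ * Real.cos (2 * Real.pi * t)) : ℝ) : ℂ) * Complex.I := by
  apply Complex.ext <;> simp only [circ, Complex.add_re, Complex.add_im, Complex.mul_re,
    Complex.mul_im, Complex.ofReal_re, Complex.ofReal_im, Complex.I_re, Complex.I_im] <;> ring

lemma continuous_circ {Y : Type*} [TopologicalSpace Y] {x ρ t : Y → ℝ} (hx : Continuous x)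
    (hρ : Continuous ρ) (ht : Continuous t) : Continuous fun y => circ (x y) (ρ y) (t y) := by
  simp only [circ_eq]
  fun_prop

lemma circ_im_eq_zero {x ρ t : ℝ} (h : (circ x ρ t).im = 0) :
    (circ x ρ t).re = x - ρ ∨ (circ x ρ t).re = x + ρ := by
  simp only [circ, neg_eq_zero, mul_eq_zero] at h ⊢
  rcases h with rfl | h
  · simp
  · have := Real.sin_sq_add_cos_sq (2 * Real.pi * t)
    rw [h] at this
    rcases mul_self_eq_one_iff.1 (show Real.sin (2 * Real.pi * t) * Real.sin (2 * Real.pi * t) = 1 by linarith) with h1 | h1 <;> simp [h1]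

lemma dist_circ (x ρ t : ℝ) (hρ : 0 ≤ ρ) : ‖circ x ρ t - x‖ = ρ := by
  rw [← sq_eq_sq₀ (norm_nonneg _) hρ, Complex.sq_norm, Complex.normSq_apply]
  simp only [circ, Complex.sub_re, Complex.ofReal_re, Complex.sub_im, Complex.ofReal_im]
  linear_combination ρ ^ 2 * Real.sin_sq_add_cos_sq (2 * Real.pi * t)

lemma circ_mem_Av {x ρ : ℝ} (hρ : 0 ≤ ρ) (h : ∀ k ∈ W, |(k : ℝ) - x| ≠ ρ) (t : ℝ) :
    circ x ρ t ∈ Av W := fun k hk e => by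
  have := dist_circ x ρ t hρ
  rw [e, ← Complex.ofReal_intCast, ← Complex.ofReal_sub, Complex.norm_real] at this
  exact h k hk this

lemma wd_circ {x ρ : ℝ} (hρ : 0 ≤ ρ) (h : ∀ k ∈ W, |(k : ℝ) - x| ≠ ρ) :
    wd W (fun t : I => circ x ρ t) = kill W (pw ⌈x - ρ⌉ * (pw ⌈x + ρ⌉)⁻¹) := by
  have hc : Continuous fun t : I => circ x ρ t :=
    continuous_circ continuous_const continuous_const continuous_subtype_val
  have hW : ∀ t : I, circ x ρ t ∈ Av W := fun t => circ_mem_Av hρ h t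
  have hre : ∀ t : I, (circ x ρ t).im = 0 → ∀ k ∈ W, (circ x ρ t).re ≠ (k : ℤ) := by
    intro t ht k hk e
    apply h k hk
    rcases circ_im_eq_zero ht with h1 | h1
    · rw [← e, h1, sub_sub_cancel_left, abs_neg, abs_of_nonneg hρ]
    · rw [← e, h1, add_sub_cancel_left, abs_of_nonneg hρ]
  have hLo : ∀ t : I, 0 ≤ Real.cos (2 * Real.pi * t) → circ x ρ t ∈ Lo W := fun t ht => by
    rcases (show (circ x ρ t).im ≤ 0 by simp [circ]; positivity).lt_or_eq with h1 | h1
    · exact Or.inl h1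
    · exact Or.inr (hre t h1)
  have hUp : ∀ t : I, Real.cos (2 * Real.pi * t) ≤ 0 → circ x ρ t ∈ Up W := fun t ht => by
    rcases (show 0 ≤ (circ x ρ t).im by
      simp [circ]; exact mul_nonpos_of_nonneg_of_nonpos hρ ht).lt_or_eq with h1 | h1
    · exact Or.inl h1
    · exact Or.inr (hre t h1.symm)
  obtain ⟨u, hu⟩ := exists_lift_I hc hW
  let q1 : I := ⟨1 / 4, by norm_num, by norm_num⟩
  let q3 : I := ⟨3 / 4, by norm_num, by norm_num⟩
  have hpi := Real.pi_pos
  have e1 : u 0 = u q1 := hu.eq_of_Lo hc (S := Icc 0 q1) isPreconnected_Icc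
    (fun t ht => hLo t (Real.cos_nonneg_of_mem_Icc ⟨by nlinarith [t.2.1],
      by have : (t : ℝ) ≤ 1 / 4 := ht.2
         nlinarith⟩)) (by simp [q1]) (by simp [q1])
  have e2 : u q1 * kill W (ph (circ x ρ q1)) = u q3 * kill W (ph (circ x ρ q3)) :=
    hu.eq_of_Up hc (S := Icc q1 q3) isPreconnected_Icc
    (fun t ht => hUp t (Real.cos_nonpos_of_pi_div_two_le_of_le
      (by have : 1 / 4 ≤ (t : ℝ) := ht.1
          nlinarith)
      (by have : (t : ℝ) ≤ 3 / 4 := ht.2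
          nlinarith)))
      (by simp [q1, q3, ← Subtype.coe_le_coe]; norm_num)
      (by simp [q1, q3, ← Subtype.coe_le_coe]; norm_num)
  have e3 : u q3 = u 1 := hu.eq_of_Lo hc (S := Icc q3 1) isPreconnected_Icc
    (fun t ht => hLo t (by
      rw [← Real.cos_sub_two_pi]
      exact Real.cos_nonneg_of_mem_Icc ⟨by
         have : 3 / 4 ≤ (t : ℝ) := ht.1
         nlinarith, by nlinarith [t.2.2]⟩)) (by simp [q3, ← Subtype.coe_le_coe]; norm_num)
           (by simp [q3, ← Subtype.coe_le_coe]; norm_num)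
  rw [hu.wd_eq hW, e1, ← e3]
  have r1 : (circ x ρ q1).re = x - ρ := by
    simp [circ, q1, show 2 * Real.pi * 4⁻¹ = Real.pi / 2 by ring]
  have r3 : (circ x ρ q3).re = x + ρ := by
    simp [circ, q3, show 2 * Real.pi * (3 / 4) = Real.pi / 2 + Real.pi by ring, Real.sin_add_pi]
  rw [ph, ph, r1, r3] at e2
  rw [map_mul, map_inv, inv_mul_eq_iff_eq_mul, ← mul_assoc, e2]
  group

lemma exists_path_Hf {ε : ℝ} (hε : ε = 1 ∨ ε = -1) {x y : ℂ} (hx : x ∈ Hf ε W) (hy : y ∈ Hf ε W) :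
    ∃ γ : Path x y, ∀ t, γ t ∈ Hf ε W := by
  have := Hf_simplyConnected (W := W) hε
  exact ⟨(PathConnectedSpace.somePath (⟨x, hx⟩ : Hf ε W) ⟨y, hy⟩).map continuous_subtype_val,
    fun t => Subtype.prop _⟩

lemma exists_path_Lo {x y : ℂ} (hx : x ∈ Lo W) (hy : y ∈ Lo W) :
    ∃ γ : Path x y, ∀ t, γ t ∈ Lo W := by
  rw [Lo_eq] at *
  exact exists_path_Hf (Or.inr rfl) hx hy

lemma exists_path_Up {x y : ℂ} (hx : x ∈ Up W) (hy : y ∈ Up W) :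
    ∃ γ : Path x y, ∀ t, γ t ∈ Up W := by
  rw [Up_eq] at *
  exact exists_path_Hf (Or.inl rfl) hx hy

lemma Lo_subset_Av : Lo W ⊆ Av W := Up_union_Lo (W := W) ▸ subset_union_right
lemma Up_subset_Av : Up W ⊆ Av W := Up_union_Lo (W := W) ▸ subset_union_left

lemma trans_mem {S : Set ℂ} {x y z : ℂ} {γ : Path x y} {δ : Path y z} (h1 : ∀ t, γ t ∈ S)
    (h2 : ∀ t, δ t ∈ S) (t : I) : γ.trans δ t ∈ S := by
  rw [Path.trans_apply]
  split_ifs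
  · exact h1 _
  · exact h2 _

/-- Every element of the free group is the word of a loop based at a point below the axis. -/
lemma exists_loop {b : ℂ} (hb : b.im < 0) (g : F) :
    ∃ γ : Path b b, (∀ t, γ t ∈ Av univ) ∧ wd univ γ = g := by
  have hbL : b ∈ Lo univ := Or.inl hb
  induction g using FreeGroup.induction_on with
  | C1 => exact ⟨Path.refl b, fun t => Lo_subset_Av hbL, wd_const (Lo_subset_Av hbL)⟩
  | of i =>
    obtain ⟨α, hα⟩ := exists_path_Lo hbL (Or.inr fun k _ => gp_re_ne i k : gp i ∈ Lo univ)
    obtain ⟨β, hβ⟩ := exists_path_Up (Or.inr fun k _ => gp_re_ne i k : gp i ∈ Up univ)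
      (Or.inr fun k _ => gp_re_ne (i + 1) k : gp (i + 1) ∈ Up univ)
    obtain ⟨γ, hγ⟩ := exists_path_Lo (Or.inr fun k _ => gp_re_ne (i + 1) k : gp (i + 1) ∈ Lo univ)
      hbL
    have h1 := fun t => Lo_subset_Av (hα t)
    have h2 := fun t => Up_subset_Av (hβ t)
    have h3 := fun t => Lo_subset_Av (hγ t)
    refine ⟨α.trans (β.trans γ), trans_mem h1 (trans_mem h2 h3), ?_⟩
    rw [wd_trans h1 (trans_mem h2 h3), wd_trans h2 h3, wd_of_Lo α.continuous hα,
      wd_of_Lo γ.continuous hγ, wd_of_Up β.continuous hβ, β.source, β.target, ph, ph, ceil_gp,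
      ceil_gp, pw_rec i, kill_univ]
    simp
  | inv_of i h =>
    obtain ⟨γ, h1, h2⟩ := h
    exact ⟨γ.symm, fun t => h1 _, by rw [wd_symm h1, h2]⟩
  | mul x y hx hy =>
    obtain ⟨γ, h1, h2⟩ := hx
    obtain ⟨δ, h3, h4⟩ := hy
    exact ⟨γ.trans δ, trans_mem h1 h3, by rw [wd_trans h1 h3, h2, h4]⟩

end PlaneTC

namespace PlaneTC
open FreeGroup (of)
open Topology unitInterval

/-- `h` preserves the set of integers. -/
def Pres (h : ℂ ≃ₜ ℂ) : Prop := ∀ z, h z ∈ Av univ ↔ z ∈ Av univ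

/-- The action of `h` on words of paths avoiding the integers is given by `θ`, with gauge `ψ`. -/
def Ind (h : ℂ ≃ₜ ℂ) (θ : F →* F) (ψ : ℂ → F) : Prop :=
  ∀ f : I → ℂ, Continuous f → (∀ t, f t ∈ Av univ) →
    wd univ (fun t => h (f t)) = (ψ (f 0))⁻¹ * θ (wd univ f) * ψ (f 1)

variable {h k : ℂ ≃ₜ ℂ} {θ θ' : F →* F} {ψ ψ' : ℂ → F}

lemma Pres.mul (hh : Pres h) (hk : Pres k) : Pres (h * k) := fun z => (hh _).trans (hk z)

lemma Pres.inv (hh : Pres h) : Pres h⁻¹ := fun z => by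
  rw [← hh, app_inv_self]

lemma mem_Av_univ {z : ℂ} : z ∈ Av univ ↔ ∀ k : ℤ, z ≠ k := by simp [Av]

lemma pres_of_perm (e : ℤ ≃ ℤ) (hk : ∀ i : ℤ, h i = (e i : ℤ)) : Pres h := fun z => by
  rw [mem_Av_univ, mem_Av_univ]
  refine ⟨fun H k hz => H (e k) (by rw [hz, hk]), fun H k hz => H (e.symm k) (h.injective ?_)⟩
  rw [hz, hk, e.apply_symm_apply]

lemma Pres.wd_eq (hh : Pres h) {x y : ℂ} {γ δ : Path x y} (hγ : ∀ t, γ t ∈ Av univ)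
    (hδ : ∀ t, δ t ∈ Av univ) (e : wd univ γ = wd univ δ) :
    wd univ (fun t => h (γ t)) = wd univ (fun t => h (δ t)) := by
  obtain ⟨H, hH⟩ := exists_homotopy γ δ hγ hδ e
  exact wd_homotopy (γ := γ.map h.continuous) (δ := δ.map h.continuous)
    (H.map ⟨h, h.continuous⟩) fun p => (hh _).2 (hH p)

/-- The path underlying a continuous function on the unit interval. -/
def toPath {f : I → ℂ} (hf : Continuous f) : Path (f 0) (f 1) := ⟨⟨f, hf⟩, rfl, rfl⟩

lemma Pres.exists_ind (hh : Pres h) : ∃ θ ψ, Ind h θ ψ := by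
  have hb : (-Complex.I).im < 0 := by simp
  have hbM : (-Complex.I) ∈ Av univ := Lo_subset_Av (Or.inl hb)
  choose L hL1 hL2 using exists_loop hb
  have key : ∀ γ : Path (-Complex.I) (-Complex.I), (∀ t, γ t ∈ Av univ) →
      wd univ (fun t => h (L (wd univ γ) t)) = wd univ (fun t => h (γ t)) := fun γ hγ =>
    hh.wd_eq (hL1 _) hγ (hL2 _)
  have tr : ∀ {x y z : ℂ} (γ : Path x y) (δ : Path y z), (∀ t, γ t ∈ Av univ) →
      (∀ t, δ t ∈ Av univ) → wd univ (fun t => h (γ.trans δ t)) =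
      wd univ (fun t => h (γ t)) * wd univ (fun t => h (δ t)) := fun γ δ h1 h2 => by
    have := wd_trans (γ := γ.map h.continuous) (δ := δ.map h.continuous) (W := univ)
      (fun t => (hh _).2 (h1 t)) (fun t => (hh _).2 (h2 t))
    rw [← Path.map_trans] at this
    exact this
  have sy : ∀ {x y : ℂ} (γ : Path x y), (∀ t, γ t ∈ Av univ) →
      wd univ (fun t => h (γ.symm t)) = (wd univ (fun t => h (γ t)))⁻¹ := fun γ h1 => by
    exact wd_symm (γ := γ.map h.continuous) (W := univ) (fun t => (hh _).2 (h1 t))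
  let θ : F →* F := MonoidHom.mk' (fun g => wd univ (fun t => h (L g t))) fun x y => by
    rw [← tr _ _ (hL1 x) (hL1 y), ← key _ (trans_mem (hL1 x) (hL1 y)),
      wd_trans (hL1 x) (hL1 y), hL2, hL2]
  have c : ∀ p, ∃ γ : Path (-Complex.I) p, p ∈ Av univ → ∀ t, γ t ∈ Av univ := fun p => by
    by_cases hp : p ∈ Av univ
    · obtain ⟨γ, hγ⟩ := isPathConnected_Av.joinedIn _ hbM _ hp
      exact ⟨γ, fun _ => hγ⟩
    · exact ⟨PathConnectedSpace.somePath _ _, fun h => absurd h hp⟩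
  choose c hc using c
  refine ⟨θ, fun p => (θ (wd univ (c p)))⁻¹ * wd univ (fun t => h (c p t)), fun f hf hM => ?_⟩
  have h0 := hc _ (hM 0)
  have h1 := hc _ (hM 1)
  have h2 : ∀ t, toPath hf t ∈ Av univ := hM
  have h3 : ∀ t, (c (f 1)).symm t ∈ Av univ := fun t => h1 _
  have e := key ((c (f 0)).trans ((toPath hf).trans (c (f 1)).symm))
    (trans_mem h0 (trans_mem h2 h3))
  rw [tr _ _ h0 (trans_mem h2 h3), tr _ _ h2 h3, sy _ h1] at e
  have e2 : θ (wd univ ((c (f 0)).trans ((toPath hf).trans (c (f 1)).symm))) = _ := e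
  rw [wd_trans h0 (trans_mem h2 h3), wd_trans h2 h3, wd_symm h1, map_mul, map_mul, map_inv] at e2
  change _ = _ * (wd univ (fun t => h (f t)) * _) at e2
  change θ _ * (θ (wd univ f) * _) = _ at e2
  have e3 : θ (wd univ f) = (θ (wd univ (c (f 0))))⁻¹ * (θ (wd univ (c (f 0))) *
    (θ (wd univ f) * (θ (wd univ (c (f 1))))⁻¹)) * θ (wd univ (c (f 1))) := by group
  rw [e2] at e3
  rw [e3]
  group

lemma Ind.mul (hh : Ind h θ ψ) (hk : Ind k θ' ψ') (hP : Pres k) :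
    Ind (h * k) (θ.comp θ') (fun p => θ (ψ' p) * ψ (k p)) := fun f hf hM => by
  have := hh (fun t => k (f t)) (k.continuous.comp hf) fun t => (hP _).2 (hM t)
  rw [hk f hf hM] at this
  simp only [mul_app, this, map_mul, map_inv, MonoidHom.comp_apply]
  group

lemma Ind.inv (hh : Ind h θ ψ) (hP : Pres h) (e : ∀ g, θ' (θ g) = g) :
    Ind h⁻¹ θ' (fun p => (θ' (ψ ((h⁻¹ : ℂ ≃ₜ ℂ) p)))⁻¹) := fun f hf hM => by
  have := hh (fun t => (h⁻¹ : ℂ ≃ₜ ℂ) (f t)) ((h⁻¹ : ℂ ≃ₜ ℂ).continuous.comp hf)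
    fun t => (hP.inv _).2 (hM t)
  simp only [app_inv_self] at this
  have e2 := congrArg θ' this
  simp only [map_mul, map_inv, e] at e2
  rw [e2]
  group

lemma Ind.of_conj (hh : Ind h θ ψ) (v : F) (e : ∀ g, θ g = v * θ' g * v⁻¹) :
    Ind h θ' (fun p => v⁻¹ * ψ p) := fun f hf hM => by
  rw [hh f hf hM, e]
  group

lemma Ind.conj_eq (hh : Ind h θ ψ) (hk : Ind h θ' ψ') : ∃ v, ∀ g, θ g = v * θ' g * v⁻¹ := by
  have hb : (-Complex.I).im < 0 := by simp
  refine ⟨ψ (-Complex.I) * (ψ' (-Complex.I))⁻¹, fun g => ?_⟩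
  obtain ⟨γ, h1, rfl⟩ := exists_loop hb g
  have e := (hh γ γ.continuous h1).symm.trans (hk γ γ.continuous h1)
  rw [γ.source, γ.target] at e
  have : θ (wd univ γ) = ψ (-Complex.I) * ((ψ (-Complex.I))⁻¹ * θ (wd univ γ) * ψ (-Complex.I)) *
    (ψ (-Complex.I))⁻¹ := by group
  rw [this, e]
  group

lemma Ind.isotopy {H : I → ℂ ≃ₜ ℂ} (hH : JC H) (hP : ∀ t, Pres (H t)) (hh : Ind (H 0) θ ψ) :
    Ind (H 1) θ (fun p => ψ p * wd univ (fun t => H t p)) := fun f hf hM => by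
  have := wd_square (W := univ) (H := fun p : I × I => H p.1 (f p.2))
    (hH.app continuous_fst (hf.comp continuous_snd)) fun p => (hP _ _).2 (hM _)
  simp only at this
  rw [hh f hf hM] at this
  rw [← inv_mul_eq_iff_eq_mul] at this
  rw [← this]
  group

lemma Ind.one : Ind 1 (MonoidHom.id F) 1 := fun f _ _ => by simp

/-- `h` acts on words by an inner automorphism. -/
def Triv (h : ℂ ≃ₜ ℂ) : Prop := ∃ ψ, Ind h (MonoidHom.id F) ψ

lemma Triv.isotopy {H : I → ℂ ≃ₜ ℂ} (hH : JC H) (hP : ∀ t, Pres (H t)) (hh : Triv (H 0)) :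
    Triv (H 1) := hh.imp' _ fun _ h => h.isotopy hH hP

/-- Translation by a complex number. -/
noncomputable def tau (a : ℂ) : ℂ ≃ₜ ℂ := Homeomorph.addRight a

lemma tau_app (a z : ℂ) : tau a z = z + a := rfl

lemma tau_inv_app (a z : ℂ) : (tau a)⁻¹ z = z - a := by
  rw [inv_app_eq, tau_app, sub_add_cancel]

lemma pres_tau (n : ℤ) : Pres (tau n) :=
  pres_of_perm (Equiv.addRight n) fun i => by simp [tau_app]

lemma ind_tau (n : ℤ) : Ind (tau n) (sh n).toMonoidHom 1 := fun f hf hM => by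
  simp [tau_app, wd_add n hf hM]

end PlaneTC

namespace PlaneTC
open FreeGroup (of)
open Topology unitInterval

variable {W : Set ℤ} {θ : F →* F} {ψ : ℂ → F}

/-- Free homotopies of loops conjugate the words. -/
lemma wd_isConj {G : I × I → ℂ} (hG : Continuous G) (hW : ∀ p, G p ∈ Av W)
    (hl : ∀ t, G (t, 0) = G (t, 1)) :
    IsConj (wd W fun s => G (0, s)) (wd W fun s => G (1, s)) := by
  have h := wd_square hG hW
  simp only [← hl] at h
  rw [isConj_iff]
  refine ⟨(wd W fun t => G (t, 0))⁻¹, ?_⟩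
  rw [inv_inv, mul_assoc, h]
  group

lemma circ_zero_one (x ρ : ℝ) : circ x ρ 1 = circ x ρ 0 := by simp [circ]

lemma kill_seg_of_disjoint (a : ℤ) (n : ℕ) (h : ∀ i ∈ Ico a (a + n), i ∉ W) :
    kill W (seg a n) = 1 := by
  induction n with
  | zero => simp [seg]
  | succ n ih =>
    rw [seg_succ, map_mul, ih fun i hi => h i ⟨hi.1, by have := hi.2; push_cast; omega⟩, one_mul,
      kill_of_notMem (h _ ⟨by omega, by push_cast; omega⟩)]

lemma kill_seg_of_subset (a : ℤ) (n : ℕ) (h : Ico a (a + n) ⊆ W) :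
    kill W (seg a n) = seg a n := by
  induction n with
  | zero => simp [seg]
  | succ n ih =>
    rw [seg_succ, map_mul, ih fun i hi => h ⟨hi.1, by have := hi.2; push_cast; omega⟩,
      kill_of_mem (h ⟨by omega, by push_cast; omega⟩)]

lemma kill_seg_Ico {c a : ℤ} {m n : ℕ} (h1 : a ≤ c) (h2 : c + m ≤ a + n) :
    kill (Ico c (c + m)) (seg a n) = seg c m := by
  obtain ⟨p, rfl⟩ := Int.le.dest h1
  obtain ⟨q, hq⟩ := Int.le.dest h2
  obtain rfl : n = p + (m + q) := by omega
  rw [seg_add, seg_add, map_mul, map_mul, kill_seg_of_disjoint a p,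
    kill_seg_of_disjoint (a + p + m) q, kill_seg_of_subset _ m subset_rfl, one_mul, mul_one]
  · rintro i ⟨hi, _⟩ ⟨_, h⟩; omega
  · rintro i ⟨hi, hi2⟩ ⟨h, _⟩; omega

lemma pw_ceil_circ (a : ℤ) (n : ℕ) (x ρ : ℝ) (hx : x - ρ = a - 1 / 2) (hy : x + ρ = a + n - 1 / 2) :
    pw ⌈x - ρ⌉ * (pw ⌈x + ρ⌉)⁻¹ = seg a n := by
  rw [seg_eq_pw, hx, hy, show ⌈(a : ℝ) - 1 / 2⌉ = a from Int.ceil_eq_iff.2 ⟨by linarith, by linarith⟩,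
    show ⌈(a + n : ℝ) - 1 / 2⌉ = a + n from
      Int.ceil_eq_iff.2 ⟨by push_cast; linarith, by push_cast; linarith⟩]

lemma exists_family_bound {H : I → ℂ ≃ₜ ℂ} (hH : JC H) (R : ℝ) :
    ∃ M, ∀ t z, ‖z‖ ≤ R → ‖H t z‖ ≤ M := by
  have hc : IsCompact ((fun p : I × ℂ => H p.1 p.2) '' (univ ×ˢ Metric.closedBall 0 R)) :=
    (isCompact_univ.prod (isCompact_closedBall _ _)).image hH
  obtain ⟨M, hM⟩ := hc.isBounded.exists_norm_le
  exact ⟨M, fun t z hz => hM _ ⟨(t, z), ⟨mem_univ _, by simpa using hz⟩, rfl⟩⟩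

/-- The word of a small circle around an integer has exponent sum one. -/
lemma exponent_eq_one {H : I → ℂ ≃ₜ ℂ} (hH : JC H) (h0 : H 0 = 1) (i j : ℤ) (hij : H 1 i = j)
    {ρ : ℝ} (hρ : 0 < ρ) (hρ1 : ρ < 1) (hM : ∀ s : I, H 1 (circ i ρ s) ∈ Av univ) {m : ℤ}
    (hm : wd univ (fun s : I => H 1 (circ i ρ s)) = of j ^ m) : m = 1 := by
  have hc : Continuous fun s : I => circ i ρ s :=
    continuous_circ continuous_const continuous_const continuous_subtype_val
  have hne : ∀ s : I, circ i ρ s ≠ i := fun s e => by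
    have := dist_circ i ρ s hρ.le
    simp [e] at this
    exact hρ.ne this
  have h := wd_isConj (W := {0}) (G := fun p : I × I => H p.1 (circ i ρ p.2) - H p.1 i)
    ((hH.app continuous_fst (hc.comp continuous_snd)).sub (hH.app continuous_fst continuous_const))
    (fun p k hk => by
      rw [mem_singleton_iff.1 hk, Int.cast_zero, sub_ne_zero]
      exact (H p.1).injective.ne (hne _)) fun t => by simp [circ_zero_one]
  simp only [h0, one_app, hij] at h
  have e0 : (fun s : I => circ i ρ s - (i : ℂ)) = fun s : I => circ 0 ρ s := by
    funext s
    apply Complex.ext <;> simp [circ]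
  rw [e0, wd_circ hρ.le (by simpa using hρ.ne)] at h
  have e1 : wd {0} (fun s : I => H 1 (circ i ρ s) - (j : ℂ)) = of 0 ^ m := by
    have := wd_kill (subset_univ {0}) (f := fun s : I => H 1 (circ i ρ s) + ((-j : ℤ) : ℂ))
      (((H 1).continuous.comp hc).add continuous_const) fun s => Av_univ_add _ (hM s)
    have h4 := wd_add (-j) ((H 1).continuous.comp hc) hM
    simp only [Function.comp_def] at h4
    rw [h4, hm, map_zpow, map_zpow, sh_of, add_neg_cancel,
      kill_of_mem (mem_singleton 0)] at this
    simpa [sub_eq_add_neg] using this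
  rw [e1, show ⌈0 - ρ⌉ = 0 from Int.ceil_eq_iff.2 ⟨by push_cast; linarith, by push_cast; linarith⟩,
    show ⌈0 + ρ⌉ = 1 from Int.ceil_eq_iff.2 ⟨by push_cast; linarith, by push_cast; linarith⟩,
    pw_rec 0, zero_add, mul_inv_cancel_right, kill_of_mem (mem_singleton 0)] at h
  have h2 := isConj_iff_eq.1 ((FreeGroup.lift fun _ : ℤ => Multiplicative.ofAdd (1 : ℤ)).map_isConj h)
  rw [map_zpow, FreeGroup.lift_apply_of, ← ofAdd_zsmul, Multiplicative.ofAdd.apply_eq_iff_eq] at h2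
  simpa using h2.symm

/-- The homomorphism induced by `H 1` maps generators to conjugates of generators. -/
lemma Ind.exists_conj {H : I → ℂ ≃ₜ ℂ} (hH : JC H) (h0 : H 0 = 1) (hh : Ind (H 1) θ ψ)
    (hP : Pres (H 1)) (i j : ℤ) (hij : H 1 i = j) : ∃ v, θ (of i) = v * of j * v⁻¹ := by
  obtain ⟨ρ₀, hρ₀, hb⟩ := Metric.continuousAt_iff.1
    ((H 1).continuous.continuousAt (x := (i : ℂ))) 1 one_pos
  set ρ := min ρ₀ 1 / 2 with hρd
  have hρ : 0 < ρ := by positivity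
  have hρ1 : ρ < 1 := by have := min_le_right ρ₀ 1; rw [hρd]; linarith
  have hρ2 : ρ < ρ₀ := by have := min_le_left ρ₀ 1; rw [hρd]; linarith
  have hc : Continuous fun s : I => circ i ρ s :=
    continuous_circ continuous_const continuous_const continuous_subtype_val
  have hn : ∀ k ∈ (univ : Set ℤ), |(k : ℝ) - (i : ℝ)| ≠ ρ := fun k _ e => by
    rw [← Int.cast_sub, ← Int.cast_abs] at e
    have h1 : (0 : ℝ) < |k - i| := by rw [e]; exact hρ
    have h2 : ((|k - i| : ℤ) : ℝ) < 1 := by rw [e]; exact hρ1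
    norm_cast at h1 h2
    omega
  have hM := circ_mem_Av hρ.le hn
  have hM2 : ∀ s : I, H 1 (circ i ρ s) ∈ Av univ := fun s => (hP _).2 (hM s)
  have hw := hh _ hc fun s => hM s
  rw [wd_circ hρ.le hn,
    show ⌈(i : ℝ) - ρ⌉ = i from Int.ceil_eq_iff.2 ⟨by linarith, by linarith⟩,
    show ⌈(i : ℝ) + ρ⌉ = i + 1 from Int.ceil_eq_iff.2 ⟨by push_cast; linarith, by push_cast; linarith⟩,
    pw_rec i, mul_inv_cancel_right, kill_univ] at hw
  have hs : wd univ (fun s : I => H 1 (circ i ρ s)) ∈ span {j} := by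
    refine wd_strip ((H 1).continuous.comp hc) hM2 j fun s => ?_
    have h1 := hb (x := circ i ρ s) (by
      have := dist_circ i ρ s hρ.le
      rw [Complex.ofReal_intCast] at this
      rw [dist_eq_norm, this]; exact hρ2)
    rw [hij, dist_eq_norm] at h1
    refine lt_of_le_of_lt ?_ h1
    simpa using Complex.abs_re_le_norm (H 1 (circ i ρ s) - j)
  obtain ⟨m, hm⟩ := mem_span_singleton.1 hs
  obtain rfl := exponent_eq_one hH h0 i j hij hρ hρ1 hM2 hm.symm
  rw [← hm, zpow_one] at hw
  simp only [Icc.coe_zero, Icc.coe_one, circ_zero_one] at hw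
  exact ⟨ψ (circ i ρ 0), by rw [hw]; group⟩

/-- The induced homomorphism respects the words of big circles after forgetting punctures. -/
lemma Ind.star {H : I → ℂ ≃ₜ ℂ} (hH : JC H) (h0 : H 0 = 1) (hh : Ind (H 1) θ ψ)
    (hP : Pres (H 1)) {π : ℤ → ℤ} (hπ : ∀ i : ℤ, H 1 i = π i) (hs : Function.Surjective π)
    (c : ℤ) (m : ℕ) (a : ℤ) (n : ℕ) (hca : ∀ i, π i ∈ Ico c (c + m) → i ∈ Ico a (a + n)) :
    IsConj (kill (Ico c (c + m)) (θ (seg a n))) (seg c m) := by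
  set W := Ico c (c + m) with hW
  set x : ℝ := a + n / 2 - 1 / 2 with hx
  obtain ⟨M, hM⟩ := exists_family_bound hH.inv (|(c : ℝ)| + m)
  obtain ⟨N, hN⟩ := exists_nat_gt (M + |x| + |(c : ℝ)| + m + 1)
  have hM0 : 0 ≤ M := (norm_nonneg _).trans (hM 0 0 (by rw [norm_zero]; positivity))
  set R : ℝ := n / 2 + N with hR
  have hN0 : (0 : ℝ) ≤ N := N.cast_nonneg
  have hn0 : (0 : ℝ) ≤ n / 2 := by positivity
  have hkW : ∀ k ∈ W, |(k : ℝ)| ≤ |(c : ℝ)| + m := fun k hk => by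
    have h1 : (c : ℝ) ≤ k := by exact_mod_cast hk.1
    have h2 : (k : ℝ) ≤ c + m := by exact_mod_cast hk.2.le
    have h3 : (0 : ℝ) ≤ m := m.cast_nonneg
    rw [abs_le]
    constructor
    · linarith [neg_abs_le (c : ℝ)]
    · linarith [le_abs_self (c : ℝ)]
  have hRW : ∀ k ∈ W, |(k : ℝ) - x| ≠ R := fun k hk e => by
    have h1 := abs_sub (k : ℝ) x
    have h2 := hkW k hk
    linarith
  have hrad : ∀ ρ : ℝ, n / 2 ≤ ρ → ∀ s, H 1 (circ x ρ s) ∈ Av W := fun ρ hρ s k hk e => by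
    obtain ⟨i, rfl⟩ := hs k
    have hi := hca i hk
    have : circ x ρ s = i := (H 1).injective (e.trans (hπ i).symm)
    have h1 := dist_circ x ρ s (hn0.trans hρ)
    rw [this, ← Complex.ofReal_intCast, ← Complex.ofReal_sub, Complex.norm_real, Real.norm_eq_abs]
      at h1
    have h2 : (a : ℝ) ≤ i := by exact_mod_cast hi.1
    have h3 : (i : ℝ) + 1 ≤ a + n := by exact_mod_cast hi.2
    have : |(i : ℝ) - x| ≤ n / 2 - 1 / 2 := abs_le.2 ⟨by rw [hx]; linarith, by rw [hx]; linarith⟩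
    linarith
  have hcc : Continuous fun s : I => circ x (n / 2) s :=
    continuous_circ continuous_const continuous_const continuous_subtype_val
  have hn : ∀ k ∈ (univ : Set ℤ), |(k : ℝ) - x| ≠ n / 2 := fun k _ e => by
    rcases abs_choice ((k : ℝ) - x) with h | h
    · rw [e, hx] at h
      have : (2 * n + 2 * a : ℝ) = 2 * k + 1 := by linarith
      norm_cast at this
      omega
    · rw [e, hx] at h
      have : (2 * a : ℝ) = 2 * k + 1 := by linarith
      norm_cast at this
      omega
  have hM1 := circ_mem_Av hn0 hn
  have e1 := hh _ hcc fun s => hM1 s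
  rw [wd_circ hn0 hn, pw_ceil_circ a n _ _ (by rw [hx]; ring) (by rw [hx]; ring), kill_univ] at e1
  have e2 := wd_kill (subset_univ W) ((H 1).continuous.comp hcc) fun s => (hP _).2 (hM1 s)
  simp only [Function.comp_def] at e2
  simp only [Icc.coe_zero, Icc.coe_one, circ_zero_one] at e1
  have c1 : IsConj (kill W (θ (seg a n))) (kill W (wd univ fun s : I => H 1 (circ x (n / 2) s))) := by
    rw [e1]
    exact (kill W).map_isConj (isConj_iff.2 ⟨(ψ (circ x (n / 2) 0))⁻¹, by rw [inv_inv]⟩)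
  rw [← e2] at c1
  have c2 := wd_isConj (W := W) (G := fun p : I × I => H 1 (circ x (n / 2 + p.1 * N) p.2))
    ((H 1).continuous.comp (continuous_circ continuous_const (by fun_prop) (by fun_prop)))
    (fun p => hrad _ (by have := p.1.2.1; nlinarith) _) fun t => by simp [circ_zero_one]
  simp only [Icc.coe_zero, Icc.coe_one, zero_mul, add_zero, one_mul, ← hR] at c2
  have c3 := wd_isConj (W := W) (G := fun p : I × I => H (σ p.1) (circ x R p.2))
    (hH.app (by fun_prop) (continuous_circ continuous_const continuous_const (by fun_prop)))
    (fun p k hk e => by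
      have h1 := hM (σ p.1) k (by
        rw [← Complex.ofReal_intCast, Complex.norm_real]; exact hkW k hk)
      rw [← e, inv_app_self] at h1
      have h2 := dist_circ x R p.2 (by positivity)
      have h3 := norm_sub_le (circ x R p.2) x
      rw [h2, Complex.norm_real, Real.norm_eq_abs] at h3
      have : (0 : ℝ) ≤ m := m.cast_nonneg
      linarith [abs_nonneg (c : ℝ)]) fun t => by simp [circ_zero_one]
  simp only [unitInterval.symm_zero, unitInterval.symm_one, h0, one_app] at c3
  rw [wd_circ (by positivity) hRW, pw_ceil_circ (a - N) (n + 2 * N) _ _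
    (by rw [hx, hR]; push_cast; ring) (by rw [hx, hR]; push_cast; ring), kill_seg_Ico] at c3
  · exact c1.trans (c2.trans c3)
  · have h1 := neg_abs_le (c : ℝ)
    have h2 := le_abs_self x
    have h3 : (0 : ℝ) ≤ m := m.cast_nonneg
    have : (a : ℝ) - N ≤ c := by linarith
    exact_mod_cast this
  · have h1 := le_abs_self (c : ℝ)
    have h2 := neg_abs_le x
    have : (c : ℝ) + m ≤ a - N + (n + 2 * N) := by linarith
    exact_mod_cast this

lemma Ind.adm {H : I → ℂ ≃ₜ ℂ} (hH : JC H) (h0 : H 0 = 1) (hh : Ind (H 1) θ ψ) (π : ℤ ≃ ℤ)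
    (hπ : ∀ i : ℤ, H 1 i = (π i : ℤ)) {f : I → ℂ ≃ₜ ℂ} (hf : JC f)
    (f0 : f 0 = H 1 * tau 2 * (H 1)⁻¹) (f1 : f 1 = tau 2)
    (hfix : ∀ t, ∀ i : ℤ, f t i = f 0 i) : ∃ ω, Adm θ π ω := by
  have hP : Pres (H 1) := pres_of_perm π hπ
  have h2 : ((2 : ℤ) : ℂ) = 2 := by norm_num
  have hfz : ∀ t, ∀ i : ℤ, f t i = (i + 2 : ℤ) := fun t i => by
    rw [hfix, ← hfix 1, f1, tau_app]; push_cast; rfl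
  have per : ∀ i, π (i + 2) = π i + 2 := fun i => by
    have h := hfz 0 (π i)
    rw [f0, mul_app, mul_app, ← hπ, inv_app_self, tau_app, ← h2, ← Int.cast_add, hπ] at h
    exact_mod_cast h
  have t2 := ind_tau 2
  have p2 := pres_tau 2
  rw [h2] at t2 p2
  have i1 := hh.mul t2 p2
  have i2 := t2.mul hh hP
  have hfP : ∀ t, Pres (f t) := fun t => pres_of_perm (Equiv.addRight 2) (hfz t)
  have i3 := Ind.isotopy (H := fun t => f t * H 1) (hf.mul (JC.const _))
    (fun t => (hfP t).mul hP) (by rw [f0, inv_mul_cancel_right]; exact i1)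
  rw [f1] at i3
  obtain ⟨v, hv⟩ := i3.conj_eq i2
  exact ⟨v, per, fun i => hh.exists_conj hH h0 hP i _ (hπ i), hv,
    hh.star hH h0 hP hπ π.surjective⟩

end PlaneTC

namespace PlaneTC
open FreeGroup (of)
open Topology unitInterval

/-- The rotation angle of the half twist at distance `r` from the centre. -/
noncomputable def ang (r : ℝ) : ℝ := Real.pi * max 0 (min 1 ((9 / 10 - r) / (3 / 10)))

lemma continuous_ang : Continuous ang := by unfold ang; fun_prop

lemma ang_of_ge {r : ℝ} (h : 9 / 10 ≤ r) : ang r = 0 := by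
  rw [ang, max_eq_left, mul_zero]
  exact (min_le_right _ _).trans (by rw [div_le_iff₀ (by norm_num)]; linarith)

lemma ang_mem (r : ℝ) : 0 ≤ ang r ∧ ang r ≤ Real.pi := by
  have h := Real.pi_pos
  have h1 : max 0 (min 1 ((9 / 10 - r) / (3 / 10))) ≤ 1 := max_le zero_le_one (min_le_left _ _)
  exact ⟨mul_nonneg h.le (le_max_left _ _), by unfold ang; nlinarith⟩

lemma ang_le {r : ℝ} (h : 3 / 4 ≤ r) : ang r ≤ Real.pi / 2 := by
  have h0 := Real.pi_pos
  have h1 : max 0 (min 1 ((9 / 10 - r) / (3 / 10))) ≤ 1 / 2 :=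
    max_le (by norm_num) ((min_le_right _ _).trans (by rw [div_le_iff₀ (by norm_num)]; linarith))
  unfold ang; nlinarith

lemma le_ang {r : ℝ} (h : r ≤ 3 / 4) : Real.pi / 2 ≤ ang r := by
  have h0 := Real.pi_pos
  have h1 : 1 / 2 ≤ max 0 (min 1 ((9 / 10 - r) / (3 / 10))) :=
    le_max_of_le_right (le_min (by norm_num) (by rw [le_div_iff₀ (by norm_num)]; linarith))
  unfold ang; nlinarith

lemma ang_eq {r : ℝ} (h : ang r = Real.pi / 2) : r = 3 / 4 := by
  have h0 := Real.pi_pos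
  have h1 : max 0 (min 1 ((9 / 10 - r) / (3 / 10))) = 1 / 2 := by
    unfold ang at h
    have : Real.pi * (max 0 (min 1 ((9 / 10 - r) / (3 / 10))) - 1 / 2) = 0 := by linarith
    rcases mul_eq_zero.1 this with h | h <;> linarith
  rcases max_choice 0 (min 1 ((9 / 10 - r) / (3 / 10))) with e | e <;> rw [e] at h1
  · norm_num at h1
  rcases min_choice 1 ((9 / 10 - r) / (3 / 10)) with e | e <;> rw [e] at h1
  · norm_num at h1
  · rw [div_eq_iff (by norm_num)] at h1; linarith

lemma ang_half : ang (1 / 2) = Real.pi := by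
  norm_num [ang]

/-- The centres of the half twists. -/
noncomputable def ctr (n : ℤ) : ℝ := 2 * n + 1 / 2

/-- Rotation by the angle `-s * ang` around `c`. -/
noncomputable def rot (s : ℝ) (c : ℝ) (z : ℂ) : ℂ :=
  c + (z - c) * Complex.exp ((-(s * ang ‖z - c‖) : ℝ) * Complex.I)

lemma continuous_rot (c : ℝ) : Continuous fun p : ℝ × ℂ => rot p.1 c p.2 := by
  unfold rot
  have := continuous_ang
  fun_prop

lemma rot_of_ge {s c : ℝ} {z : ℂ} (h : 9 / 10 ≤ ‖z - c‖) : rot s c z = z := by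
  simp [rot, ang_of_ge h]

lemma norm_rot (s c : ℝ) (z : ℂ) : ‖rot s c z - c‖ = ‖z - c‖ := by
  rw [rot, add_sub_cancel_left, norm_mul, Complex.norm_exp_ofReal_mul_I, mul_one]

lemma rot_neg (s c : ℝ) (z : ℂ) : rot (-s) c (rot s c z) = z := by
  rw [rot, norm_rot]
  rw [rot, add_sub_cancel_left, mul_assoc, ← Complex.exp_add]
  simp

lemma abs_re_le_norm_sub (z : ℂ) (c : ℝ) : |z.re - c| ≤ ‖z - c‖ := by
  simpa using Complex.abs_re_le_norm (z - c)

/-- The simultaneous twist at all centres. -/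
noncomputable def twf (s : ℝ) (z : ℂ) : ℂ := rot s (ctr (round ((z.re - 1 / 2) / 2))) z

lemma abs_sub_ctr_round (z : ℂ) : |z.re - ctr (round ((z.re - 1 / 2) / 2))| ≤ 1 := by
  have := abs_le.1 (abs_sub_round ((z.re - 1 / 2) / 2))
  rw [ctr, abs_le]
  constructor <;> linarith

lemma twf_eq {s : ℝ} {z : ℂ} {n : ℤ} (h : |z.re - ctr n| ≤ 11 / 10) :
    twf s z = rot s (ctr n) z := by
  have h1 := abs_sub_ctr_round z
  set m := round ((z.re - 1 / 2) / 2) with hm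
  rw [twf, ← hm]
  by_cases hmn : m = n
  · rw [hmn]
  rw [abs_le] at h h1
  have h2 := abs_re_le_norm_sub z (ctr n)
  have h3 := abs_re_le_norm_sub z (ctr m)
  have h4 := (abs_le.1 h2)
  have h5 := (abs_le.1 h3)
  rw [ctr] at h h1
  rcases lt_or_gt_of_ne hmn with h6 | h6
  · have h7 : (m : ℝ) + 1 ≤ n := by exact_mod_cast h6
    rw [rot_of_ge, rot_of_ge]
    · refine le_trans ?_ h2
      rw [le_abs, ctr]; right; linarith
    · refine le_trans ?_ h3
      rw [le_abs, ctr]; left; linarith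
  · have h7 : (n : ℝ) + 1 ≤ m := by exact_mod_cast h6
    rw [rot_of_ge, rot_of_ge]
    · refine le_trans ?_ h2
      rw [le_abs, ctr]; left; linarith
    · refine le_trans ?_ h3
      rw [le_abs, ctr]; right; linarith

lemma twf_of_im {s : ℝ} {z : ℂ} (h : 9 / 10 ≤ |z.im|) : twf s z = z :=
  rot_of_ge (h.trans (by simpa using Complex.abs_im_le_norm (z - ctr (round ((z.re - 1 / 2) / 2)))))

lemma continuous_twf : Continuous fun p : ℝ × ℂ => twf p.1 p.2 := by
  refine continuous_iff_continuousAt.2 fun p => ?_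
  refine (continuous_rot (ctr (round ((p.2.re - 1 / 2) / 2)))).continuousAt.congr ?_
  have ho : IsOpen {q : ℝ × ℂ | |q.2.re - ctr (round ((p.2.re - 1 / 2) / 2))| < 11 / 10} :=
    isOpen_lt (by fun_prop) continuous_const
  filter_upwards [ho.mem_nhds (show |p.2.re - ctr _| < 11 / 10 from
    (abs_sub_ctr_round p.2).trans_lt (by norm_num))] with q hq
  exact (twf_eq (le_of_lt hq)).symm

lemma twf_neg (s : ℝ) (z : ℂ) : twf (-s) (twf s z) = z := by
  set n := round ((z.re - 1 / 2) / 2) with hn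
  have h1 := abs_sub_ctr_round z
  rw [← hn] at h1
  rw [twf_eq (n := n) (z := z) (h1.trans (by norm_num)), twf_eq (n := n), rot_neg]
  rcases le_or_gt (9 / 10) ‖z - ctr n‖ with h | h
  · rw [rot_of_ge h]; exact h1.trans (by norm_num)
  · refine (abs_re_le_norm_sub _ _).trans ?_
    rw [norm_rot]
    linarith

lemma twf_add_two (s : ℝ) (z : ℂ) : twf s (z + 2) = twf s z + 2 := by
  set n := round ((z.re - 1 / 2) / 2) with hn
  have h1 := abs_sub_ctr_round z
  rw [← hn] at h1
  have h2 : ctr (n + 1) = ctr n + 2 := by simp only [ctr]; push_cast; ring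
  have h3 : (z + 2).re - ctr (n + 1) = z.re - ctr n := by rw [h2]; simp
  rw [twf_eq (n := n) (z := z) (h1.trans (by norm_num)),
    twf_eq (n := n + 1) (z := z + 2) (by rw [h3]; exact h1.trans (by norm_num))]
  have h4 : z + 2 - ctr (n + 1) = z - ctr n := by rw [h2]; push_cast; ring
  rw [rot, rot, h4, h2]
  push_cast
  ring

lemma continuous_twf_right (s : ℝ) : Continuous fun z => twf s z := by
  have h : Continuous fun z : ℂ => ((s, z) : ℝ × ℂ) := by fun_prop
  have := continuous_twf.comp h
  simpa only [Function.comp_def] using this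

/-- The family of twists as homeomorphisms. -/
noncomputable def tw (s : ℝ) : ℂ ≃ₜ ℂ where
  toFun := twf s
  invFun := twf (-s)
  left_inv := twf_neg s
  right_inv z := by simpa using twf_neg (-s) z
  continuous_toFun := continuous_twf_right s
  continuous_invFun := continuous_twf_right (-s)

lemma tw_app (s : ℝ) (z : ℂ) : tw s z = twf s z := rfl

lemma jc_tw : JC tw := continuous_twf

lemma tw_zero : tw 0 = 1 := by
  ext z
  simp [tw_app, twf, rot]

lemma tw_tau (s : ℝ) : tw s * tau 2 = tau 2 * tw s := by
  ext z
  simp [tau_app, tw_app, twf_add_two]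

/-- The transposition of `2n` and `2n + 1` for all `n`. -/
def swp : ℤ ≃ ℤ where
  toFun i := if Even i then i + 1 else i - 1
  invFun i := if Even i then i + 1 else i - 1
  left_inv i := by grind
  right_inv i := by grind

lemma tw_int (i : ℤ) : tw 1 i = (swp i : ℤ) := by
  have key : ∀ n : ℤ, ∀ v : ℝ, |v| = 1 / 2 → tw 1 ((ctr n + v : ℝ) : ℂ) = ((ctr n - v : ℝ) : ℂ) := by
    intro n v hv
    rw [tw_app, twf_eq (n := n) (by simp [hv]; norm_num), rot, Complex.ofReal_add,
      add_sub_cancel_left, Complex.norm_real, Real.norm_eq_abs, hv, ang_half]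
    rw [one_mul, Complex.ofReal_neg, neg_mul, Complex.exp_neg, Complex.exp_pi_mul_I]
    push_cast
    ring
  rcases Int.even_or_odd' i with ⟨n, rfl | rfl⟩
  · have := key n (-1 / 2) (by norm_num)
    rw [show ctr n + -1 / 2 = ((2 * n : ℤ) : ℝ) by rw [ctr]; push_cast; ring,
      show ctr n - -1 / 2 = ((2 * n + 1 : ℤ) : ℝ) by rw [ctr]; push_cast; ring,
      Complex.ofReal_intCast, Complex.ofReal_intCast] at this
    rw [this, show swp (2 * n) = 2 * n + 1 from if_pos (by simp)]
  · have := key n (1 / 2) (by norm_num)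
    rw [show ctr n + 1 / 2 = ((2 * n + 1 : ℤ) : ℝ) by rw [ctr]; push_cast; ring,
      show ctr n - 1 / 2 = ((2 * n : ℤ) : ℝ) by rw [ctr]; push_cast; ring,
      Complex.ofReal_intCast, Complex.ofReal_intCast] at this
    rw [this, show swp (2 * n + 1) = 2 * n + 1 - 1 from if_neg (by simp), add_sub_cancel_right]

lemma pres_tw : Pres (tw 1) := pres_of_perm swp tw_int

end PlaneTC

namespace PlaneTC
open FreeGroup (of)
open Topology unitInterval

lemma wd_line {x y c : ℝ} (hc : c = 1 ∨ c = -1) {W : Set ℤ} :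
    (∀ t : I, (⟨x + t * (y - x), c⟩ : ℂ) ∈ Av W) ∧
    wd W (fun t : I => (⟨x + t * (y - x), c⟩ : ℂ)) =
      if c = 1 then kill W (pw ⌈x⌉ * (pw ⌈y⌉)⁻¹) else 1 := by
  have hcont : Continuous fun t : I => (⟨x + t * (y - x), c⟩ : ℂ) := by
    have : (fun t : I => (⟨x + t * (y - x), c⟩ : ℂ)) =
        fun t : I => ((x + t * (y - x) : ℝ) : ℂ) + c * Complex.I := by
      funext t
      apply Complex.ext <;> simp
    rw [this]
    fun_prop
  rcases hc with rfl | rfl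
  · have h : ∀ t : I, (⟨x + t * (y - x), 1⟩ : ℂ) ∈ Up W := fun t => Or.inl one_pos
    refine ⟨fun t => Up_subset_Av (h t), ?_⟩
    rw [wd_of_Up hcont h, if_pos rfl]
    simp [ph]
  · have h : ∀ t : I, (⟨x + t * (y - x), -1⟩ : ℂ) ∈ Lo W := fun t => Or.inl (by simp)
    refine ⟨fun t => Lo_subset_Av (h t), ?_⟩
    rw [wd_of_Lo hcont h, if_neg (by norm_num)]

/-- The vertical segment through the centre `ctr n`, downwards. -/
noncomputable def vert (x : ℝ) (t : ℝ) : ℂ := ⟨x, 1 - 2 * t⟩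

lemma continuous_vert (x : ℝ) : Continuous fun t : I => vert x t := by
  have : (fun t : I => vert x t) = fun t : I => (x : ℂ) + ((1 - 2 * t : ℝ) : ℂ) * Complex.I := by
    funext t
    apply Complex.ext <;> simp [vert]
  rw [this]
  fun_prop

lemma wd_vert {x : ℝ} (hx : ∀ k : ℤ, x ≠ k) :
    (∀ t : I, vert x t ∈ Av univ) ∧ wd univ (fun t : I => vert x t) = 1 := by
  have h : ∀ t : I, vert x t ∈ Lo univ := fun t => Or.inr fun k _ => hx k
  exact ⟨fun t => Lo_subset_Av (h t), wd_of_Lo (continuous_vert x) h⟩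

lemma tw_vert (n : ℤ) (t : ℝ) : tw 1 (vert (ctr n) t) =
    ⟨ctr n + (1 - 2 * t) * Real.sin (ang |1 - 2 * t|), (1 - 2 * t) * Real.cos (ang |1 - 2 * t|)⟩ := by
  have e : vert (ctr n) t - ctr n = ((1 - 2 * t : ℝ) : ℂ) * Complex.I := by
    apply Complex.ext <;> simp [vert]
  rw [tw_app, twf_eq (n := n) (by simp [vert]; norm_num), rot, e, norm_mul, Complex.norm_real,
    Complex.norm_I, mul_one, Real.norm_eq_abs, Complex.exp_mul_I, ← Complex.ofReal_cos,
    ← Complex.ofReal_sin, one_mul, Real.cos_neg, Real.sin_neg]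
  apply Complex.ext <;> simp [-Complex.ofReal_sin, -Complex.ofReal_cos]

lemma wd_tw_vert (n : ℤ) : wd univ (fun t : I => tw 1 (vert (ctr n) t)) =
    of (2 * n + 1) * (of (2 * n))⁻¹ := by
  have hnz : ∀ k : ℤ, ctr n ≠ k := fun k e => by
    rw [ctr] at e
    have : (4 * n + 1 : ℝ) = 2 * k := by linarith
    norm_cast at this
    omega
  have hc : Continuous fun t : I => tw 1 (vert (ctr n) t) :=
    (tw 1).continuous.comp (continuous_vert _)
  have hM : ∀ t : I, tw 1 (vert (ctr n) t) ∈ Av univ := fun t => (pres_tw _).2 ((wd_vert hnz).1 t)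
  have hre : ∀ t : I, (1 - 2 * (t : ℝ)) * Real.cos (ang |1 - 2 * (t : ℝ)|) = 0 → ∀ k : ℤ,
      ctr n + (1 - 2 * (t : ℝ)) * Real.sin (ang |1 - 2 * (t : ℝ)|) ≠ k := by
    intro t ht k
    rcases mul_eq_zero.1 ht with h | h
    · rw [h, zero_mul, add_zero]; exact hnz k
    · have h1 : ang |1 - 2 * (t : ℝ)| = Real.pi / 2 :=
        Real.injOn_cos ⟨(ang_mem _).1, (ang_mem _).2⟩
          ⟨by positivity, by linarith [Real.pi_pos]⟩ (by rw [h, Real.cos_pi_div_two])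
      have h2 := ang_eq h1
      rw [h1, Real.sin_pi_div_two, mul_one, ctr]
      intro e
      rcases abs_choice (1 - 2 * (t : ℝ)) with h3 | h3
      · have : (8 * n + 5 : ℝ) = 4 * k := by linarith
        norm_cast at this
        omega
      · have : (8 * n - 1 : ℝ) = 4 * k := by linarith
        have : (8 * n : ℝ) = 4 * k + 1 := by linarith
        norm_cast at this
        omega
  have hLo : ∀ t : I, (1 - 2 * (t : ℝ)) * Real.cos (ang |1 - 2 * (t : ℝ)|) ≤ 0 →
      tw 1 (vert (ctr n) t) ∈ Lo univ := fun t ht => by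
    rw [tw_vert]
    rcases ht.lt_or_eq with h | h
    · exact Or.inl h
    · exact Or.inr fun k _ => hre t h k
  have hUp : ∀ t : I, 0 ≤ (1 - 2 * (t : ℝ)) * Real.cos (ang |1 - 2 * (t : ℝ)|) →
      tw 1 (vert (ctr n) t) ∈ Up univ := fun t ht => by
    rw [tw_vert]
    rcases ht.lt_or_eq with h | h
    · exact Or.inl h
    · exact Or.inr fun k _ => hre t h.symm k
  have cpos : ∀ r : ℝ, 3 / 4 ≤ r → 0 ≤ Real.cos (ang r) := fun r hr =>
    Real.cos_nonneg_of_mem_Icc ⟨by linarith [(ang_mem r).1, Real.pi_pos], ang_le hr⟩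
  have cneg : ∀ r : ℝ, r ≤ 3 / 4 → Real.cos (ang r) ≤ 0 := fun r hr =>
    Real.cos_nonpos_of_pi_div_two_le_of_le (le_ang hr) (by linarith [(ang_mem r).2, Real.pi_pos])
  obtain ⟨u, hu⟩ := exists_lift_I hc hM
  let q1 : I := ⟨1 / 8, by norm_num, by norm_num⟩
  let q2 : I := ⟨1 / 2, by norm_num, by norm_num⟩
  let q3 : I := ⟨7 / 8, by norm_num, by norm_num⟩
  have e1 := hu.eq_of_Up hc (S := Icc 0 q1) isPreconnected_Icc (x := 0) (y := q1)
    (fun t ht => hUp t (by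
      have h1 : (t : ℝ) ≤ 1 / 8 := ht.2
      rw [abs_of_nonneg (by linarith)]
      exact mul_nonneg (by linarith) (cpos _ (by linarith)))) (by simp [q1]) (by simp [q1])
  have e2 := hu.eq_of_Lo hc (S := Icc q1 q2) isPreconnected_Icc (x := q1) (y := q2)
    (fun t ht => hLo t (by
      have h1 : (t : ℝ) ≤ 1 / 2 := ht.2
      have h2 : 1 / 8 ≤ (t : ℝ) := ht.1
      rw [abs_of_nonneg (by linarith)]
      exact mul_nonpos_of_nonneg_of_nonpos (by linarith) (cneg _ (by linarith))))
    (by simp [q1, q2, ← Subtype.coe_le_coe]; norm_num)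
    (by simp [q1, q2, ← Subtype.coe_le_coe]; norm_num)
  have e3 := hu.eq_of_Up hc (S := Icc q2 q3) isPreconnected_Icc (x := q2) (y := q3)
    (fun t ht => hUp t (by
      have h1 : (t : ℝ) ≤ 7 / 8 := ht.2
      have h2 : 1 / 2 ≤ (t : ℝ) := ht.1
      rw [abs_of_nonpos (by linarith)]
      exact mul_nonneg_of_nonpos_of_nonpos (by linarith) (cneg _ (by linarith))))
    (by simp [q3, q2, ← Subtype.coe_le_coe]; norm_num)
    (by simp [q3, q2, ← Subtype.coe_le_coe]; norm_num)
  have e4 := hu.eq_of_Lo hc (S := Icc q3 1) isPreconnected_Icc (x := q3) (y := 1)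
    (fun t ht => hLo t (by
      have h1 : (t : ℝ) ≤ 1 := t.2.2
      have h2 : 7 / 8 ≤ (t : ℝ) := ht.1
      rw [abs_of_nonpos (by linarith)]
      exact mul_nonpos_of_nonpos_of_nonneg (by linarith) (cpos _ (by linarith))))
    (by simp [q3, ← Subtype.coe_le_coe]; norm_num)
    (by simp [q3, ← Subtype.coe_le_coe]; norm_num)
  have a34 : ang (3 / 4) = Real.pi / 2 := le_antisymm (ang_le le_rfl) (le_ang le_rfl)
  have p0 : ph (tw 1 (vert (ctr n) (0 : I))) = pw (2 * n + 1) := by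
    rw [tw_vert, ph, Icc.coe_zero, mul_zero, sub_zero, abs_one, ang_of_ge (by norm_num),
      Real.sin_zero, mul_zero, add_zero, ctr]
    congr 1
    rw [Int.ceil_eq_iff]
    constructor <;> push_cast <;> linarith
  have p1 : ph (tw 1 (vert (ctr n) q1)) = pw (2 * n + 2) := by
    rw [tw_vert, ph, show (1 - 2 * (q1 : ℝ)) = 3 / 4 by simp [q1]; norm_num,
      abs_of_pos (by norm_num), a34, Real.sin_pi_div_two, ctr]
    congr 1
    rw [Int.ceil_eq_iff]
    constructor <;> push_cast <;> linarith
  have p2 : ph (tw 1 (vert (ctr n) q2)) = pw (2 * n + 1) := by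
    rw [tw_vert, ph, show (1 - 2 * (q2 : ℝ)) = 0 by simp [q2], zero_mul, add_zero, ctr]
    congr 1
    rw [Int.ceil_eq_iff]
    constructor <;> push_cast <;> linarith
  have p3 : ph (tw 1 (vert (ctr n) q3)) = pw (2 * n) := by
    rw [tw_vert, ph, show (1 - 2 * (q3 : ℝ)) = -(3 / 4) by simp [q3]; norm_num, abs_neg,
      abs_of_pos (by norm_num), a34, Real.sin_pi_div_two, ctr]
    congr 1
    rw [Int.ceil_eq_iff]
    constructor <;> push_cast <;> linarith
  rw [hu.wd_eq hM]
  simp only [p0, p1, p2, p3, kill_univ] at e1 e3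
  rw [← e4, inv_mul_eq_iff_eq_mul]
  rw [e2] at e1
  have f1 := pw_rec (2 * n + 1)
  have f2 := pw_rec (2 * n)
  rw [show 2 * n + 1 + 1 = 2 * n + 2 by ring] at f1
  rw [f2] at e3
  rw [f1] at e1
  have f3 : u q2 = u 0 * of (2 * n + 1) := by
    rw [← mul_assoc] at e1
    exact (mul_right_cancel e1).symm
  rw [f3, f1] at e3
  rw [← mul_assoc, eq_mul_inv_iff_mul_eq]
  have := mul_right_cancel (b := of (2 * n + 1) * pw (2 * n + 2))
    (a := u 0 * of (2 * n + 1)) (c := u q3 * of (2 * n)) (by rw [e3]; group)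
  exact this.symm

theorem exists_ind_tw : ∃ ψ, Ind (tw 1) A0 ψ := by
  obtain ⟨θ, ψ, h⟩ := pres_tw.exists_ind
  set v := ψ ⟨0, -1⟩ with hv
  set θ' : F →* F := (MulAut.conj v⁻¹).toMonoidHom.comp θ with hθ'
  have h := h.of_conj (θ' := θ') v fun g => by simp [hθ']; group
  set ψ' : ℂ → F := fun p => v⁻¹ * ψ p with hψ'
  have h0 : ψ' ⟨0, -1⟩ = 1 := by simp [hψ', hv]
  have hline : ∀ (c x y : ℝ), c = 1 ∨ c = -1 → ∀ f : I → ℂ,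
      f = (fun t : I => (⟨x + t * (y - x), c⟩ : ℂ)) →
      wd univ f = (ψ' ⟨x, c⟩)⁻¹ * θ' (wd univ f) * ψ' ⟨y, c⟩ := by
    intro c x y hc f hf
    have hcont : Continuous f := by
      have : f = fun t : I => ((x + t * (y - x) : ℝ) : ℂ) + c * Complex.I := by
        rw [hf]; funext t
        apply Complex.ext <;> simp
      rw [this]
      fun_prop
    have := h f hcont (by rw [hf]; exact (wd_line hc).1)
    rw [show (fun t => tw 1 (f t)) = f from funext fun t => twf_of_im (by
      rw [hf]
      rcases hc with rfl | rfl <;> norm_num),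
      show f 0 = ⟨x, c⟩ by simp [hf], show f 1 = ⟨y, c⟩ by simp [hf]] at this
    exact this
  have hlow : ∀ x : ℝ, ψ' ⟨x, -1⟩ = 1 := fun x => by
    have := hline (-1) 0 x (Or.inr rfl) _ rfl
    rw [(wd_line (Or.inr rfl)).2, if_neg (by norm_num), map_one, h0] at this
    simpa using this.symm
  have hup : ∀ x y : ℝ, pw ⌈x⌉ * (pw ⌈y⌉)⁻¹ =
      (ψ' ⟨x, 1⟩)⁻¹ * θ' (pw ⌈x⌉ * (pw ⌈y⌉)⁻¹) * ψ' ⟨y, 1⟩ := fun x y => by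
    have := hline 1 x y (Or.inl rfl) _ rfl
    rwa [(wd_line (Or.inl rfl)).2, if_pos rfl, kill_univ] at this
  have hside : ∀ n : ℤ, ψ' ⟨ctr n - 1, 1⟩ = 1 := fun n => by
    have hk : ∀ k : ℤ, ctr n - 1 ≠ k := fun k e => by
      rw [ctr] at e
      have : (4 * n : ℝ) = 2 * k + 1 := by linarith
      norm_cast at this
      omega
    have := h _ (continuous_vert (ctr n - 1)) (wd_vert hk).1
    rw [show (fun t : I => tw 1 (vert (ctr n - 1) t)) = fun t : I => vert (ctr n - 1) t from
      funext fun t => by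
        rw [tw_app, twf_eq (n := n) (by simp [vert]; norm_num), rot_of_ge]
        refine le_trans ?_ (abs_re_le_norm_sub _ _)
        simp [vert]; norm_num, (wd_vert hk).2, map_one] at this
    have e1 : vert (ctr n - 1) (1 : I) = ⟨ctr n - 1, -1⟩ := by simp [vert]; norm_num
    have e0 : vert (ctr n - 1) (0 : I) = ⟨ctr n - 1, 1⟩ := by simp [vert]
    rw [e1, e0, hlow] at this
    simpa using this.symm
  have c1 : ∀ n : ℤ, ⌈ctr n - 1⌉ = 2 * n := fun n => by
    rw [Int.ceil_eq_iff, ctr]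
    constructor <;> push_cast <;> linarith
  have c2 : ∀ n : ℤ, ⌈ctr n⌉ = 2 * n + 1 := fun n => by
    rw [Int.ceil_eq_iff, ctr]
    constructor <;> push_cast <;> linarith
  have k1 : ∀ n : ℤ, of (2 * n) = θ' (of (2 * n)) * ψ' ⟨ctr n, 1⟩ := fun n => by
    have := hup (ctr n - 1) (ctr n)
    rwa [c1, c2, hside, pw_rec (2 * n), mul_inv_cancel_right, inv_one, one_mul] at this
  have k2 : ∀ n : ℤ, θ' (of (2 * n)) * θ' (of (2 * n + 1)) = of (2 * n) * of (2 * n + 1) :=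
      fun n => by
    have := hup (ctr n - 1) (ctr (n + 1) - 1)
    rw [c1, c1, hside, hside, pw_rec (2 * n), pw_rec (2 * n + 1),
      show 2 * n + 1 + 1 = 2 * (n + 1) by ring, ← mul_assoc, mul_inv_cancel_right, inv_one,
      one_mul, mul_one, map_mul] at this
    exact this.symm
  have k3 : ∀ n : ℤ, of (2 * n + 1) * (of (2 * n))⁻¹ = (ψ' ⟨ctr n, 1⟩)⁻¹ := fun n => by
    have hk : ∀ k : ℤ, ctr n ≠ k := fun k e => by
      rw [ctr] at e
      have : (4 * n + 1 : ℝ) = 2 * k := by linarith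
      norm_cast at this
      omega
    have := h _ (continuous_vert (ctr n)) (wd_vert hk).1
    have e1 : vert (ctr n) (1 : I) = ⟨ctr n, -1⟩ := by simp [vert]; norm_num
    have e0 : vert (ctr n) (0 : I) = ⟨ctr n, 1⟩ := by simp [vert]
    rwa [wd_tw_vert, (wd_vert hk).2, map_one, mul_one, e1, e0, hlow, mul_one] at this
  have k4 : ∀ n : ℤ, θ' (of (2 * n)) = of (2 * n) * of (2 * n + 1) * (of (2 * n))⁻¹ := fun n => by
    have := k1 n
    rw [← mul_inv_eq_iff_eq_mul, ← k3] at this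
    rw [← this]; group
  have : θ' = A0 := FreeGroup.ext_hom _ _ fun i => by
    rcases Int.even_or_odd' i with ⟨n, rfl | rfl⟩
    · rw [k4]; simp [A0]
    · have := k2 n
      rw [k4] at this
      rw [show A0 (of (2 * n + 1)) = of (2 * n) by simp [A0]]
      rw [← eq_inv_mul_iff_mul_eq] at this
      rw [this]; group
  exact ⟨ψ', this ▸ h⟩

/-- The endomorphisms induced by homeomorphisms commuting with the translation by two. -/
def Good (s : F →* F) : Prop := ∃ H : I → ℂ ≃ₜ ℂ, JC H ∧ H 0 = 1 ∧ H 1 * tau 2 = tau 2 * H 1 ∧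
  (∃ e : ℤ ≃ ℤ, ∀ i : ℤ, H 1 i = (e i : ℤ)) ∧ ∃ ψ, Ind (H 1) s ψ

lemma Good.comp {s r : F →* F} (hs : Good s) (hr : Good r) : Good (s.comp r) := by
  obtain ⟨H, h1, h2, h3, ⟨e, he⟩, ψ, h4⟩ := hs
  obtain ⟨K, k1, k2, k3, ⟨f, hf⟩, ψ', k4⟩ := hr
  refine ⟨fun t => H t * K t, h1.mul k1, by simp only [h2, k2, mul_one], ?_, ⟨f.trans e, fun i => ?_⟩,
    _, h4.mul k4 (pres_of_perm f hf)⟩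
  · rw [mul_assoc, k3, ← mul_assoc, h3, mul_assoc]
  · rw [mul_app, hf, he]; rfl

lemma Good.one : Good (MonoidHom.id F) :=
  ⟨fun _ => 1, JC.const 1, rfl, by rw [one_mul, mul_one], ⟨Equiv.refl ℤ, fun _ => rfl⟩, _, Ind.one⟩

lemma Good.inv {s r : F →* F} (hs : Good s) (e : ∀ g, r (s g) = g) : Good r := by
  obtain ⟨H, h1, h2, h3, ⟨f, hf⟩, ψ, h4⟩ := hs
  refine ⟨fun t => (H t)⁻¹, h1.inv, by simp only [h2, inv_one], ?_, ⟨f.symm, fun i => ?_⟩,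
    _, h4.inv (pres_of_perm f hf) e⟩
  · rw [inv_mul_eq_iff_eq_mul, ← mul_assoc, h3, mul_inv_cancel_right]
  · rw [inv_app_eq, hf, f.apply_symm_apply]

lemma Good.A0 : Good A0 := by
  obtain ⟨ψ, h⟩ := exists_ind_tw
  exact ⟨fun t => tw t, jc_tw.comp continuous_subtype_val, tw_zero, tw_tau 1, ⟨swp, tw_int⟩, ψ, h⟩

lemma Good.A0' : Good A0' := Good.A0.inv fun g => by
  refine hom_ext_of (f := PlaneTC.A0'.comp PlaneTC.A0) (g := MonoidHom.id F) (fun i => ?_) g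
  rcases Int.even_or_odd' i with ⟨n, rfl | rfl⟩
  · have e : ¬ Odd (2 * n) := by grind
    simp [PlaneTC.A0, PlaneTC.A0', e]
    group
  · have e : ¬ Odd (2 * n) := by grind
    simp [PlaneTC.A0, PlaneTC.A0', e]

lemma Good.A1 : Good A1 := by
  obtain ⟨ψ, h⟩ := exists_ind_tw
  have t1 := ind_tau 1
  have p1 := pres_tau 1
  have hi := t1.inv (θ' := (sh (-1)).toMonoidHom) p1 fun g => by
    change sh (-1) (sh 1 g) = g
    rw [sh_sh]; simp
  have hA : ((sh 1).toMonoidHom.comp PlaneTC.A0).comp (sh (-1)).toMonoidHom = PlaneTC.A1 :=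
    FreeGroup.ext_hom _ _ fun i => by
      rcases Int.even_or_odd' i with ⟨n, rfl | rfl⟩
      · have : ¬ Even (2 * n + -1) := by grind
        simp [PlaneTC.A0, PlaneTC.A1, this]
        ring_nf
      · simp [PlaneTC.A0, PlaneTC.A1]
  have hh := (t1.mul h pres_tw).mul hi p1.inv
  rw [hA] at hh
  refine ⟨fun t => tau (1 : ℤ) * tw t * (tau (1 : ℤ))⁻¹,
    ((JC.const _).mul (jc_tw.comp continuous_subtype_val)).mul (JC.const _),
    by simp only [Icc.coe_zero, tw_zero, mul_one, mul_inv_cancel], ?_,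
    ⟨((Equiv.addRight 1).symm.trans swp).trans (Equiv.addRight 1), fun i => ?_⟩, _, hh⟩
  · have : tau 2 * tau (1 : ℤ) = tau (1 : ℤ) * tau 2 := by
      ext z; simp only [mul_app, tau_app]; ring
    have e2 : (tau (1 : ℤ))⁻¹ * tau 2 = tau 2 * (tau (1 : ℤ))⁻¹ := by
      rw [inv_mul_eq_iff_eq_mul, ← mul_assoc, ← this, mul_inv_cancel_right]
    simp only [Icc.coe_one]
    rw [mul_assoc, e2, ← mul_assoc, mul_assoc _ (tw 1), tw_tau, ← mul_assoc, ← this]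
    simp only [mul_assoc]
  · rw [mul_app, mul_app, tau_inv_app, ← Int.cast_sub, Icc.coe_one, tw_int, tau_app]
    simp [sub_eq_add_neg]

lemma Good.A1' : Good A1' := Good.A1.inv fun g => by
  refine hom_ext_of (f := PlaneTC.A1'.comp PlaneTC.A1) (g := MonoidHom.id F) (fun i => ?_) g
  rcases Int.even_or_odd' i with ⟨n, rfl | rfl⟩
  · have : ¬ Even (2 * n - 1) := by grind
    simp [PlaneTC.A1, PlaneTC.A1', this]
  · have e : ¬ Odd (2 * n) := by grind
    simp [PlaneTC.A1, PlaneTC.A1', e]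
    group

/-- A homeomorphism whose class commutes with that of the translation by two acts on words as
a homeomorphism commuting with that translation. -/
theorem exists_triv {H : I → ℂ ≃ₜ ℂ} (hH : JC H) (h0 : H 0 = 1) (π : ℤ ≃ ℤ)
    (hπ : ∀ i : ℤ, H 1 i = (π i : ℤ)) {f : I → ℂ ≃ₜ ℂ} (hf : JC f)
    (f0 : f 0 = H 1 * tau 2 * (H 1)⁻¹) (f1 : f 1 = tau 2)
    (hfix : ∀ t, ∀ i : ℤ, f t i = f 0 i) :
    ∃ K : I → ℂ ≃ₜ ℂ, JC K ∧ K 0 = 1 ∧ K 1 * tau 2 = tau 2 * K 1 ∧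
      (∀ i : ℤ, H 1 i = K 1 i) ∧ Triv (H 1 * (K 1)⁻¹) := by
  obtain ⟨θ, ψ, h⟩ := (pres_of_perm π hπ).exists_ind
  obtain ⟨ω, hω⟩ := h.adm hH h0 π hπ hf f0 f1 hfix
  obtain ⟨s, ⟨S, hS, S0, ST, ⟨e, he⟩, ψs, hs⟩, lam, b, hb⟩ := hω.exists_shift (Good := Good) .one
    (fun s hs => hs.comp .A0) (fun s hs => hs.comp .A0') (fun s hs => hs.comp .A1)
    (fun s hs => hs.comp .A1')
  have hτ : JC fun t : I => tau ((t * b : ℝ) : ℂ) := by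
    have : Continuous fun p : I × ℂ => p.2 + ((p.1 * b : ℝ) : ℂ) := by fun_prop
    exact this
  set K : I → ℂ ≃ₜ ℂ := fun t => tau ((t * b : ℝ) : ℂ) * (S t)⁻¹ with hK
  have hKJ : JC K := hτ.mul hS.inv
  have K0 : K 0 = 1 := by
    ext z
    simp [hK, S0, tau_app]
  have K1 : K 1 = tau (b : ℂ) * (S 1)⁻¹ := by simp [hK]
  have hcm : tau (b : ℂ) * tau 2 = tau 2 * tau b := by
    ext z; simp only [mul_app, tau_app]; ring
  have hh := (h.mul hs (pres_of_perm e he)).mul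
    ((ind_tau b).inv (θ' := (sh (-b)).toMonoidHom) (pres_tau b) fun g => by
      change sh (-b) (sh b g) = g
      rw [sh_sh]; simp) (pres_tau b).inv
  have hE : H 1 * (K 1)⁻¹ = H 1 * S 1 * (tau (b : ℂ))⁻¹ := by
    rw [K1, mul_inv_rev, inv_inv, mul_assoc]
  have hθ : ∀ g, ((θ.comp s).comp (sh (-b)).toMonoidHom) g = lam * g * lam⁻¹ := fun g => by
    refine hom_ext_of (g := (MulAut.conj lam).toMonoidHom) (fun i => ?_) g
    simp [hb]
  rw [← hE] at hh
  have hT := hh.of_conj (θ' := MonoidHom.id F) lam hθ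
  have hK1 : ∀ i : ℤ, K 1 i = ((e.symm.trans (Equiv.addRight b)) i : ℤ) := fun i => by
    have : (S 1)⁻¹ (i : ℂ) = (e.symm i : ℤ) := by rw [inv_app_eq, he, e.apply_symm_apply]
    rw [K1, mul_app, this, tau_app]
    simp
  refine ⟨K, hKJ, K0, ?_, ?_, _, hT⟩
  · have e2 : (S 1)⁻¹ * tau 2 = tau 2 * (S 1)⁻¹ := by
      rw [inv_mul_eq_iff_eq_mul, ← mul_assoc, ST, mul_inv_cancel_right]
    rw [K1, mul_assoc, e2, ← mul_assoc, hcm, mul_assoc]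
  · set k := e.symm.trans (Equiv.addRight b) with hk
    have hp : ∀ i : ℤ, (H 1 * (K 1)⁻¹) i = ((k.symm.trans π) i : ℤ) := fun i => by
      have : (K 1)⁻¹ (i : ℂ) = (k.symm i : ℤ) := by rw [inv_app_eq, hK1, k.apply_symm_apply]
      rw [mul_app, this, hπ]; rfl
    intro i
    have hm : ∀ m : ℤ, (H 1 * (K 1)⁻¹) m = m := fun m => by
      obtain ⟨v, hv⟩ := Ind.exists_conj (H := fun t => H t * (K t)⁻¹) (hH.mul hKJ.inv)
        (by simp only [h0, K0, inv_one, mul_one]) hT (pres_of_perm (k.symm.trans π) hp) m _ (hp m)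
      have hv := congrArg
        (FreeGroup.lift fun j => Multiplicative.ofAdd (if j = m then (1 : ℤ) else 0)) hv
      simp at hv
      rw [hp, Equiv.trans_apply, hv]
    have := hm (k i)
    rwa [mul_app, ← hK1, inv_app_self] at this

end PlaneTC

namespace PlaneTC
open Topology unitInterval

/-- Two paths with the same exponentials and the same starting point agree. -/
lemma eq_of_exp_eq {f g : I → ℂ} (hf : Continuous f) (hg : Continuous g)
    (h : ∀ t, Complex.exp (f t) = Complex.exp (g t)) (h0 : f 0 = g 0) (t : I) : f t = g t :=
  congrFun (Complex.isCoveringMap_exp.eq_of_comp_eq hf hg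
    (funext fun t => Subtype.ext (h t)) 0 h0) t

lemma exists_exp_lift {H : I → ℂ ≃ₜ ℂ} (hH : JC H) (h0 : H 0 = 1) (hz : ∀ t, H t 0 = 0) :
    ∃ f : I → ℂ → ℂ, (Continuous fun p : I × ℂ => f p.1 p.2) ∧ (∀ w, f 0 w = w) ∧
      ∀ t w, Complex.exp (f t w) = H t (Complex.exp w) := by
  have hne : ∀ t w, H t (Complex.exp w) ≠ 0 := fun t w e =>
    Complex.exp_ne_zero w ((H t).injective (e.trans (hz t).symm))
  let Hc : C(I × ℂ, {z : ℂ // z ≠ 0}) :=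
    ⟨fun p => ⟨H p.1 (Complex.exp p.2), hne _ _⟩,
      (hH.app continuous_fst (Complex.continuous_exp.comp continuous_snd)).subtype_mk _⟩
  have hs : ∀ w : ℂ, Hc (0, w) = ⟨Complex.exp (ContinuousMap.id ℂ w), Complex.exp_ne_zero _⟩ :=
    fun w => Subtype.ext (by simp [Hc, h0])
  let L := Complex.isCoveringMap_exp.liftHomotopy Hc (ContinuousMap.id ℂ) hs
  refine ⟨fun t w => L (t, w), L.continuous, fun w => ?_, fun t w => ?_⟩
  · exact Complex.isCoveringMap_exp.liftHomotopy_zero Hc (ContinuousMap.id ℂ) hs w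
  · exact congrArg Subtype.val
      (congrFun (Complex.isCoveringMap_exp.liftHomotopy_lifts Hc (ContinuousMap.id ℂ) hs) (t, w))

/-- Lifting an isotopy of the plane fixing the origin through `w ↦ exp (c * w)`. -/
lemma exists_lift_family {H : I → ℂ ≃ₜ ℂ} (hH : JC H) (h0 : H 0 = 1) (hz : ∀ t, H t 0 = 0)
    {c : ℝ} (hc : c ≠ 0) :
    ∃ L : I → ℂ ≃ₜ ℂ, JC L ∧ L 0 = 1 ∧ (∀ t w, Complex.exp (c * L t w) = H t (Complex.exp (c * w))) ∧
      (∀ t w, L t (w + (2 * Real.pi / c : ℝ) * Complex.I) =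
        L t w + (2 * Real.pi / c : ℝ) * Complex.I) ∧
      ((∀ t, H t 1 = 1) → ∀ t, L t 0 = 0) := by
  have hc' : (c : ℂ) ≠ 0 := by exact_mod_cast hc
  obtain ⟨f, hf, f0, fe⟩ := exists_exp_lift hH h0 hz
  obtain ⟨g, hg, g0, ge⟩ := exists_exp_lift hH.inv (by simp only [h0, inv_one])
    fun t => inv_fix (hz t)
  have path : ∀ {k : I → ℂ → ℂ}, (Continuous fun p : I × ℂ => k p.1 p.2) → ∀ {a : I → ℂ},
      Continuous a → Continuous fun t => k t (a t) := fun hk a ha =>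
    hk.comp (continuous_id.prodMk ha)
  have gf : ∀ t w, g t (f t w) = w := fun t w =>
    eq_of_exp_eq (path hg (path hf continuous_const)) continuous_const
      (fun t => by rw [ge, fe, inv_app_self]) (by rw [f0, g0]) t
  have fg : ∀ t w, f t (g t w) = w := fun t w =>
    eq_of_exp_eq (path hf (path hg continuous_const)) continuous_const
      (fun t => by rw [fe, ge, app_inv_self]) (by rw [f0, g0]) t
  obtain ⟨L, hL, hLf⟩ := exists_family (f := fun t w => f t (c * w) / c)
    (g := fun t w => g t (c * w) / c)
    ((hf.comp (continuous_fst.prodMk (continuous_const.mul continuous_snd))).div_const _)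
    (fun t => (hg.comp (continuous_const.prodMk
      (continuous_const.mul continuous_id))).div_const _)
    (fun t w => by rw [mul_div_cancel₀ _ hc', gf, mul_div_cancel_left₀ _ hc'])
    (fun t w => by rw [mul_div_cancel₀ _ hc', fg, mul_div_cancel_left₀ _ hc'])
  refine ⟨L, hL, ?_, fun t w => ?_, fun t w => ?_, fun h1 t => ?_⟩
  · ext w
    rw [hLf, f0, mul_div_cancel_left₀ _ hc', one_app]
  · rw [hLf, mul_div_cancel₀ _ hc', fe]
  · have e : (c : ℂ) * ((2 * Real.pi / c : ℝ) * Complex.I) = 2 * Real.pi * Complex.I := by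
      push_cast; field_simp
    rw [hLf, hLf, mul_add, e]
    have := eq_of_exp_eq (f := fun t => f t (c * w + 2 * Real.pi * Complex.I))
      (g := fun t => f t (c * w) + 2 * Real.pi * Complex.I) (path hf continuous_const)
      ((path hf continuous_const).add continuous_const)
      (fun t => by rw [Complex.exp_periodic, fe, fe, Complex.exp_periodic]) (by rw [f0, f0]) t
    rw [this, add_div, ← e, mul_div_cancel_left₀ _ hc']
  · have := eq_of_exp_eq (f := fun t => f t 0) (g := fun _ => 0) (path hf continuous_const)
      continuous_const (fun t => by rw [fe, Complex.exp_zero, h1]) (f0 0) t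
    rw [hLf, mul_zero, this, zero_div]

end PlaneTC

namespace PlaneTC
open Topology unitInterval

/-- The odd function vanishing on `[-m, m]` with slope one elsewhere. -/
def clip (m y : ℝ) : ℝ := max 0 (y - m) - max 0 (-y - m)

lemma continuous_clip (m : ℝ) : Continuous (clip m) := by unfold clip; fun_prop

lemma monotone_clip (m : ℝ) : Monotone (clip m) := fun x y h =>
  sub_le_sub (max_le_max le_rfl (by linarith)) (max_le_max le_rfl (by linarith))

lemma clip_neg (m y : ℝ) : clip m (-y) = -clip m y := by simp [clip]

lemma clip_of_abs_le {m y : ℝ} (h : |y| ≤ m) : clip m y = 0 := by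
  rw [abs_le] at h
  rw [clip, max_eq_left (by linarith), max_eq_left (by linarith), sub_zero]

lemma clip_of_le {m y : ℝ} (h0 : 0 ≤ m) (h : m ≤ y) : clip m y = y - m := by
  rw [clip, max_eq_right (by linarith), max_eq_left (by linarith), sub_zero]

/-- Partial sums of a rapidly growing piecewise linear function. -/
def fast (b : ℕ → ℝ) (n : ℕ) (y : ℝ) : ℝ := y + ∑ k ∈ Finset.range n, b k * clip (k + 1) y

variable {b : ℕ → ℝ}

lemma fast_eq {n m : ℕ} {y : ℝ} (hy : |y| ≤ n) (h : n ≤ m) : fast b m y = fast b n y := by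
  rw [fast, fast, Finset.sum_subset (Finset.range_mono h) fun k _ hk => ?_]
  rw [Finset.mem_range, not_lt] at hk
  rw [clip_of_abs_le, mul_zero]
  have : (n : ℝ) ≤ k := by exact_mod_cast hk
  linarith

lemma strictMono_fast (hb : ∀ k, 0 ≤ b k) (n : ℕ) : StrictMono (fast b n) :=
  strictMono_id.add_monotone fun _ _ h =>
    Finset.sum_le_sum fun k _ => mul_le_mul_of_nonneg_left (monotone_clip _ h) (hb k)

lemma continuous_fast (n : ℕ) : Continuous (fast b n) :=
  continuous_id.add (continuous_finsetSum _ fun _ _ => continuous_const.mul (continuous_clip _))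

lemma fast_neg (n : ℕ) (y : ℝ) : fast b n (-y) = -fast b n y := by
  simp [fast, clip_neg, Finset.sum_neg_distrib, add_comm]

/-- The coefficients making `fast` grow faster than `N`. -/
noncomputable def coef (N : ℝ → ℝ) : ℕ → ℝ
  | 0 => N 1
  | k + 1 => N (k + 2 + (k + 1) * (k + 1) * coef N k)

lemma exists_slow {N : ℝ → ℝ} (hN : Monotone N) (hx : ∀ x, 0 ≤ x → x ≤ N x) :
    ∃ f : ℝ ≃ₜ ℝ, StrictMono f ∧ (∀ x, f (-x) = -f x) ∧ (∀ x, |x| ≤ 1 → f x = x) ∧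
      ∀ x, 0 ≤ x → f (N x) ≤ f x + 2 := by
  set b := coef N with hb
  have b0 : ∀ k, 0 ≤ b k := fun k => by
    induction k with
    | zero => exact zero_le_one.trans (hx 1 zero_le_one)
    | succ k ih => exact le_trans (by positivity) (hx _ (by positivity))
  have bm : Monotone b := monotone_nat_of_le_succ fun k => by
    have h0 := b0 k
    have hk : (0 : ℝ) ≤ k := k.cast_nonneg
    refine le_trans ?_ (hx (k + 2 + (k + 1) * (k + 1) * b k) (by positivity))
    nlinarith [mul_nonneg hk h0, mul_nonneg (mul_nonneg hk hk) h0]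
  set e : ℝ → ℝ := fun y => fast b ⌈|y|⌉₊ y with he
  have ee : ∀ {y : ℝ} {n : ℕ}, |y| ≤ n → e y = fast b n y := fun {y n} h =>
    (fast_eq (Nat.le_ceil _) (Nat.ceil_le.2 h)).symm
  have emono : StrictMono e := fun x y h => by
    have h1 : |x| ≤ (max ⌈|x|⌉₊ ⌈|y|⌉₊ : ℕ) := (Nat.le_ceil _).trans (by simp)
    have h2 : |y| ≤ (max ⌈|x|⌉₊ ⌈|y|⌉₊ : ℕ) := (Nat.le_ceil _).trans (by simp)
    rw [ee h1, ee h2]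
    exact strictMono_fast b0 _ h
  have econt : Continuous e := continuous_iff_continuousAt.2 fun y => by
    refine (continuous_fast (b := b) ⌈|y| + 1⌉₊).continuousAt.congr ?_
    filter_upwards [Metric.ball_mem_nhds y one_pos] with z hz
    refine (ee (le_trans ?_ (Nat.le_ceil _))).symm
    have := abs_sub_abs_le_abs_sub z y
    rw [Metric.mem_ball, Real.dist_eq] at hz
    linarith
  have eneg : ∀ y, e (-y) = -e y := fun y => by
    simp only [he, abs_neg, fast_neg]
  have ele : ∀ y, 0 ≤ y → y ≤ e y := fun y hy => by
    refine le_add_of_nonneg_right (Finset.sum_nonneg fun k _ => mul_nonneg (b0 k) ?_)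
    have := monotone_clip (k + 1) hy
    rwa [clip_of_abs_le (by rw [abs_zero]; positivity)] at this
  have etop : Filter.Tendsto e Filter.atTop Filter.atTop :=
    Filter.tendsto_atTop_mono' _ ((Filter.eventually_ge_atTop 0).mono ele) Filter.tendsto_id
  have ebot : Filter.Tendsto e Filter.atBot Filter.atBot := by
    have := Filter.tendsto_neg_atTop_atBot.comp (etop.comp Filter.tendsto_neg_atBot_atTop)
    refine this.congr fun y => ?_
    simp [eneg]
  have estep : ∀ k : ℕ, N (e (k + 1)) ≤ e (k + 2) := fun k => by
    have h2 : e (k + 2) = fast b (k + 2) (k + 2) := by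
      have := ee (y := (k + 2 : ℝ)) (n := k + 2) (by rw [abs_of_nonneg (by positivity)]; simp)
      exact this
    have h3 : b k ≤ e (k + 2) := by
      rw [h2, fast]
      have := Finset.single_le_sum (f := fun j : ℕ => b j * clip (j + 1) (k + 2))
        (s := Finset.range (k + 2)) (fun j _ => mul_nonneg (b0 j) (by
          have := monotone_clip (j + 1) (show (0 : ℝ) ≤ k + 2 by positivity)
          rwa [clip_of_abs_le (by rw [abs_zero]; positivity)] at this))
        (Finset.mem_range.2 (show k < k + 2 by omega))
      rw [clip_of_le (by positivity) (by linarith)] at this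
      have hk : (0 : ℝ) ≤ k := k.cast_nonneg
      nlinarith
    refine le_trans ?_ h3
    cases k with
    | zero =>
      have : e ((0 : ℕ) + 1) = 1 := by
        have := ee (y := ((0 : ℕ) + 1 : ℝ)) (n := 1) (by simp)
        rw [this]
        simp [fast, clip]
      rw [this]
      rfl
    | succ k =>
      refine hN ?_
      have h4 : e ((k + 1 : ℕ) + 1) = fast b (k + 2) (k + 2) := by
        have := ee (y := ((k + 1 : ℕ) + 1 : ℝ)) (n := k + 2) (by
          rw [abs_of_nonneg (by positivity)]; push_cast; linarith)
        rw [this]; push_cast; congr 1; ring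
      rw [h4, fast, Finset.sum_range_succ, clip_of_abs_le (m := (k + 1 : ℕ) + 1) (by
        rw [abs_of_nonneg (by positivity)]; push_cast; linarith), mul_zero, add_zero]
      refine add_le_add le_rfl ?_
      have := Finset.sum_le_card_nsmul (Finset.range (k + 1))
        (fun j : ℕ => b j * clip (j + 1) (k + 2)) ((k + 1) * b k) fun j hj => by
          rw [Finset.mem_range] at hj
          have hj' : (j : ℝ) + 1 ≤ k + 1 := by exact_mod_cast hj
          rw [clip_of_le (by positivity) (by linarith), mul_comm]
          have hj0 : (0 : ℝ) ≤ j := j.cast_nonneg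
          exact mul_le_mul (by linarith) (bm (by omega)) (b0 j) (by positivity)
      refine this.trans (le_of_eq ?_)
      simp [hb, mul_assoc]
  let f : ℝ ≃ₜ ℝ :=
    (emono.orderIsoOfSurjective e (econt.surjective etop ebot)).symm.toHomeomorph
  have fe : ∀ y, f (e y) = y := fun y =>
    (emono.orderIsoOfSurjective e (econt.surjective etop ebot)).symm_apply_apply y
  have ef : ∀ x, e (f x) = x := fun x =>
    (emono.orderIsoOfSurjective e (econt.surjective etop ebot)).apply_symm_apply x
  have fmono : StrictMono f := fun x y h => emono.lt_iff_lt.1 (by rwa [ef, ef])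
  refine ⟨f, fmono, fun x => emono.injective (by rw [ef, eneg, ef]), fun x h => ?_, fun x h => ?_⟩
  · refine emono.injective ?_
    rw [ef, ee (n := 1) (by simpa using h)]
    simp [fast, clip_of_abs_le h]
  · have hy : 0 ≤ f x := by
      have := fmono.monotone h
      rwa [show f 0 = 0 from emono.injective (by rw [ef]; simp [he, fast])] at this
    rw [← emono.le_iff_le, ef]
    set k := ⌊f x⌋₊ with hk
    have h1 : x ≤ e (k + 1) := by
      conv_lhs => rw [← ef x]
      exact emono.monotone (Nat.lt_floor_add_one _).le
    exact (hN h1).trans ((estep k).trans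
      (emono.monotone (by have := Nat.floor_le hy; linarith)))

end PlaneTC

namespace PlaneTC
open Topology unitInterval

/-- The homeomorphism `a ↦ a * max 1 |a|` of the line. -/
noncomputable def quad : ℝ ≃ₜ ℝ where
  toFun a := a * max 1 |a|
  invFun b := b / max 1 √|b|
  left_inv a := by
    have hm : (0 : ℝ) < max 1 |a| := by positivity
    simp only [abs_mul, abs_of_pos hm]
    rcases le_total |a| 1 with h | h
    · rw [max_eq_left h, mul_one, mul_one, max_eq_left (Real.sqrt_le_one.2 h), div_one]
    · rw [max_eq_right h, Real.sqrt_mul_self (abs_nonneg a), max_eq_right h,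
        mul_div_cancel_right₀ _ (by positivity)]
  right_inv b := by
    have hm : (0 : ℝ) < max 1 √|b| := by positivity
    simp only [abs_div, abs_of_pos hm]
    rcases le_total |b| 1 with h | h
    · simp [max_eq_left (Real.sqrt_le_one.2 h), max_eq_left h]
    · have h1 : 1 ≤ √|b| := Real.one_le_sqrt.2 h
      rw [max_eq_right h1, Real.div_sqrt, max_eq_right h1, div_mul_cancel₀ _ (by positivity)]
  continuous_toFun := by fun_prop
  continuous_invFun := by
    refine continuous_id.div (by fun_prop) fun b => ?_
    positivity

lemma quad_apply (a : ℝ) : quad a = a * max 1 |a| := rfl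

lemma quad_of_abs_le {a : ℝ} (h : |a| ≤ 1) : quad a = a := by
  rw [quad_apply, max_eq_left h, mul_one]

/-- The radial homeomorphism of the plane onto the disc of radius two, fixing the unit disc. -/
noncomputable def squash : OpenPartialHomeomorph ℂ ℂ where
  toFun v := v / ((1 + max 0 (‖v‖ - 1) / 2 : ℝ) : ℂ)
  invFun v := v / ((1 - max 0 (‖v‖ - 1) : ℝ) : ℂ)
  source := univ
  target := Metric.ball 0 2
  map_source' v _ := by
    rw [mem_ball_zero_iff, norm_div, Complex.norm_of_nonneg (by positivity),
      div_lt_iff₀ (by positivity)]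
    linarith [le_max_right 0 (‖v‖ - 1)]
  map_target' _ _ := mem_univ _
  left_inv' v _ := by
    rcases le_total (‖v‖ - 1) 0 with h | h
    · simp [max_eq_left h]
    · have h2 : (0 : ℝ) < 1 + (‖v‖ - 1) / 2 := by linarith
      have h1 : ‖v / ((1 + (‖v‖ - 1) / 2 : ℝ) : ℂ)‖ = ‖v‖ / (1 + (‖v‖ - 1) / 2) := by
        rw [norm_div, Complex.norm_of_nonneg h2.le]
      have h3 : 0 ≤ ‖v‖ / (1 + (‖v‖ - 1) / 2) - 1 := by
        rw [sub_nonneg, le_div_iff₀ h2]; linarith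
      rw [max_eq_right h, h1, max_eq_right h3, div_div, ← Complex.ofReal_mul]
      have : (1 + (‖v‖ - 1) / 2) * (1 - (‖v‖ / (1 + (‖v‖ - 1) / 2) - 1)) = 1 := by
        field_simp; ring
      rw [this, Complex.ofReal_one, div_one]
  right_inv' v hv := by
    rw [mem_ball_zero_iff] at hv
    rcases le_total (‖v‖ - 1) 0 with h | h
    · simp [max_eq_left h]
    · have h2 : (0 : ℝ) < 1 - (‖v‖ - 1) := by linarith
      have h1 : ‖v / ((1 - (‖v‖ - 1) : ℝ) : ℂ)‖ = ‖v‖ / (1 - (‖v‖ - 1)) := by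
        rw [norm_div, Complex.norm_of_nonneg h2.le]
      have h3 : 0 ≤ ‖v‖ / (1 - (‖v‖ - 1)) - 1 := by
        rw [sub_nonneg, le_div_iff₀ h2]; linarith
      rw [max_eq_right h, h1, max_eq_right h3, div_div, ← Complex.ofReal_mul]
      have : (1 - (‖v‖ - 1)) * (1 + (‖v‖ / (1 - (‖v‖ - 1)) - 1) / 2) = 1 := by
        have := h2.ne'
        field_simp; ring
      rw [this, Complex.ofReal_one, div_one]
  open_source := isOpen_univ
  open_target := Metric.isOpen_ball
  continuousOn_toFun := by
    refine Continuous.continuousOn (continuous_id.div (by fun_prop) fun v => ?_)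
    exact_mod_cast (show (1 + max 0 (‖v‖ - 1) / 2 : ℝ) ≠ 0 by positivity)
  continuousOn_invFun := by
    refine continuousOn_id.div (Continuous.continuousOn (by fun_prop)) fun v hv => ?_
    rw [mem_ball_zero_iff] at hv
    have : max 0 (‖v‖ - 1) < 1 := max_lt one_pos (by linarith)
    exact_mod_cast (show (1 - max 0 (‖v‖ - 1) : ℝ) ≠ 0 by linarith)

lemma squash_apply (v : ℂ) : squash v = v / ((1 + max 0 (‖v‖ - 1) / 2 : ℝ) : ℂ) := rfl

lemma squash_of_norm_le {v : ℂ} (h : ‖v‖ ≤ 1) : squash v = v := by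
  rw [squash_apply, max_eq_left (by linarith)]
  simp

lemma norm_squash_lt (v : ℂ) : ‖squash v‖ < 2 :=
  mem_ball_zero_iff.1 (squash.map_source (mem_univ v))

lemma norm_squash_sub (v v' : ℂ) : ‖squash v' - squash v‖ ≤ 4 * ‖v' - v‖ / (1 + ‖v‖) := by
  set m := 1 + max 0 (‖v‖ - 1) / 2 with hm
  set m' := 1 + max 0 (‖v'‖ - 1) / 2 with hm'
  have m0 : 0 < m := by positivity
  have m0' : 0 < m' := by positivity
  have h1 : squash v' - squash v = (v' - v) / (m : ℂ) + squash v' * (((m - m') / m : ℝ) : ℂ) := by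
    rw [squash_apply, squash_apply, ← hm, ← hm']
    have h : (m : ℂ) ≠ 0 := by exact_mod_cast m0.ne'
    have h' : (m' : ℂ) ≠ 0 := by exact_mod_cast m0'.ne'
    push_cast
    field_simp
    ring
  have h2 : |m - m'| ≤ ‖v' - v‖ / 2 := by
    have := abs_max_sub_max_le_abs (‖v‖ - 1) (‖v'‖ - 1) 0
    rw [max_comm, max_comm _ (0 : ℝ)] at this
    have h3 := abs_norm_sub_norm_le v v'
    rw [norm_sub_rev] at h3
    rw [hm, hm', show 1 + max 0 (‖v‖ - 1) / 2 - (1 + max 0 (‖v'‖ - 1) / 2)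
      = (max 0 (‖v‖ - 1) - max 0 (‖v'‖ - 1)) / 2 by ring, abs_div, abs_two]
    have h4 : ‖v‖ - 1 - (‖v'‖ - 1) = ‖v‖ - ‖v'‖ := by ring
    rw [h4] at this
    linarith
  have h5 : ‖squash v' - squash v‖ ≤ 2 * ‖v' - v‖ / m := by
    rw [h1]
    refine (norm_add_le _ _).trans ?_
    rw [norm_div, norm_mul, Complex.norm_of_nonneg m0.le, Complex.norm_real, Real.norm_eq_abs,
      abs_div, abs_of_pos m0]
    have := mul_le_mul (norm_squash_lt v').le (div_le_div_of_nonneg_right h2 m0.le)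
      (by positivity) (by norm_num)
    refine (add_le_add le_rfl this).trans (le_of_eq ?_)
    field_simp
    ring
  refine h5.trans ?_
  rw [div_le_div_iff₀ m0 (by positivity)]
  have : 1 + ‖v‖ ≤ 2 * m := by
    rw [hm]; linarith [le_max_right 0 (‖v‖ - 1)]
  nlinarith [norm_nonneg (v' - v)]

lemma exists_width {L : I → ℂ ≃ₜ ℂ} (hL : JC L) {P : ℝ} (hP : 0 < P)
    (hper : ∀ t w, L t (w + P * Complex.I) = L t w + P * Complex.I) :
    ∃ N : ℝ → ℝ, Monotone N ∧ (∀ x, 0 ≤ x → 2 * x ≤ N x) ∧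
      ∀ t w, ‖L t w - w‖ + |w.re| ≤ N |w.re| := by
  choose M hM using exists_family_bound hL
  have perZ : ∀ (n : ℤ) t w, L t (w + n * P * Complex.I) = L t w + n * P * Complex.I := by
    intro n t w
    induction n using Int.induction_on with
    | zero => simp
    | succ n ih =>
      push_cast at ih ⊢
      rw [show w + (n + 1 : ℂ) * P * Complex.I = w + n * P * Complex.I + P * Complex.I by ring,
        hper, ih]
      ring
    | pred n ih =>
      push_cast at ih ⊢
      have := hper t (w + (-n - 1 : ℂ) * P * Complex.I)
      rw [show w + (-n - 1 : ℂ) * P * Complex.I + P * Complex.I = w + -n * P * Complex.I by ring,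
        ih] at this
      rw [← sub_eq_iff_eq_add.2 this]
      ring
  let B : ℕ → ℝ := fun j => |M (j + P)| + (j + P)
  have hB : ∀ j, 0 ≤ B j := fun j => by positivity
  refine ⟨fun x => ∑ j ∈ Finset.range (⌈x⌉₊ + 1), B j + 2 * max 0 x, fun x y h => ?_,
    fun x h => ?_, fun t w => ?_⟩
  · refine add_le_add (Finset.sum_le_sum_of_subset_of_nonneg (Finset.range_mono ?_)
      fun j _ _ => hB j) (by gcongr)
    gcongr
  · simp only [max_eq_right h]
    exact le_add_of_nonneg_left (Finset.sum_nonneg fun j _ => hB j)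
  · set j := ⌈|w.re|⌉₊ with hj
    have h1 : B j ≤ ∑ j ∈ Finset.range (j + 1), B j :=
      Finset.single_le_sum (fun j _ => hB j) (Finset.self_mem_range_succ j)
    set n := ⌊w.im / P⌋ with hn
    set u := w + (-n : ℤ) * P * Complex.I with hu
    have h2 : L t u - u = L t w - w := by rw [hu, perZ]; ring
    have h3 : ‖u‖ ≤ j + P := by
      refine (Complex.norm_le_abs_re_add_abs_im u).trans (add_le_add ?_ ?_)
      · rw [hu]; simpa using Nat.le_ceil |w.re|
      · have h4 : u.im = w.im - n * P := by rw [hu]; simp [sub_eq_add_neg]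
        have h5 := Int.floor_le (w.im / P)
        have h6 := Int.lt_floor_add_one (w.im / P)
        rw [le_div_iff₀ hP] at h5
        rw [div_lt_iff₀ hP] at h6
        rw [h4, abs_le]
        constructor <;> rw [hn] <;> linarith
    rw [← h2]
    have h7 := norm_sub_le (L t u) u
    have h8 := (hM (j + P) t u h3).trans (le_abs_self _)
    simp only [max_eq_right (abs_nonneg w.re)]
    have h9 : B j = |M (j + P)| + (j + P) := rfl
    linarith [abs_nonneg w.re]

end PlaneTC

namespace PlaneTC
open Topology unitInterval

lemma quad_neg (a : ℝ) : quad (-a) = -quad a := by simp [quad_apply]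

lemma abs_sub_of_odd {g : ℝ → ℝ} (hg : ∀ x, g (-x) = -g x) {x y : ℝ} (h : 0 < x * y) :
    |g y - g x| = |(g |y|) - (g |x|)| := by
  rcases pos_and_pos_or_neg_and_neg_of_mul_pos h with ⟨h1, h2⟩ | ⟨h1, h2⟩
  · rw [abs_of_pos h1, abs_of_pos h2]
  · rw [abs_of_neg h1, abs_of_neg h2, hg, hg, ← abs_neg]
    congr 1; ring

lemma abs_odd {g : ℝ → ℝ} (hg : ∀ x, g (-x) = -g x) (h0 : ∀ x, 0 ≤ x → 0 ≤ g x) (x : ℝ) :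
    |g x| = g |x| := by
  rcases le_total 0 x with h | h
  · rw [abs_of_nonneg h, abs_of_nonneg (h0 x h)]
  · rw [abs_of_nonpos h, hg, abs_of_nonpos]
    have := h0 (-x) (by linarith)
    rw [hg] at this
    linarith

lemma abs_quad_sub {a a' : ℝ} (h0 : 0 ≤ a) (h0' : 0 ≤ a') (h : |a' - a| ≤ 2) :
    |quad a' - quad a| ≤ 4 * a + 6 := by
  rw [quad_apply, quad_apply, abs_of_nonneg h0, abs_of_nonneg h0']
  rw [abs_le] at h ⊢
  rcases le_total 1 a with h1 | h1 <;> rcases le_total 1 a' with h2 | h2 <;>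
    simp only [max_eq_left, max_eq_right, h1, h2] <;> constructor <;> nlinarith

lemma abs_of_mul_pos_of_lt {x y : ℝ} (h : |y - x| < |x|) : 0 < x * y := by
  rw [← sq_lt_sq] at h
  nlinarith [sq_nonneg y]

lemma slow_bound {N : ℝ → ℝ} (h2 : ∀ x, 0 ≤ x → 2 * x ≤ N x) {f : ℝ ≃ₜ ℝ}
    (fm : StrictMono f) (fo : ∀ x, f (-x) = -f x) (fN : ∀ x, 0 ≤ x → f (N x) ≤ f x + 2)
    {l l' y y' : ℝ} (hr : |l' - l| + |l| ≤ N |l|) (hr' : |l' - l| + |l'| ≤ N |l'|)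
    (hi : |y' - y| + |l| ≤ N |l|) (hi' : |y' - y| + |l'| ≤ N |l'|)
    (hs : |l| ≤ N 0 ∨ 0 < l * l') :
    |quad (f l') - quad (f l)| + |f y' - f y| ≤ 6 * f |l| + 30 := by
  have f0 : f 0 = 0 := by
    have := fo 0
    rw [neg_zero] at this
    linarith
  have fp : ∀ x, 0 ≤ x → 0 ≤ f x := fun x hx => f0 ▸ fm.monotone hx
  have step : ∀ x z : ℝ, |z| ≤ N |x| → f |z| ≤ f |x| + 2 := fun x z h =>
    (fm.monotone h).trans (fN _ (abs_nonneg x))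
  have step2 : ∀ x z : ℝ, |z| ≤ 2 * |x| → f |z| ≤ f |x| + 2 := fun x z h =>
    step x z (h.trans (h2 _ (abs_nonneg x)))
  have tri : ∀ x z : ℝ, |z| ≤ |z - x| + |x| := fun x z => by
    simpa using abs_add_le (z - x) x
  have tri' : ∀ x z : ℝ, |x| ≤ |z - x| + |z| := fun x z => by
    have := tri z x
    rwa [abs_sub_comm] at this
  have a0 := fp _ (abs_nonneg l)
  have a0' := fp _ (abs_nonneg l')
  have s1 : f |l'| ≤ f |l| + 2 := step _ _ ((tri _ _).trans hr)
  have s2 : f |l| ≤ f |l'| + 2 := step _ _ ((tri' _ _).trans hr')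
  have hq : ∀ x, 0 ≤ x → 0 ≤ quad x := fun x hx => mul_nonneg hx (by positivity)
  have hS : |quad (f l') - quad (f l)| ≤ 4 * f |l| + 20 := by
    rcases hs with hs | hs
    · have h3 : f |l| ≤ 2 := by
        have := (fm.monotone hs).trans (fN 0 le_rfl)
        rwa [f0, zero_add] at this
      refine (abs_sub _ _).trans ?_
      rw [abs_odd quad_neg hq, abs_odd quad_neg hq, abs_odd fo fp, abs_odd fo fp, quad_apply,
        quad_apply, abs_of_nonneg a0, abs_of_nonneg a0']
      have h4 : max 1 (f |l|) ≤ 2 := max_le (by norm_num) h3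
      have h5 : max 1 (f |l'|) ≤ 4 := max_le (by norm_num) (by linarith)
      have h6 := mul_le_mul h3 h4 (by positivity) zero_le_two
      have h7 := mul_le_mul (show f |l'| ≤ 4 by linarith) h5 (by positivity) (by norm_num)
      linarith
    · rw [abs_sub_of_odd (g := fun x => quad (f x)) (fun x => by rw [fo, quad_neg]) hs]
      have := abs_quad_sub a0 a0' (abs_le.2 ⟨by linarith, by linarith⟩)
      linarith
  have hU : |f y' - f y| ≤ 2 * f |l| + 10 := by
    by_cases c1 : |y| ≤ N |l|
    · have h3 := step l y c1
      have h4 : f |y'| ≤ f (N |l|) + 2 := by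
        have hn : 0 ≤ N |l| := (abs_nonneg y).trans c1
        have := step2 (N |l|) y' (by
          rw [abs_of_nonneg hn]; linarith [tri y y', abs_nonneg l])
        rwa [abs_of_nonneg hn] at this
      have h5 := fN _ (abs_nonneg l)
      refine (abs_sub _ _).trans ?_
      rw [abs_odd fo fp, abs_odd fo fp]
      linarith
    by_cases c2 : |y'| ≤ N |l'|
    · have h3 := step l' y' c2
      have h4 : f |y| ≤ f (N |l'|) + 2 := by
        have hn : 0 ≤ N |l'| := (abs_nonneg y').trans c2
        have := step2 (N |l'|) y (by
          rw [abs_of_nonneg hn]; linarith [tri' y y', abs_nonneg l'])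
        rwa [abs_of_nonneg hn] at this
      have h5 := fN _ (abs_nonneg l')
      refine (abs_sub _ _).trans ?_
      rw [abs_odd fo fp, abs_odd fo fp]
      linarith
    push Not at c1 c2
    have := abs_nonneg l
    have := abs_nonneg l'
    rw [abs_sub_of_odd fo (abs_of_mul_pos_of_lt (x := y) (y := y') (by linarith))]
    have h3 := step2 y y' (by linarith [tri y y'])
    have h4 := step2 y' y (by linarith [tri' y y'])
    rw [abs_le]
    constructor <;> linarith
  linarith

end PlaneTC

namespace PlaneTC
open Topology unitInterval

/-- The homeomorphism of the plane slowing down both coordinates by `f`. -/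
noncomputable def slowMap (f : ℝ ≃ₜ ℝ) : ℂ ≃ₜ ℂ :=
  (Complex.equivRealProdCLM.toHomeomorph.trans ((f.trans quad).prodCongr f)).trans
    Complex.equivRealProdCLM.symm.toHomeomorph

lemma slowMap_re (f : ℝ ≃ₜ ℝ) (w : ℂ) : (slowMap f w).re = quad (f w.re) := by
  simp [slowMap]

lemma slowMap_im (f : ℝ ≃ₜ ℝ) (w : ℂ) : (slowMap f w).im = f w.im := by
  simp [slowMap]

/-- A chart around `1` from the logarithmic coordinate, shrinking displacements near infinity. -/
noncomputable def germChart (f : ℝ ≃ₜ ℝ) : OpenPartialHomeomorph ℂ ℂ :=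
  (((slowMap f).toOpenPartialHomeomorph.trans squash).trans
    (Homeomorph.mulLeft₀ (1 / 16 : ℂ) (by norm_num)).toOpenPartialHomeomorph).trans
    Complex.expOpenPartialHomeomorph

lemma germChart_apply (f : ℝ ≃ₜ ℝ) (w : ℂ) :
    germChart f w = Complex.exp (1 / 16 * squash (slowMap f w)) := rfl

lemma norm_chart_arg (v : ℂ) : ‖(1 / 16 : ℂ) * squash v‖ < 1 / 8 := by
  have := norm_squash_lt v
  rw [norm_mul, show ‖(1 / 16 : ℂ)‖ = 1 / 16 by norm_num]
  linarith

lemma germChart_source (f : ℝ ≃ₜ ℝ) : (germChart f).source = univ := by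
  refine eq_univ_of_forall fun w => ?_
  have h1 : (1 / 16 * squash (slowMap f w)).im ∈ Ioo (-Real.pi) Real.pi := by
    have h2 := (Complex.abs_im_le_norm _).trans_lt (norm_chart_arg (slowMap f w))
    have h3 := Real.pi_gt_three
    rw [abs_lt] at h2
    constructor <;> linarith
  simp only [germChart, OpenPartialHomeomorph.trans_source, mem_inter_iff, mem_preimage]
  exact ⟨⟨⟨mem_univ _, mem_univ _⟩, mem_univ _⟩, h1⟩

lemma notMem_germChart_target {f : ℝ ≃ₜ ℝ} {z : ℂ} (hz : 1 / 2 ≤ ‖z - 1‖) :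
    z ∉ (germChart f).target := fun h => by
  rw [← (germChart f).right_inv h, germChart_apply] at hz
  have h1 := norm_chart_arg (slowMap f ((germChart f).symm z))
  have h2 := Complex.norm_exp_sub_one_le (h1.le.trans (by norm_num))
  linarith

lemma dist_exp_lt {x y : ℂ} (hx : ‖x‖ < 1 / 8) (hy : ‖y‖ < 1 / 8) :
    dist (Complex.exp y) (Complex.exp x) ≤ 4 * ‖y - x‖ := by
  have h1 : ‖y - x‖ ≤ 1 := (norm_sub_le _ _).trans (by linarith)
  rw [dist_eq_norm, show Complex.exp y - Complex.exp x
    = Complex.exp x * (Complex.exp (y - x) - 1) by rw [mul_sub, ← Complex.exp_add]; simp, norm_mul]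
  have h2 : ‖Complex.exp x‖ ≤ 2 := by
    have := Complex.norm_exp_sub_one_le (hx.le.trans (by norm_num))
    have h3 := norm_le_norm_add_norm_sub' (Complex.exp x) 1
    rw [norm_one] at h3
    linarith
  have := mul_le_mul h2 (Complex.norm_exp_sub_one_le h1) (norm_nonneg _) zero_le_two
  linarith

lemma exists_chart {L : I → ℂ ≃ₜ ℂ} (hL : JC L) (h0 : L 0 = 1) {P : ℝ} (hP : 0 < P)
    (hper : ∀ t w, L t (w + P * Complex.I) = L t w + P * Complex.I) :
    ∃ f : ℝ ≃ₜ ℝ, (∀ x, |x| ≤ 1 → f x = x) ∧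
      ∀ ε > 0, ∃ Q ⊆ (germChart f).source, IsCompact Q ∧
        ∀ y, ∀ z ∈ (germChart f).source \ Q, dist (germChart f (L y z)) (germChart f z) < ε := by
  obtain ⟨N₁, m1, g1, b1⟩ := exists_width hL hP hper
  obtain ⟨N₂, m2, g2, b2⟩ := exists_width hL.inv hP fun t w => by
    rw [inv_app_eq, hper, app_inv_self]
  set N : ℝ → ℝ := fun x => max (N₁ x) (N₂ x) with hN
  have Nm : Monotone N := m1.max m2
  have N2 : ∀ x, 0 ≤ x → 2 * x ≤ N x := fun x hx => (g1 x hx).trans (le_max_left _ _)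
  have bd : ∀ t w, ‖L t w - w‖ + |w.re| ≤ N |w.re| := fun t w => (b1 t w).trans (le_max_left _ _)
  have bd' : ∀ t w, ‖L t w - w‖ + |(L t w).re| ≤ N |(L t w).re| := fun t w => by
    have := b2 t (L t w)
    rw [inv_app_self, norm_sub_rev] at this
    exact this.trans (le_max_right _ _)
  obtain ⟨f, fm, fo, f1, fN⟩ := exists_slow Nm fun x hx => by linarith [N2 x hx]
  have key : ∀ t w, ‖slowMap f (L t w) - slowMap f w‖ ≤ 6 * f |w.re| + 30 := fun t w => by
    have hr := (Complex.abs_re_le_norm (L t w - w))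
    have hi := (Complex.abs_im_le_norm (L t w - w))
    rw [Complex.sub_re] at hr
    rw [Complex.sub_im] at hi
    have e1 := bd t w
    have e2 := bd' t w
    refine (Complex.norm_le_abs_re_add_abs_im _).trans ?_
    rw [Complex.sub_re, Complex.sub_im, slowMap_re, slowMap_re, slowMap_im, slowMap_im]
    refine slow_bound N2 fm fo fN (by linarith) (by linarith) (by linarith) (by linarith) ?_
    by_contra! hc
    have hne : ∀ s, (L s w).re ≠ 0 := fun s hs => by
      have h1 := bd' s w
      have h2 := abs_sub_abs_le_abs_sub (L s w).re w.re
      have h3 := (Complex.abs_re_le_norm (L s w - w))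
      rw [Complex.sub_re] at h3
      rw [hs, abs_zero] at h1
      rw [hs, zero_sub, abs_neg] at h3
      linarith [hc.1]
    have hcont : Continuous fun s => w.re * (L s w).re :=
      continuous_const.mul (Complex.continuous_re.comp (hL.app continuous_id continuous_const))
    have hw : w.re ≠ 0 := by simpa [h0] using hne 0
    have hpos : 0 < w.re * (L 0 w).re := by rw [h0]; exact mul_self_pos.2 hw
    obtain ⟨s, hs⟩ := mem_range_of_exists_le_of_exists_ge hcont ⟨t, hc.2⟩ ⟨0, hpos.le⟩
    exact (mul_ne_zero hw (hne s)) hs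
  refine ⟨f, f1, fun ε hε => ?_⟩
  rw [germChart_source]
  set R := (240 + 576 / ε) / ε with hR
  refine ⟨slowMap f ⁻¹' Metric.closedBall 0 R, subset_univ _,
    (slowMap f).isCompact_preimage.2 (isCompact_closedBall 0 R), fun t w hw => ?_⟩
  have hw : R < ‖slowMap f w‖ := by simpa using hw.2
  set n := 1 + ‖slowMap f w‖ with hn
  have n0 : 0 < n := by positivity
  set a := f |w.re| with ha
  have an : a ^ 2 ≤ n := by
    have h1 : |quad (f w.re)| ≤ ‖slowMap f w‖ := by
      rw [← slowMap_re]; exact Complex.abs_re_le_norm _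
    have f0 : f 0 = 0 := by simpa using f1 0
    have fp : ∀ x, 0 ≤ x → 0 ≤ f x := fun x hx => f0 ▸ fm.monotone hx
    have h2 := fp _ (abs_nonneg w.re)
    rw [abs_odd (g := fun x => quad (f x)) (fun x => by rw [fo, quad_neg])
      (fun x hx => mul_nonneg (fp x hx) (by positivity)), ← ha, quad_apply, abs_of_nonneg h2] at h1
    rcases le_total 1 a with h3 | h3
    · rw [max_eq_right h3] at h1
      nlinarith
    · nlinarith [norm_nonneg (slowMap f w)]
  have h1 := norm_squash_sub (slowMap f w) (slowMap f (L t w))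
  rw [germChart_apply, germChart_apply]
  refine (dist_exp_lt (norm_chart_arg _) (norm_chart_arg _)).trans_lt ?_
  rw [← mul_sub, norm_mul, show ‖(1 / 16 : ℂ)‖ = 1 / 16 by norm_num]
  suffices h : 4 * ‖slowMap f (L t w) - slowMap f w‖ / n < ε by linarith
  rw [div_lt_iff₀ n0]
  have h2 := key t w
  have h3 : R < n := by linarith
  rw [hR, div_lt_iff₀ hε, ← sub_pos] at h3
  have h4 : 24 * a ≤ ε / 2 * a ^ 2 + 288 / ε := by
    have : ε / 2 * a ^ 2 + 288 / ε - 24 * a = (ε * a - 24) ^ 2 / (2 * ε) := by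
      field_simp; ring
    have h5 : 0 ≤ (ε * a - 24) ^ 2 / (2 * ε) := by positivity
    linarith
  have h5 := mul_le_mul_of_nonneg_left an (half_pos hε).le
  have h6 : 576 / ε = 2 * (288 / ε) := by ring
  rw [h6] at h3
  linarith

/-- An isotopy fixing `0` and `1` agrees near `1` with one supported in a small disc. -/
theorem exists_germ {H : I → ℂ ≃ₜ ℂ} (hH : JC H) (h0 : H 0 = 1) (hz : ∀ t, H t 0 = 0)
    (h1 : ∀ t, H t 1 = 1) : ∃ G : I → ℂ ≃ₜ ℂ, JC G ∧ G 0 = 1 ∧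
      (∀ t z, 1 / 2 ≤ ‖z - 1‖ → G t z = z) ∧
      ∃ ε > 0, ∀ t z, ‖z - 1‖ < ε → G t z = H t z := by
  obtain ⟨L, hL, L0, he, hp, hl⟩ := exists_lift_family hH h0 hz (c := 1 / 16) (by norm_num)
  replace hl := hl h1
  obtain ⟨f, f1, hQ⟩ := exists_chart hL L0 (P := 2 * Real.pi / (1 / 16)) (by positivity) hp
  obtain ⟨k, hk, k1, k2⟩ := exists_transplant (germChart f) hL
    (fun y z => by rw [germChart_source]; simp) hQ
  rw [germChart_source] at k1
  have small : ∀ w : ℂ, ‖w‖ ≤ 1 → germChart f w = Complex.exp (1 / 16 * w) := fun w hw => by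
    have hre := f1 _ ((Complex.abs_re_le_norm w).trans hw)
    have him := f1 _ ((Complex.abs_im_le_norm w).trans hw)
    have : slowMap f w = w := Complex.ext
      (by rw [slowMap_re, hre, quad_of_abs_le ((Complex.abs_re_le_norm w).trans hw)])
      (by rw [slowMap_im, him])
    rw [germChart_apply, this, squash_of_norm_le hw]
  refine ⟨k, hk, Homeomorph.ext fun z => ?_, fun t z h => k2 t z (notMem_germChart_target h), ?_⟩
  · by_cases h : z ∈ (germChart f).target
    · have := k1 0 ((germChart f).symm z) (mem_univ _)
      rw [L0, (germChart f).right_inv h] at this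
      rw [this]
      exact (germChart f).right_inv h
    · exact k2 0 z h
  · have ev : ∀ᶠ w in 𝓝 (0 : ℂ), ∀ t ∈ (univ : Set I), ‖L t w‖ < 1 := by
      refine isCompact_univ.eventually_forall_of_forall_eventually fun t _ => ?_
      have hc : Continuous fun p : ℂ × I => ‖L p.2 p.1‖ :=
        (hL.app continuous_snd continuous_fst).norm
      refine hc.continuousAt.eventually_lt continuousAt_const ?_
      simp [hl t]
    have ev' : ∀ᶠ z in 𝓝 (1 : ℂ), (‖16 * Complex.log z‖ < 1 ∧
        ∀ t ∈ (univ : Set I), ‖L t (16 * Complex.log z)‖ < 1) ∧ z ≠ 0 := by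
      have hc : ContinuousAt (fun z => 16 * Complex.log z) 1 :=
        continuousAt_const.mul (continuousAt_clog Complex.one_mem_slitPlane)
      have ht : Filter.Tendsto (fun z => 16 * Complex.log z) (𝓝 1) (𝓝 0) := by
        simpa [ContinuousAt] using hc
      have ev2 : ∀ᶠ w in 𝓝 (0 : ℂ), ‖w‖ < 1 :=
        continuous_norm.continuousAt.eventually_lt continuousAt_const (by simp)
      exact (ht.eventually (ev2.and ev)).and (isOpen_ne.mem_nhds one_ne_zero)
    obtain ⟨ε, hε, hb⟩ := Metric.eventually_nhds_iff_ball.1 ev'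
    refine ⟨ε, hε, fun t z hzε => ?_⟩
    obtain ⟨⟨b1, b2⟩, b3⟩ := hb z (mem_ball_iff_norm.2 hzε)
    have e1 : Complex.exp (1 / 16 * (16 * Complex.log z)) = z := by
      rw [← mul_assoc]; norm_num; exact Complex.exp_log b3
    have e2 := k1 t (16 * Complex.log z) (mem_univ _)
    have e3 := he t (16 * Complex.log z)
    push_cast at e3
    rw [small _ b1.le, e1, small _ (b2 t (mem_univ t)).le, e3, e1] at e2
    exact e2

end PlaneTC

namespace PlaneTC
open FreeGroup (of)
open Topology unitInterval

lemma mem_span_of_comm {o : ℤ} (n : ℕ) : ∀ g : F, g.norm ≤ n → of o * g = g * of o →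
    g ∈ span {o} := by
  induction n with
  | zero =>
    intro g hg _
    rw [FreeGroup.norm_eq_zero.1 (Nat.le_zero.1 hg)]
    exact one_mem _
  | succ n ih =>
    intro g hg hc
    have ho : of o ∈ span {o} := of_mem_span rfl
    have hred := FreeGroup.isReduced_toWord (x := g)
    have hnorm : g.toWord.length ≤ n + 1 := hg
    have hL : ∀ (b : Bool) l, g.toWord = (o, b) :: l → g ∈ span {o} := fun b l h => by
      have hg' : g = FreeGroup.mk [(o, b)] * FreeGroup.mk l := by
        rw [FreeGroup.mul_mk, List.singleton_append, ← h, FreeGroup.mk_toWord]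
      have hb : FreeGroup.mk [(o, b)] ∈ span {o} ∧
          of o * FreeGroup.mk [(o, b)] = FreeGroup.mk [(o, b)] * of o := by
        cases b
        · have : FreeGroup.mk [(o, false)] = (of o)⁻¹ := rfl
          rw [this]
          exact ⟨inv_mem ho, by group⟩
        · exact ⟨ho, rfl⟩
      rw [hg']
      refine mul_mem hb.1 (ih _ ?_ ?_)
      · refine FreeGroup.norm_mk_le.trans ?_
        rw [h, List.length_cons] at hnorm
        omega
      · rw [hg', ← mul_assoc, hb.2, mul_assoc, mul_assoc] at hc
        exact mul_left_cancel hc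
    have hR : ∀ (b : Bool) l, g.toWord = l ++ [(o, b)] → g ∈ span {o} := fun b l h => by
      have hg' : g = FreeGroup.mk l * FreeGroup.mk [(o, b)] := by
        rw [FreeGroup.mul_mk, ← h, FreeGroup.mk_toWord]
      have hb : FreeGroup.mk [(o, b)] ∈ span {o} ∧
          of o * FreeGroup.mk [(o, b)] = FreeGroup.mk [(o, b)] * of o := by
        cases b
        · have : FreeGroup.mk [(o, false)] = (of o)⁻¹ := rfl
          rw [this]
          exact ⟨inv_mem ho, by group⟩
        · exact ⟨ho, rfl⟩
      rw [hg']
      refine mul_mem (ih _ ?_ ?_) hb.1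
      · refine FreeGroup.norm_mk_le.trans ?_
        rw [h, List.length_append, List.length_singleton] at hnorm
        omega
      · rw [hg', mul_assoc, ← hb.2, ← mul_assoc, ← mul_assoc] at hc
        exact mul_right_cancel hc
    rcases hw : g.toWord with _ | ⟨⟨i, b⟩, l⟩
    · rw [FreeGroup.toWord_eq_nil_iff.1 hw]
      exact one_mem _
    by_cases hi : i = o
    · subst hi; exact hL b l hw
    rcases List.eq_nil_or_concat g.toWord with h | ⟨l', ⟨j, c⟩, hl'⟩
    · rw [hw] at h; exact absurd h (by simp)
    by_cases hj : j = o
    · subst hj; exact hR c l' (by simpa using hl')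
    exfalso
    have e1 : (of o * g).toWord = (o, true) :: g.toWord := by
      rw [FreeGroup.toWord_mul, FreeGroup.toWord_of]
      refine FreeGroup.IsReduced.reduce_eq ?_
      rw [hw] at hred ⊢
      exact FreeGroup.isReduced_cons_cons.2 ⟨fun h => absurd h.symm hi, hred⟩
    have e2 : (g * of o).toWord = g.toWord ++ [(o, true)] := by
      rw [FreeGroup.toWord_mul, FreeGroup.toWord_of]
      refine FreeGroup.IsReduced.reduce_eq ?_
      refine List.isChain_append.2 ⟨hred, List.isChain_singleton _, ?_⟩
      rw [hl']
      rintro x hx y hy h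
      simp at hx hy
      subst hx hy
      exact absurd h hj
    rw [hc, e2, hw] at e1
    simp at e1
    exact hi e1.1.1

lemma eq_one_of_comm {g : F} (h0 : of 0 * g = g * of 0) (h1 : of 1 * g = g * of 1) : g = 1 := by
  have e0 := kill_of_mem_span (mem_span_of_comm _ g le_rfl h0)
  have e1 := kill_of_mem_span (mem_span_of_comm _ g le_rfl h1)
  obtain ⟨m, hm⟩ := mem_span_singleton.1 (mem_span_of_comm _ g le_rfl h0)
  rw [← hm, map_zpow, kill_of_notMem (by simp), one_zpow] at e1
  rw [← hm, ← e1]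

lemma comm_of_conj_mem {o : ℤ} {g : F} (h : g⁻¹ * of o * g ∈ span {o}) : g ∈ span {o} := by
  obtain ⟨m, hm⟩ := mem_span_singleton.1 h
  have e := congrArg (FreeGroup.lift fun _ : ℤ => Multiplicative.ofAdd (1 : ℤ)) hm
  rw [map_zpow, map_mul, map_mul, map_inv, FreeGroup.lift_apply_of, mul_comm _⁻¹, mul_assoc,
    inv_mul_cancel, mul_one, ← ofAdd_zsmul] at e
  have e1 : m = 1 := by simpa using e
  rw [e1, zpow_one] at hm
  refine mem_span_of_comm _ g le_rfl ?_
  conv_rhs => rw [hm]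
  group

variable {H : I → ℂ ≃ₜ ℂ} {Q : Set ℤ} {ψ : ℂ → F}

lemma app_mem_Av {h : ℂ ≃ₜ ℂ} (hfix : ∀ k ∈ Q, h k = (k : ℤ)) {z : ℂ} (hz : z ∈ Av Q) :
    h z ∈ Av Q := fun k hk e => hz k hk (h.injective (by rw [e, hfix k hk]))

lemma wd_track (hH : JC H) (h0 : H 0 = 1) (hfix : ∀ t, ∀ k ∈ Q, H t k = (k : ℤ))
    (hQ0 : 0 ∈ Q) (hQ1 : 1 ∈ Q) (hΦ : ∀ k : ℤ, H 1 k = k) (hI : Ind (H 1) (MonoidHom.id F) ψ) {p : ℂ} (hp : p.im < 0) :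
    wd Q (fun t => H t p) = kill Q (ψ p) := by
  have key : ∀ w, kill Q w * (wd Q (fun t => H t p) * (kill Q (ψ p))⁻¹) =
      wd Q (fun t => H t p) * (kill Q (ψ p))⁻¹ * kill Q w := fun w => by
    obtain ⟨γ, hγ, hw⟩ := exists_loop hp w
    have hγQ : ∀ t, γ t ∈ Av Q := fun t k _ => hγ t k trivial
    have := wd_square (W := Q) (H := fun q : I × I => H q.1 (γ q.2))
      (hH.app continuous_fst (γ.continuous.comp continuous_snd))
      fun q => app_mem_Av (hfix _) (hγQ _)
    have e1 := hI γ γ.continuous hγ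
    simp only [h0, γ.source, γ.target, MonoidHom.id_apply] at this e1
    rw [wd_kill (subset_univ Q) (f := fun t => H 1 (γ t)) ((H 1).continuous.comp γ.continuous)
      fun t => app_mem_Av (h := H 1) (fun k _ => hΦ k) (hγ t), e1] at this
    change wd Q γ * _ = _ at this
    rw [wd_kill (subset_univ Q) γ.continuous hγ, hw, map_mul, map_mul, map_inv] at this
    rw [← mul_assoc, this]
    group
  have := eq_one_of_comm (g := wd Q (fun t => H t p) * (kill Q (ψ p))⁻¹)
    (by have := key (of 0); rwa [kill_of_mem hQ0] at this)
    (by have := key (of 1); rwa [kill_of_mem hQ1] at this)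
  exact mul_inv_eq_one.1 this

lemma wd_eq_one_of_strip {f : I → ℂ} (hf : Continuous f) (hW : ∀ t, f t ∈ Av Q) {o : ℤ} (hoQ : o ∉ Q)
    (ho : ∀ t, |(f t).re - o| < 1) : wd Q f = 1 := by
  obtain ⟨m, hm⟩ := mem_span_singleton.1 (wd_strip hf hW o ho)
  rw [wd_kill subset_rfl hf hW, ← hm, map_zpow, kill_of_notMem hoQ, one_zpow]

lemma wd_track_eq_one (hH : JC H) (h0 : H 0 = 1) (hfix : ∀ t, ∀ k ∈ Q, H t k = (k : ℤ))
    (hQ0 : 0 ∈ Q) (hQ1 : 1 ∈ Q) (hΦ : ∀ k : ℤ, H 1 k = k) (hI : Ind (H 1) (MonoidHom.id F) ψ)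
    {o : ℤ} (hoQ : o ∉ Q) : wd Q (fun t => H t o) = 1 := by
  obtain ⟨ρ', hρ', hball⟩ := Metric.continuousAt_iff.1
    ((H 1).continuous.continuousAt (x := (o : ℂ))) 1 one_pos
  rw [hΦ] at hball
  set ρ := min (ρ' / 2) (1 / 2) with hρ
  have ρ0 : 0 < ρ := by positivity
  have hb : ∀ z : ℂ, ‖z - o‖ ≤ ρ → |(H 1 z).re - o| < 1 := fun z hz => by
    have := hball (x := z) (by
      rw [dist_eq_norm]; exact hz.trans_lt ((min_le_left _ _).trans_lt (by linarith)))
    rw [dist_eq_norm] at this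
    have h2 := Complex.abs_re_le_norm (H 1 z - o)
    rw [Complex.sub_re, Complex.intCast_re] at h2
    exact h2.trans_lt this
  set p : ℂ := circ o ρ 0 with hp
  have hp' : p = o - ρ * Complex.I := by
    rw [hp]; apply Complex.ext <;> simp [circ]
  have hp1 : circ o ρ 1 = p := by
    rw [hp']; apply Complex.ext <;> simp [circ]
  have hk : ∀ k ∈ (univ : Set ℤ), |(k : ℝ) - o| ≠ ρ := fun k _ e => by
    have h1 : ρ ≤ 1 / 2 := min_le_right _ _
    rw [← e, ← Int.cast_sub, ← Int.cast_abs] at h1 ρ0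
    have h2 : (0 : ℤ) < |k - o| := by exact_mod_cast ρ0
    have h3 : (1 : ℝ) ≤ (|k - o| : ℤ) := by exact_mod_cast h2
    linarith
  have hc : Continuous fun t : I => circ o ρ t :=
    continuous_circ continuous_const continuous_const continuous_subtype_val
  have hcM : ∀ t : I, circ o ρ t ∈ Av univ := fun t => circ_mem_Av ρ0.le hk t
  have hstrip := wd_strip (W := univ) ((H 1).continuous.comp hc)
    (fun t => app_mem_Av (fun k _ => hΦ k) (hcM t)) o fun t => hb _ (by
      have := dist_circ o ρ t ρ0.le
      push_cast at this
      exact this.le)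
  have hψ : ψ p ∈ span {o} := by
    refine comm_of_conj_mem ?_
    have e := hI _ hc hcM
    simp only [Icc.coe_zero, Icc.coe_one, hp1, ← hp, MonoidHom.id_apply] at e
    have hce : wd univ (fun t : I => circ o ρ t) = of o := by
      rw [wd_circ ρ0.le hk]
      have h1 : ⌈(o : ℝ) - ρ⌉ = o := by
        rw [Int.ceil_eq_iff]
        have : ρ ≤ 1 / 2 := min_le_right _ _
        constructor <;> linarith
      have h2 : ⌈(o : ℝ) + ρ⌉ = o + 1 := by
        rw [Int.ceil_eq_iff]
        have : ρ ≤ 1 / 2 := min_le_right _ _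
        push_cast
        constructor <;> linarith
      rw [h1, h2, pw_rec o, mul_assoc, mul_inv_cancel, mul_one, kill_of_mem (mem_univ o)]
    rw [hce] at e
    rw [← e]
    exact hstrip
  obtain ⟨m, hm⟩ := mem_span_singleton.1 hψ
  have hδ := wd_track hH h0 hfix hQ0 hQ1 hΦ hI (p := p) (by rw [hp']; simpa using ρ0)
  rw [← hm, map_zpow, kill_of_notMem hoQ, one_zpow] at hδ
  set sg : I → ℂ := fun s => o - ((1 - s : ℝ) * ρ : ℝ) * Complex.I with hsg
  have sgc : Continuous sg := by fun_prop
  have sgre : ∀ s, (sg s).re = o := fun s => by simp [hsg]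
  have sgQ : ∀ s, ∀ k ∈ Q, (sg s).re ≠ (k : ℤ) := fun s k hkQ e => by
    rw [sgre] at e
    have : o = k := by exact_mod_cast e
    exact hoQ (this ▸ hkQ)
  have sgA : ∀ s, sg s ∈ Av Q := fun s => Lo_subset_Av (Or.inr (sgQ s))
  have sgn : ∀ s, ‖sg s - o‖ ≤ ρ := fun s => by
    have h1 : ‖sg s - o‖ = (1 - s) * ρ := by
      simp only [hsg, sub_sub_cancel_left, norm_neg, norm_mul, Complex.norm_I, mul_one]
      exact Complex.norm_of_nonneg (mul_nonneg (by linarith [s.2.2]) ρ0.le)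
    rw [h1]
    nlinarith [s.2.1]
  have sq := wd_square (W := Q) (H := fun q : I × I => H q.1 (sg q.2))
    (hH.app continuous_fst (sgc.comp continuous_snd)) fun q => app_mem_Av (hfix _) (sgA _)
  have sg0 : sg 0 = p := by rw [hp']; simp [hsg]
  have sg1 : sg 1 = o := by simp [hsg]
  have e1 : wd Q sg = 1 := wd_of_Lo sgc fun s => Or.inr (sgQ s)
  have e2 : wd Q (fun s => H 1 (sg s)) = 1 :=
    wd_eq_one_of_strip ((H 1).continuous.comp sgc) (fun s => app_mem_Av (hfix 1) (sgA s)) hoQ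
      fun s => hb _ (sgn s)
  simp only [h0, sg0, sg1, hδ, e2] at sq
  change wd Q sg * _ = _ at sq
  rwa [e1, one_mul, one_mul] at sq

end PlaneTC

namespace PlaneTC
open FreeGroup (of)
open Topology unitInterval

/-- The radial embedding of the punctured plane avoiding the disc of radius `r'`. -/
noncomputable def avoid (r' r : ℝ) (z : ℂ) : ℂ := z * ((1 + max 0 (r' / ‖z‖ - r' / r) : ℝ) : ℂ)

section
variable {r' r : ℝ} {z : ℂ}

lemma avoid_of_le (hr' : 0 < r') (hr : r' < r) (h : r ≤ ‖z‖) : avoid r' r z = z := by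
  rw [avoid, max_eq_left, add_zero, Complex.ofReal_one, mul_one]
  rw [sub_nonpos]
  exact div_le_div_of_nonneg_left hr'.le (hr'.trans hr) h

lemma norm_avoid (hr' : 0 < r') (hz : z ≠ 0) (h : ‖z‖ ≤ r) :
    ‖avoid r' r z‖ = r' + ‖z‖ * (1 - r' / r) := by
  have hz' : 0 < ‖z‖ := norm_pos_iff.2 hz
  have h1 : 0 ≤ r' / ‖z‖ - r' / r := sub_nonneg.2 (div_le_div_of_nonneg_left hr'.le hz' h)
  rw [avoid, max_eq_right h1, norm_mul, Complex.norm_of_nonneg (by positivity)]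
  field_simp
  ring

lemma continuousOn_avoid : ContinuousOn (avoid r' r) {0}ᶜ := fun z hz => by
  have hz' : ‖z‖ ≠ 0 := norm_ne_zero_iff.2 hz
  refine ContinuousAt.continuousWithinAt (continuousAt_id.mul
    (Complex.continuous_ofReal.continuousAt.comp (f := fun z : ℂ => 1 + max 0 (r' / ‖z‖ - r' / r)) ?_))
  exact continuousAt_const.add (continuousAt_const.max
    ((continuousAt_const.div continuous_norm.continuousAt hz').sub continuousAt_const))

end

lemma exists_comb_step {H : I → ℂ ≃ₜ ℂ} {Q : Set ℤ} (hQf : Q.Finite) {ψ : ℂ → F} (hH : JC H)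
    (h0 : H 0 = 1) (hfix : ∀ t, ∀ k ∈ Q, H t k = (k : ℤ)) (hQ0 : 0 ∈ Q) (hQ1 : 1 ∈ Q)
    (hΦ : ∀ k : ℤ, H 1 k = k) (hI : Ind (H 1) (MonoidHom.id F) ψ) {o : ℤ} (hoQ : o ∉ Q)
    {r' r : ℝ} (hr' : 0 < r') (hr : r' < r) (hball : ∀ t z, ‖z‖ < r → H t z = z)
    (hor : r ≤ ‖(o : ℂ)‖) (hQr : ∀ k ∈ Q, ‖((k : ℤ) : ℂ)‖ < r → ‖((k : ℤ) : ℂ)‖ ≤ r') :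
    ∃ K : I → ℂ ≃ₜ ℂ, JC K ∧ K 0 = 1 ∧ K 1 = H 1 ∧ (∀ t, ∀ k ∈ insert o Q, K t k = (k : ℤ)) ∧
      ∀ t z, ‖z‖ < r' → K t z = z := by
  have hoA : (o : ℂ) ∈ Av Q := fun k hk e => hoQ (by
    have : o = k := by exact_mod_cast e
    exact this ▸ hk)
  let γ : Path (o : ℂ) o := ⟨⟨fun t => H t o, hH.app continuous_id continuous_const⟩,
    by simp [h0], by simp [hΦ]⟩
  have hγ : ∀ t, γ t ∈ Av Q := fun t => app_mem_Av (hfix t) hoA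
  obtain ⟨Ho, hHo⟩ := exists_homotopy (Path.refl (o : ℂ)) γ (fun _ => hoA) hγ (by
    rw [show wd Q γ = 1 from wd_track_eq_one hH h0 hfix hQ0 hQ1 hΦ hI hoQ]
    exact wd_const hoA)
  have hne : ∀ p, Ho p ≠ 0 := fun p => by simpa using hHo p 0 hQ0
  set U : Set ℂ := {z | r' < ‖z‖} ∩ Av Q with hU
  have hUo : IsOpen U := by
    refine (isOpen_lt continuous_const continuous_norm).inter ?_
    have : Av Q = ((fun k : ℤ => (k : ℂ)) '' Q)ᶜ := by
      ext z
      simp only [Av, mem_ofPred_eq, mem_compl_iff, mem_image, not_exists, not_and]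
      exact ⟨fun h k hk e => h k hk e.symm, fun h k hk e => h k hk e.symm⟩
    rw [this]
    exact (hQf.image _).isClosed.isOpen_compl
  have hΓc : Continuous fun p : I × I => avoid r' r (Ho p) :=
    continuousOn_avoid.comp_continuous Ho.continuous hne
  have hΓU : ∀ p, avoid r' r (Ho p) ∈ U := fun p => by
    rcases le_total r ‖Ho p‖ with h | h
    · rw [avoid_of_le hr' hr h]
      exact ⟨hr.trans_le h, hHo p⟩
    rcases h.eq_or_lt with h' | h'
    · rw [avoid_of_le hr' hr h'.ge]
      exact ⟨hr.trans_le h'.ge, hHo p⟩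
    have e := norm_avoid hr' (hne p) h
    have hp : 0 < ‖Ho p‖ := norm_pos_iff.2 (hne p)
    have h1 : r' / r < 1 := (div_lt_one (hr'.trans hr)).2 hr
    have h2 : r' < ‖avoid r' r (Ho p)‖ := by
      rw [e]
      nlinarith
    have h3 : ‖avoid r' r (Ho p)‖ < r := by
      rw [e]
      have : r * (1 - r' / r) = r - r' := by
        have := (hr'.trans hr).ne'
        field_simp
      nlinarith
    refine ⟨h2, fun k hk ek => ?_⟩
    rw [ek] at h2 h3
    exact absurd (hQr k hk h3) h2.not_ge
  have hfar : ∀ t, r ≤ ‖H t o‖ := fun t => by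
    by_contra! h
    have := (H t).injective (hball t _ h)
    rw [this] at h
    exact absurd h hor.not_gt
  have hoo : avoid r' r (o : ℂ) = o := avoid_of_le hr' hr hor
  obtain ⟨G, hG, G1, G2, G3⟩ := exists_drag hUo (Γ := fun s t => avoid r' r (Ho (s, t))) hΓc
    (fun s t => hΓU (s, t)) (o := (o : ℂ)) fun t => by simp [hoo]
  have hG1 : ∀ t, G t o = H t o := fun t => by
    rw [G1, Ho.apply_one]
    exact avoid_of_le hr' hr (hfar t)
  have hG0 : ∀ t, (∀ s, Ho (s, t) = o) → G t = 1 := fun t h => G3 t fun s => by rw [h, hoo]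
  refine ⟨fun t => (G t)⁻¹ * H t, hG.inv.mul hH, ?_, ?_, ?_, ?_⟩
  · simp only [h0, hG0 0 fun s => Ho.source s, inv_one, mul_one]
  · simp only [hG0 1 fun s => Ho.target s, inv_one, one_mul]
  · rintro t k (rfl | hk)
    · rw [mul_app, ← hG1, inv_app_self]
    · rw [mul_app, hfix t k hk]
      exact inv_fix (G2 t _ fun h => h.2 k hk rfl)
  · intro t z hz
    rw [mul_app, hball t z (hz.trans hr)]
    exact inv_fix (G2 t _ fun h => absurd h.1 hz.not_gt)

lemma exists_comb {H : I → ℂ ≃ₜ ℂ} (hH : JC H) (h0 : H 0 = 1) (h1 : ∀ t, H t 1 = 1)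
    (hΦ : ∀ k : ℤ, H 1 k = k) (hT : Triv (H 1)) {r₀ r : ℝ} (hr₀ : 0 < r₀)
    (hball : ∀ t z, ‖z‖ < r → H t z = z) (hZ : ∀ k : ℤ, ‖(k : ℂ)‖ < r → ‖(k : ℂ)‖ ≤ r₀)
    (S : Finset ℤ) : ∀ r', r₀ < r' → r' < r → ∃ K : I → ℂ ≃ₜ ℂ, JC K ∧ K 0 = 1 ∧ K 1 = H 1 ∧
      (∀ t, ∀ k ∈ ({0, 1} ∪ S : Set ℤ), K t k = (k : ℤ)) ∧ ∀ t z, ‖z‖ < r' → K t z = z := by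
  obtain ⟨ψ, hI⟩ := hT
  induction S using Finset.induction_on with
  | empty =>
    intro r' h2 h3
    refine ⟨H, hH, h0, rfl, fun t k hk => ?_, fun t z hz => hball t z (hz.trans h3)⟩
    rcases hk with (rfl | rfl) | hk
    · exact hball t _ (by simpa using hr₀.trans (h2.trans h3))
    · simpa using h1 t
    · simp at hk
  | insert o S _ ih =>
    intro r' h2 h3
    obtain ⟨K, hK, K0, K1, Kf, Kb⟩ := ih ((r' + r) / 2) (by linarith) (by linarith)
    by_cases hok : ∀ t, K t o = o
    · refine ⟨K, hK, K0, K1, fun t k hk => ?_, fun t z hz => Kb t z (hz.trans (by linarith))⟩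
      rcases hk with hk | hk
      · exact Kf t k (Or.inl hk)
      · rcases Finset.mem_insert.1 hk with rfl | hk
        · exact hok t
        · exact Kf t k (Or.inr hk)
    · have ho : o ∉ ({0, 1} ∪ S : Set ℤ) := fun h => hok fun t => Kf t o h
      have hor : (r' + r) / 2 ≤ ‖(o : ℂ)‖ := by
        by_contra! h
        exact hok fun t => Kb t _ h
      obtain ⟨K', a1, a2, a3, a4, a5⟩ := exists_comb_step (Q := {0, 1} ∪ S)
        ((toFinite _).union S.finite_toSet) hK K0 Kf (by simp) (by simp) (fun k => K1 ▸ hΦ k)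
        (K1 ▸ hI) ho (hr₀.trans h2) (by linarith : r' < (r' + r) / 2) Kb hor
        fun k _ hk => (hZ k (hk.trans (by linarith))).trans h2.le
      refine ⟨K', a1, a2, a3.trans K1, fun t k hk => a4 t k ?_, a5⟩
      rw [Finset.coe_insert, union_insert] at hk
      exact hk

end PlaneTC

namespace PlaneTC
open Topology unitInterval

lemma pres_of_fix {h : ℂ ≃ₜ ℂ} (hk : ∀ k : ℤ, h k = k) : Pres h :=
  pres_of_perm (Equiv.refl ℤ) hk

/-- The radial factor of the map which rescales radii beyond `a` by `c`. -/
noncomputable def dilFactor (a c r : ℝ) : ℝ := 1 + (c - 1) * (max 0 (r - a) / max r a)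

/-- The radial map which is the identity on the disc of radius `a` and rescales radii beyond `a`
by `c`. -/
noncomputable def dil (a c : ℝ) (z : ℂ) : ℂ := dilFactor a c ‖z‖ • z

section
variable {a c : ℝ} {z : ℂ}

lemma dil_of_le (h : ‖z‖ ≤ a) : dil a c z = z := by
  rw [dil, dilFactor, max_eq_left (sub_nonpos.2 h), zero_div, mul_zero, add_zero, one_smul]

lemma dil_of_ge (ha : 0 < a) (h : a ≤ ‖z‖) : dil a c z = ((a + c * (‖z‖ - a)) / ‖z‖) • z := by
  have : ‖z‖ ≠ 0 := (ha.trans_le h).ne'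
  rw [dil, dilFactor, max_eq_right (sub_nonneg.2 h), max_eq_left h]
  congr 1
  field_simp
  ring

lemma norm_dil_of_ge (ha : 0 < a) (hc : 0 < c) (h : a ≤ ‖z‖) :
    ‖dil a c z‖ = a + c * (‖z‖ - a) := by
  have h0 : 0 < ‖z‖ := ha.trans_le h
  have h1 : 0 ≤ a + c * (‖z‖ - a) := add_nonneg ha.le (mul_nonneg hc.le (sub_nonneg.2 h))
  rw [dil_of_ge ha h, norm_smul, Real.norm_of_nonneg (div_nonneg h1 h0.le)]
  field_simp

lemma dil_dil_inv (ha : 0 < a) (hc : 0 < c) (z : ℂ) : dil a c⁻¹ (dil a c z) = z := by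
  rcases le_total ‖z‖ a with h | h
  · rw [dil_of_le h, dil_of_le h]
  have hn := norm_dil_of_ge ha hc h
  have h1 : 0 ≤ c * (‖z‖ - a) := mul_nonneg hc.le (sub_nonneg.2 h)
  have h0 : ‖z‖ ≠ 0 := (ha.trans_le h).ne'
  have h2 : a + c * (‖z‖ - a) ≠ 0 := by positivity
  rw [dil_of_ge ha (by rw [hn]; linarith), hn, dil_of_ge ha h, smul_smul]
  convert one_smul ℝ z using 2
  field_simp
  ring

lemma continuous_dil (ha : 0 < a) : Continuous (dil a c) := by
  have h : Continuous fun z : ℂ => max 0 (‖z‖ - a) / max ‖z‖ a :=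
    (by fun_prop : Continuous fun z : ℂ => max 0 (‖z‖ - a)).div (by fun_prop)
      fun z => (ha.trans_le (le_max_right _ _)).ne'
  exact (continuous_const.add (continuous_const.mul h)).smul continuous_id

lemma exists_dil (ha : 0 < a) (hc : 0 < c) : ∃ e : ℂ ≃ₜ ℂ, ∀ z, e z = dil a c z :=
  ⟨{ toFun := dil a c
     invFun := dil a c⁻¹
     left_inv := dil_dil_inv ha hc
     right_inv := fun z => by simpa using dil_dil_inv ha (inv_pos.2 hc) z
     continuous_toFun := continuous_dil ha
     continuous_invFun := continuous_dil ha }, fun _ => rfl⟩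
end

lemma exists_squeeze {a b R : ℝ} (ha : 0 < a) (hab : a < b) (hbR : b ≤ R) :
    ∃ q : ℂ ≃ₜ ℂ, (∀ z, ‖z‖ ≤ a → q z = z) ∧ ∀ z, b ≤ ‖z‖ → R ≤ ‖q⁻¹ z‖ := by
  have hc : 0 < (b - a) / (R - a) := div_pos (sub_pos.2 hab) (by linarith)
  obtain ⟨q, hq⟩ := exists_dil ha hc
  refine ⟨q, fun z hz => by rw [hq, dil_of_le hz], fun z hz => ?_⟩
  obtain ⟨w, rfl⟩ := q.surjective z
  rw [inv_app_self]
  by_contra! hw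
  rw [hq] at hz
  rcases le_total ‖w‖ a with h | h
  · rw [dil_of_le h] at hz
    linarith
  rw [norm_dil_of_ge ha hc h] at hz
  have h1 : (b - a) / (R - a) * (‖w‖ - a) < (b - a) / (R - a) * (R - a) :=
    mul_lt_mul_of_pos_left (by linarith) hc
  rw [div_mul_cancel₀ _ (by linarith)] at h1
  linarith

lemma exists_expand {d L : ℝ} (hd : 0 < d) (hdL : d < L) :
    ∃ p : ℂ ≃ₜ ℂ, (∀ z, ‖z‖ ≤ L → ‖p⁻¹ z‖ ≤ d) ∧ ∀ z, 2 * L ≤ ‖z‖ → p z = z := by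
  have hL : 0 < L := hd.trans hdL
  have hc : 0 < d / (2 * L) := by positivity
  have hm : 0 < 2 * L - d := by linarith
  obtain ⟨u, hu⟩ := exists_dil hL hc
  obtain ⟨v, hv⟩ := exists_dil hm two_pos
  have hs : ((L / d : ℝ) : ℂ) ≠ 0 := Complex.ofReal_ne_zero.2 (by positivity)
  set s : ℂ ≃ₜ ℂ := Homeomorph.mulLeft₀ _ hs with hsd
  have hsz : ∀ z, s z = (L / d : ℝ) • z := fun z => by
    rw [Complex.real_smul]; rfl
  have hn : ∀ z, ‖s z‖ = L / d * ‖z‖ := fun z => by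
    rw [hsz, norm_smul, Real.norm_of_nonneg (by positivity)]
  have key : ∀ z, d ≤ ‖z‖ → u (s z) = ((L + (‖z‖ - d) / 2) / ‖z‖) • z := fun z hz => by
    have h0 : ‖z‖ ≠ 0 := (hd.trans_le hz).ne'
    have : L ≤ ‖s z‖ := by
      rw [hn, div_mul_eq_mul_div, le_div_iff₀ hd]
      exact mul_le_mul_of_nonneg_left hz hL.le
    rw [hu, dil_of_ge hL this, hn, hsz, smul_smul]
    congr 1
    field_simp
  have keyn : ∀ z, d ≤ ‖z‖ → ‖u (s z)‖ = L + (‖z‖ - d) / 2 := fun z hz => by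
    have h0 : 0 < ‖z‖ := hd.trans_le hz
    have h1 : 0 ≤ L + (‖z‖ - d) / 2 := by linarith
    rw [key z hz, norm_smul, Real.norm_of_nonneg (div_nonneg h1 h0.le)]
    field_simp
  refine ⟨v * u * s, fun z hz => ?_, fun z hz => ?_⟩
  · obtain ⟨w, rfl⟩ := (v * u * s).surjective z
    rw [inv_app_self]
    by_contra! hw
    rw [mul_app, mul_app] at hz
    have hk := keyn w hw.le
    rcases le_total ‖u (s w)‖ (2 * L - d) with h | h
    · rw [hv, dil_of_le h] at hz
      linarith
    · rw [hv, norm_dil_of_ge hm two_pos h] at hz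
      linarith
  · have hz' : d ≤ ‖z‖ := by linarith
    have h0 : ‖z‖ ≠ 0 := (hd.trans_le hz').ne'
    have hk := keyn z hz'
    have h1 : L + (‖z‖ - d) / 2 ≠ 0 := by linarith
    rw [mul_app, mul_app, hv, dil_of_ge hm (by rw [hk]; linarith), hk, key z hz', smul_smul]
    convert one_smul ℝ z using 2
    rw [show 2 * L - d + 2 * (L + (‖z‖ - d) / 2 - (2 * L - d)) = ‖z‖ by ring,
      div_mul_div_cancel₀' h0, div_self h1]

/-- A family which is the identity near the origin agrees on a given disc with a family of uniformly
bounded support. -/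
lemma exists_cut {K : I → ℂ ≃ₜ ℂ} (hK : JC K) {r : ℝ} (hr : 0 < r)
    (hball : ∀ t z, ‖z‖ < r → K t z = z) (N : ℝ) :
    ∃ C : I → ℂ ≃ₜ ℂ, JC C ∧ (∀ t z, ‖z‖ ≤ N → C t z = K t z) ∧ (∀ t, K t = 1 → C t = 1) ∧
      ∃ R, ∀ t z, R ≤ ‖z‖ → C t z = z := by
  obtain ⟨M, hM⟩ := exists_family_bound hK N
  have hL : r / 2 < max M r := (half_lt_self hr).trans_le (le_max_right _ _)
  obtain ⟨p, hp1, hp2⟩ := exists_expand (half_pos hr) hL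
  set L := max M r
  obtain ⟨M', hM'⟩ := exists_family_bound hK.inv (2 * L)
  have hpi : ∀ z, 2 * L ≤ ‖z‖ → p⁻¹ z = z := fun z hz => inv_fix (hp2 z hz)
  refine ⟨fun t => (p * K t * p⁻¹)⁻¹ * K t, (((JC.const p).mul hK).mul (JC.const _)).inv.mul hK,
    fun t z hz => ?_, fun t ht => by simp [ht], max (2 * L) (M' + 1), fun t z hz => ?_⟩
  · rw [mul_app]
    refine inv_fix ?_
    rw [mul_app, mul_app, hball t _ ((hp1 _ ((hM t z hz).trans (le_max_left _ _))).trans_lt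
      (half_lt_self hr)), app_inv_self]
  · have hz1 : 2 * L ≤ ‖z‖ := (le_max_left _ _).trans hz
    have hz2 : 2 * L ≤ ‖K t z‖ := by
      by_contra! h
      have := hM' t _ h.le
      rw [inv_app_self] at this
      linarith [(le_max_right (2 * L) (M' + 1)).trans hz]
    rw [mul_app, inv_app_eq, mul_app, mul_app, hpi z hz1, hp2 _ hz2]

theorem exists_step {H : I → ℂ ≃ₜ ℂ} (hH : JC H) (h0 : H 0 = 1) (h1 : ∀ t, H t 1 = 1)
    (hΦ : ∀ k : ℤ, H 1 k = k) (hT : Triv (H 1)) {r₀ r : ℝ} (hr₀ : 0 < r₀)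
    (hball : ∀ t z, ‖z‖ < r → H t z = z) (hZ : ∀ k : ℤ, ‖(k : ℂ)‖ < r → ‖(k : ℂ)‖ ≤ r₀)
    {r' : ℝ} (hr' : r₀ < r') (hrr : r' < r) (N : ℝ) :
    ∃ C : I → ℂ ≃ₜ ℂ, JC C ∧ C 0 = 1 ∧ (∀ t, ∀ k : ℤ, C t k = k) ∧
      (∀ t z, ‖z‖ < r' → C t z = z) ∧ ∀ z, ‖z‖ ≤ N → C 1 z = H 1 z := by
  obtain ⟨M, hM⟩ := exists_family_bound hH N
  obtain ⟨n, hn⟩ := exists_nat_gt (max (max M N) r')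
  have hnM : M < n := (le_max_left _ _).trans_lt ((le_max_left _ _).trans_lt hn)
  have hnN : N < n := (le_max_right _ _).trans_lt ((le_max_left _ _).trans_lt hn)
  have hnr : r' < n := (le_max_right _ _).trans_lt hn
  have hr'0 : 0 < r' := hr₀.trans hr'
  obtain ⟨K, hK, K0, K1, hKS, hKb⟩ :=
    exists_comb hH h0 h1 hΦ hT hr₀ hball hZ (Finset.Icc (-n : ℤ) n) r' hr' hrr
  obtain ⟨C, hC, hCK, hC0, R, hR⟩ := exists_cut hK hr'0 hKb n
  have ha : (0 : ℝ) < n + 1 / 4 := by positivity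
  obtain ⟨q, hq1, hq2⟩ := exists_squeeze (b := (n : ℝ) + 1 / 2) (R := max R (n + 1 / 2)) ha
    (by linarith) (le_max_right _ _)
  have hqi : ∀ z, ‖z‖ ≤ n → q⁻¹ z = z := fun z hz => inv_fix (hq1 z (by linarith))
  refine ⟨fun t => q * C t * q⁻¹, ((JC.const q).mul hC).mul (JC.const _), by
    simp [hC0 0 K0], fun t k => ?_, fun t z hz => ?_, fun z hz => ?_⟩
  · rw [mul_app, mul_app]
    have hkn : ‖(k : ℂ)‖ = (|k| : ℤ) := by rw [Complex.norm_intCast, Int.cast_abs]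
    rcases le_or_gt |k| n with hk | hk
    · have hk' : ‖(k : ℂ)‖ ≤ n := by rw [hkn]; exact_mod_cast hk
      rw [hqi _ hk', hCK t _ hk', hKS t k, hq1 _ (by linarith)]
      exact Or.inr (by simpa [abs_le] using hk)
    · have hk' : (n : ℝ) + 1 ≤ ‖(k : ℂ)‖ := by rw [hkn]; exact_mod_cast hk
      rw [hR t _ ((le_max_left _ _).trans (hq2 _ (by linarith))), app_inv_self]
  · have hz' : ‖z‖ ≤ n := by linarith
    rw [mul_app, mul_app, hqi z hz', hCK t z hz', hKb t z hz, hq1 z (by linarith)]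
  · have hz' : ‖z‖ ≤ n := by linarith
    rw [mul_app, mul_app, hqi z hz', hCK 1 z hz', K1, hq1 _ (by linarith [hM 1 z hz])]

end PlaneTC

namespace PlaneTC
open Topology unitInterval Filter

/-- Alexander's trick. -/
lemma exists_alexander (h : ℂ ≃ₜ ℂ) {r : ℝ} (hr : 0 < r) (hb : ∀ z, ‖z‖ ≤ r → h z = z) :
    ∃ H : I → ℂ ≃ₜ ℂ, JC H ∧ H 0 = 1 ∧ H 1 = h ∧ ∀ t z, ‖z‖ ≤ r → H t z = z := by
  have hn : ∀ (t : I) (z : ℂ), ‖((t : ℝ) : ℂ) * z‖ = t * ‖z‖ := fun t z => by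
    rw [norm_mul, Complex.norm_of_nonneg t.2.1]
  have hball : ∀ e : ℂ ≃ₜ ℂ, (∀ z, ‖z‖ ≤ r → e z = z) → ∀ (t : I) (z : ℂ), t * ‖z‖ ≤ r →
      (if t = 0 then z else ((t : ℝ) : ℂ)⁻¹ * e (((t : ℝ) : ℂ) * z)) = z := fun e he t z hz => by
    split_ifs with ht
    · rfl
    · have ht' : ((t : ℝ) : ℂ) ≠ 0 := Complex.ofReal_ne_zero.2 fun h => ht (Subtype.ext h)
      rw [he _ (by rwa [hn]), inv_mul_cancel_left₀ ht']
  have hcont : ∀ e : ℂ ≃ₜ ℂ, (∀ z, ‖z‖ ≤ r → e z = z) → Continuous fun p : I × ℂ =>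
      if p.1 = 0 then p.2 else ((p.1 : ℝ) : ℂ)⁻¹ * e (((p.1 : ℝ) : ℂ) * p.2) := fun e he => by
    refine continuous_iff_continuousAt.2 fun ⟨t, z⟩ => ?_
    by_cases ht : t = 0
    · have h1 : ∀ᶠ p : I × ℂ in 𝓝 (t, z), (p.1 : ℝ) * ‖p.2‖ < r :=
        (isOpen_lt (by fun_prop : Continuous fun p : I × ℂ => (p.1 : ℝ) * ‖p.2‖)
          continuous_const).mem_nhds (by simpa [ht] using hr)
      exact continuousAt_snd.congr (h1.mono fun p hp => (hball e he p.1 p.2 hp.le).symm)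
    · have h1 : ∀ᶠ p : I × ℂ in 𝓝 (t, z), p.1 ≠ 0 :=
        (isOpen_compl_singleton.preimage continuous_fst).mem_nhds ht
      have ht' : ((t : ℝ) : ℂ) ≠ 0 := Complex.ofReal_ne_zero.2 fun h => ht (Subtype.ext h)
      have h2 : ContinuousAt (fun p : I × ℂ => ((p.1 : ℝ) : ℂ)⁻¹ * e (((p.1 : ℝ) : ℂ) * p.2))
          (t, z) :=
        (ContinuousAt.inv₀ (f := fun p : I × ℂ => ((p.1 : ℝ) : ℂ)) (by fun_prop) ht').mul
          (e.continuous.comp (by fun_prop :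
            Continuous fun p : I × ℂ => ((p.1 : ℝ) : ℂ) * p.2)).continuousAt
      exact h2.congr (h1.mono fun p hp => (if_neg hp).symm)
  have hinv : ∀ (e : ℂ ≃ₜ ℂ) (t : I) (z : ℂ),
      (if t = 0 then (if t = 0 then z else ((t : ℝ) : ℂ)⁻¹ * e (((t : ℝ) : ℂ) * z)) else
        ((t : ℝ) : ℂ)⁻¹ * e⁻¹ (((t : ℝ) : ℂ) *
          (if t = 0 then z else ((t : ℝ) : ℂ)⁻¹ * e (((t : ℝ) : ℂ) * z)))) = z := fun e t z => by
    split_ifs with ht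
    · rfl
    · have ht' : ((t : ℝ) : ℂ) ≠ 0 := Complex.ofReal_ne_zero.2 fun h => ht (Subtype.ext h)
      rw [mul_inv_cancel_left₀ ht', inv_app_self, inv_mul_cancel_left₀ ht']
  have hbi : ∀ z, ‖z‖ ≤ r → (h⁻¹ : ℂ ≃ₜ ℂ) z = z := fun z hz => inv_fix (hb z hz)
  obtain ⟨H, hH, hHf⟩ := exists_family
    (f := fun (t : I) z => if t = 0 then z else ((t : ℝ) : ℂ)⁻¹ * h (((t : ℝ) : ℂ) * z))
    (g := fun (t : I) z => if t = 0 then z else ((t : ℝ) : ℂ)⁻¹ * h⁻¹ (((t : ℝ) : ℂ) * z))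
    (hcont h hb)
    (fun t => (hcont h⁻¹ hbi).comp (continuous_const.prodMk continuous_id)) (hinv h)
    (by simpa using hinv h⁻¹)
  refine ⟨H, hH, Homeomorph.ext fun z => by simp [hHf],
    Homeomorph.ext fun z => by simp [hHf], fun t z hz => ?_⟩
  rw [hHf]
  exact hball h hb t z ((mul_le_of_le_one_left (norm_nonneg _) t.2.2).trans hz)

/-- One step of the infinite isotopy. -/
lemma exists_extend (n : ℕ) {Φ : ℂ ≃ₜ ℂ} (hΦ : ∀ k : ℤ, Φ k = k) (hT : Triv Φ)
    (hb : ∀ z, ‖z‖ ≤ n + 3 / 2 → Φ z = z) :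
    ∃ C : I → ℂ ≃ₜ ℂ, JC C ∧ C 0 = 1 ∧ (∀ t, ∀ k : ℤ, C t k = k) ∧
      (∀ t z, ‖z‖ < n + 5 / 4 → C t z = z) ∧
      ∀ z, ‖z‖ ≤ (n + 1 : ℕ) + 3 / 2 → C 1 z = Φ z := by
  obtain ⟨H, hH, h0, rfl, hHb⟩ := exists_alexander Φ (by positivity) hb
  refine exists_step hH h0 (fun t => hHb t 1 ?_) hΦ hT (r₀ := n + 9 / 8) (by positivity)
    (fun t z hz => hHb t z hz.le) (fun k hk => ?_) (by linarith) (by linarith) _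
  · rw [norm_one]
    linarith [n.cast_nonneg (α := ℝ)]
  · rw [Complex.norm_intCast, ← Int.cast_abs] at hk ⊢
    have : |k| < n + 2 := by
      have : ((|k| : ℤ) : ℝ) < (n + 2 : ℤ) := by push_cast at hk ⊢; linarith
      exact_mod_cast this
    have h2 : ((|k| : ℤ) : ℝ) ≤ (n + 1 : ℤ) := Int.cast_le.2 (by lia)
    push_cast at h2 ⊢
    linarith

lemma Triv.of_isotopy {C : I → ℂ ≃ₜ ℂ} (hC : JC C) (C0 : C 0 = 1) (hk : ∀ t, ∀ k : ℤ, C t k = k)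
    {Φ : ℂ ≃ₜ ℂ} (hΦ : ∀ k : ℤ, Φ k = k) (hT : Triv Φ) : Triv ((C 1)⁻¹ * Φ) :=
  Triv.isotopy (H := fun t => (C t)⁻¹ * Φ) (hC.inv.mul (JC.const _))
    (fun t => pres_of_fix fun k => by rw [mul_app, hΦ, inv_fix (hk t k)]) (by simpa [C0] using hT)

/-- The reparametrisation of the `n`-th stage of an infinite concatenation. -/
noncomputable def stage (n : ℕ) (t : I) : I :=
  projIcc 0 1 zero_le_one ((n + 1) * (n + 2) * (t : ℝ) - n * (n + 2))

lemma continuous_stage (n : ℕ) : Continuous (stage n) :=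
  continuous_projIcc.comp (by fun_prop)

lemma stage_eq_zero {n : ℕ} {t : I} (h : (n + 1) * (t : ℝ) ≤ n) : stage n t = 0 :=
  projIcc_of_le_left _ (by nlinarith [n.cast_nonneg (α := ℝ)])

lemma stage_eq_one {n : ℕ} {t : I} (h : (n + 1 : ℝ) ≤ (n + 2) * t) : stage n t = 1 :=
  projIcc_of_right_le _ (by nlinarith [n.cast_nonneg (α := ℝ)])

section
variable {Φ : ℕ → ℂ ≃ₜ ℂ} {C : ℕ → I → ℂ ≃ₜ ℂ}

/-- The concatenation of the first `n` isotopies. -/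
noncomputable def stages (Φ : ℕ → ℂ ≃ₜ ℂ) (C : ℕ → I → ℂ ≃ₜ ℂ) : ℕ → I → ℂ ≃ₜ ℂ
  | 0, _ => Φ 0
  | n + 1, t => (C n (stage n t))⁻¹ * stages Φ C n t

lemma jc_stages (hC : ∀ n, JC (C n)) (n : ℕ) : JC (stages Φ C n) := by
  induction n with
  | zero => exact JC.const _
  | succ n ih => exact ((hC n).comp (continuous_stage n)).inv.mul ih

lemma stages_fix (h0 : ∀ k : ℤ, Φ 0 k = k) (hk : ∀ n t, ∀ k : ℤ, C n t k = k) (n : ℕ) (t : I)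
    (k : ℤ) : stages Φ C n t k = k := by
  induction n with
  | zero => exact h0 k
  | succ n ih => rw [stages, mul_app, ih, inv_fix (hk _ _ _)]

lemma mul_le_of_stage {n m : ℕ} (hnm : n ≤ m) {t : I} (h : (n + 1) * (t : ℝ) ≤ n) :
    (m + 1) * (t : ℝ) ≤ m := by
  have : (n : ℝ) ≤ m := Nat.cast_le.2 hnm
  nlinarith [t.2.1, t.2.2]

lemma stages_eq_of_le (C0 : ∀ n, C n 0 = 1) {n m : ℕ} (hnm : n ≤ m) {t : I}
    (h : (n + 1) * (t : ℝ) ≤ n) : stages Φ C m t = stages Φ C n t := by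
  induction m, hnm using Nat.le_induction with
  | base => rfl
  | succ m hm ih => rw [stages, stage_eq_zero (mul_le_of_stage hm h), C0, inv_one, one_mul, ih]

lemma stages_eq_of_ge (hΦ : ∀ n, Φ (n + 1) = (C n 1)⁻¹ * Φ n) {n : ℕ} {t : I}
    (h : (n : ℝ) ≤ (n + 1) * t) : stages Φ C n t = Φ n := by
  induction n with
  | zero => rfl
  | succ n ih =>
    push_cast at h
    have h' : (n + 1 : ℝ) ≤ (n + 2) * t := by linarith
    rw [stages, stage_eq_one h', hΦ, ih (by nlinarith [t.2.2])]

lemma stages_ball (hΦ : ∀ n, Φ (n + 1) = (C n 1)⁻¹ * Φ n)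
    (hb : ∀ (n : ℕ) z, ‖z‖ < n + 5 / 4 → Φ n z = z)
    (hCb : ∀ (n : ℕ) t z, ‖z‖ < n + 5 / 4 → C n t z = z) {n m : ℕ} (hnm : n ≤ m) {t : I}
    (h : (n : ℝ) ≤ (n + 1) * t) {z : ℂ} (hz : ‖z‖ < n + 5 / 4) : stages Φ C m t z = z := by
  induction m, hnm using Nat.le_induction with
  | base => rw [stages_eq_of_ge hΦ h, hb n z hz]
  | succ m hm ih =>
    have : (n : ℝ) ≤ m := Nat.cast_le.2 hm
    rw [stages, mul_app, ih, inv_fix (hCb m _ z (by linarith))]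

lemma exists_limit (hC : ∀ n, JC (C n)) (C0 : ∀ n, C n 0 = 1)
    (hΦ : ∀ n, Φ (n + 1) = (C n 1)⁻¹ * Φ n)
    (hb : ∀ (n : ℕ) z, ‖z‖ < n + 5 / 4 → Φ n z = z)
    (hCb : ∀ (n : ℕ) t z, ‖z‖ < n + 5 / 4 → C n t z = z)
    (h0 : ∀ k : ℤ, Φ 0 k = k) (hk : ∀ n t, ∀ k : ℤ, C n t k = k) :
    ∃ F : I → ℂ ≃ₜ ℂ, JC F ∧ F 0 = Φ 0 ∧ F 1 = 1 ∧ ∀ t, ∀ k : ℤ, F t k = k := by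
  have hloc : ∀ (t : I) (z : ℂ), ∃ n, ∀ᶠ p : I × ℂ in 𝓝 (t, z), ∀ m, n ≤ m →
      stages Φ C m p.1 p.2 = stages Φ C n p.1 p.2 := fun t z => by
    rcases t.2.2.lt_or_eq with ht | ht
    · obtain ⟨n, hn⟩ := exists_nat_gt ((t : ℝ) / (1 - t))
      refine ⟨n, ?_⟩
      have : ∀ᶠ p : I × ℂ in 𝓝 (t, z), (n + 1) * (p.1 : ℝ) < n :=
        (isOpen_lt (by fun_prop : Continuous fun p : I × ℂ => (n + 1) * (p.1 : ℝ))
          continuous_const).mem_nhds (by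
            rw [div_lt_iff₀ (by linarith)] at hn
            simp only [mem_ofPred_eq]
            linarith)
      exact this.mono fun p hp m hm => by rw [stages_eq_of_le C0 hm hp.le]
    · obtain ⟨n, hn⟩ := exists_nat_gt ‖z‖
      refine ⟨n, ?_⟩
      have h1 : ∀ᶠ p : I × ℂ in 𝓝 (t, z), (n : ℝ) < (n + 1) * (p.1 : ℝ) :=
        (isOpen_lt continuous_const
          (by fun_prop : Continuous fun p : I × ℂ => (n + 1) * (p.1 : ℝ))).mem_nhds (by simp [ht])
      have h2 : ∀ᶠ p : I × ℂ in 𝓝 (t, z), ‖p.2‖ < n :=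
        (isOpen_lt (by fun_prop) continuous_const).mem_nhds hn
      filter_upwards [h1, h2] with p hp1 hp2 m hm
      rw [stages_ball hΦ hb hCb hm hp1.le (by linarith),
        stages_ball hΦ hb hCb le_rfl hp1.le (by linarith)]
  have hlim : ∀ t : I, ∃ e : ℂ ≃ₜ ℂ, ∀ z, ∀ᶠ m in atTop, stages Φ C m t z = e z := fun t => by
    rcases t.2.2.lt_or_eq with ht | ht
    · obtain ⟨n, hn⟩ := exists_nat_gt ((t : ℝ) / (1 - t))
      rw [div_lt_iff₀ (by linarith)] at hn
      exact ⟨stages Φ C n t, fun z => (eventually_ge_atTop n).mono fun m hm => by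
        rw [stages_eq_of_le C0 hm (by linarith)]⟩
    · refine ⟨1, fun z => ?_⟩
      obtain ⟨n, hn⟩ := exists_nat_gt ‖z‖
      exact (eventually_ge_atTop n).mono fun m hm =>
        stages_ball hΦ hb hCb hm (by rw [ht]; linarith) (by linarith)
  choose F hF using hlim
  refine ⟨F, ?_, ?_, ?_, fun t k => ?_⟩
  · refine continuous_iff_continuousAt.2 fun ⟨t, z⟩ => ?_
    obtain ⟨n, hn⟩ := hloc t z
    have hc : Continuous fun p : I × ℂ => stages Φ C n p.1 p.2 := jc_stages hC n
    refine hc.continuousAt.congr (hn.mono fun p hp => ?_)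
    obtain ⟨m, hm1, hm2⟩ := ((hF p.1 p.2).and (eventually_ge_atTop n)).exists
    exact (hp m hm2).symm.trans hm1
  · refine Homeomorph.ext fun z => ?_
    obtain ⟨m, hm⟩ := (hF 0 z).exists
    rw [← hm, stages_eq_of_le C0 (Nat.zero_le m) (by simp)]
    rfl
  · refine Homeomorph.ext fun z => ?_
    obtain ⟨n, hn⟩ := exists_nat_gt ‖z‖
    obtain ⟨m, hm1, hm2⟩ := ((hF 1 z).and (eventually_ge_atTop n)).exists
    rw [← hm1, stages_ball hΦ hb hCb hm2 (by simp) (by linarith), one_app]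
  · obtain ⟨m, hm⟩ := (hF t k).exists
    rw [← hm, stages_fix h0 hk]
end

/-- A homeomorphism fixing the integers and a disc, and acting trivially on words, is isotopic to
the identity relative to the integers. -/
lemma exists_isotopy_of_ball {Φ : ℂ ≃ₜ ℂ} (hΦ : ∀ k : ℤ, Φ k = k) (hT : Triv Φ)
    (hb : ∀ z, ‖z‖ ≤ 3 / 2 → Φ z = z) :
    ∃ F : I → ℂ ≃ₜ ℂ, JC F ∧ F 0 = Φ ∧ F 1 = 1 ∧ ∀ t, ∀ k : ℤ, F t k = k := by
  let S (n : ℕ) := {Φ : ℂ ≃ₜ ℂ // (∀ k : ℤ, Φ k = k) ∧ Triv Φ ∧ ∀ z, ‖z‖ ≤ n + 3 / 2 → Φ z = z}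
  have hE : ∀ (n : ℕ) (φ : S n), ∃ C : I → ℂ ≃ₜ ℂ, JC C ∧ C 0 = 1 ∧ (∀ t, ∀ k : ℤ, C t k = k) ∧
      (∀ t z, ‖z‖ < n + 5 / 4 → C t z = z) ∧
      ∀ z, ‖z‖ ≤ (n + 1 : ℕ) + 3 / 2 → C 1 z = φ.1 z :=
    fun n φ => exists_extend n φ.2.1 φ.2.2.1 φ.2.2.2
  choose C hC C0 hCk hCb hC1 using hE
  let φ : ∀ n, S n := fun n => Nat.rec ⟨Φ, hΦ, hT, by simpa using hb⟩
    (fun n φ => ⟨(C n φ 1)⁻¹ * φ.1, fun k => by rw [mul_app, φ.2.1, inv_fix (hCk _ _ _ _)],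
      Triv.of_isotopy (hC n φ) (C0 n φ) (hCk n φ) φ.2.1 φ.2.2.1,
      fun z hz => by rw [mul_app, inv_app_eq, hC1 n φ z hz]⟩) n
  exact exists_limit (Φ := fun n => (φ n).1) (C := fun n => C n (φ n)) (fun n => hC _ _)
    (fun n => C0 _ _) (fun n => rfl) (fun n z hz => (φ n).2.2.2 z (by linarith))
    (fun n t z hz => hCb _ _ t z hz) hΦ (fun n t k => hCk _ _ t k)

end PlaneTC

namespace PlaneTC
open Topology unitInterval

/-- An isotopy can be normalised to fix `0` and `1`. -/
lemma exists_normalized {H : I → ℂ ≃ₜ ℂ} (hH : JC H) (h0 : H 0 = 1) (h10 : H 1 0 = 0)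
    (h11 : H 1 1 = 1) : ∃ K : I → ℂ ≃ₜ ℂ, JC K ∧ K 0 = 1 ∧ K 1 = H 1 ∧ (∀ t, K t 0 = 0) ∧
      ∀ t, K t 1 = 1 := by
  have hne : ∀ t, H t 1 - H t 0 ≠ 0 := fun t =>
    sub_ne_zero.2 fun h => one_ne_zero ((H t).injective h)
  have hc : ∀ w : ℂ, Continuous fun p : I × ℂ => H p.1 w := fun w =>
    hH.app continuous_fst continuous_const
  obtain ⟨A, hA, hAf⟩ := exists_family (f := fun t z => (z - H t 0) / (H t 1 - H t 0))
    (g := fun t z => z * (H t 1 - H t 0) + H t 0)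
    ((continuous_snd.sub (hc 0)).div ((hc 1).sub (hc 0)) fun p => hne p.1)
    (fun t => by fun_prop)
    (fun t z => by rw [div_mul_cancel₀ _ (hne t), sub_add_cancel])
    (fun t z => by rw [add_sub_cancel_right, mul_div_cancel_right₀ _ (hne t)])
  refine ⟨fun t => A t * H t, hA.mul hH, Homeomorph.ext fun z => ?_, Homeomorph.ext fun z => ?_,
    fun t => ?_, fun t => ?_⟩
  · simp [hAf, h0]
  · simp [hAf, h10, h11]
  · simp [hAf]
  · rw [mul_app, hAf, div_self (hne t)]

lemma exists_germ_zero {H : I → ℂ ≃ₜ ℂ} (hH : JC H) (h0 : H 0 = 1) (hz : ∀ t, H t 0 = 0)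
    (h1 : ∀ t, H t 1 = 1) : ∃ G : I → ℂ ≃ₜ ℂ, JC G ∧ G 0 = 1 ∧
      (∀ t z, 1 / 2 ≤ ‖z‖ → G t z = z) ∧ ∃ ε > 0, ∀ t z, ‖z‖ < ε → G t z = H t z := by
  set w : ℂ ≃ₜ ℂ := Homeomorph.subLeft 1 with hw
  have hwz : ∀ z, w z = 1 - z := fun z => rfl
  have hww : w * w = 1 := Homeomorph.ext fun z => by simp [hwz]
  obtain ⟨G, hG, G0, hG1, ε, hε, hGε⟩ := exists_germ (H := fun t => w * H t * w)
    (((JC.const w).mul hH).mul (JC.const w)) (by simp [h0, hww])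
    (fun t => by simp [hwz, h1]) (fun t => by simp [hwz, hz])
  have hn : ∀ z, ‖w z - 1‖ = ‖z‖ := fun z => by rw [hwz, sub_sub_cancel_left, norm_neg]
  have hwi : ∀ z, w (w z) = z := fun z => by rw [← mul_app, hww, one_app]
  refine ⟨fun t => w * G t * w, ((JC.const w).mul hG).mul (JC.const w), by simp [G0, hww],
    fun t z hz => ?_, ε, hε, fun t z hz => ?_⟩
  · rw [mul_app, mul_app, hG1 t _ (by rwa [hn]), hwi]
  · rw [mul_app, mul_app, hGε t _ (by rwa [hn]), mul_app, mul_app, hwi, hwi]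

/-- A homeomorphism isotopic to the identity, fixing the integers and acting trivially on words, is
isotopic to the identity relative to the integers. -/
theorem exists_isotopy_of_triv {H : I → ℂ ≃ₜ ℂ} (hH : JC H) (h0 : H 0 = 1)
    (hΦ : ∀ k : ℤ, H 1 k = k) (hT : Triv (H 1)) :
    ∃ F : I → ℂ ≃ₜ ℂ, JC F ∧ F 0 = H 1 ∧ F 1 = 1 ∧ ∀ t, ∀ k : ℤ, F t k = k := by
  obtain ⟨K, hK, K0, K1, Kz, Ko⟩ := exists_normalized hH h0 (by simpa using hΦ 0)
    (by simpa using hΦ 1)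
  rw [← K1] at hΦ hT ⊢
  obtain ⟨G, hG, G0, hGb, ε, hε, hGε⟩ := exists_germ_zero hK K0 Kz Ko
  have hGk : ∀ t, ∀ k : ℤ, G t k = k := fun t k => by
    rcases eq_or_ne k 0 with rfl | hk
    · rw [Int.cast_zero, hGε t 0 (by simpa using hε), Kz]
    · refine hGb t k ?_
      rw [Complex.norm_intCast, ← Int.cast_abs]
      have : ((1 : ℤ) : ℝ) ≤ (|k| : ℤ) := Int.cast_le.2 (Int.one_le_abs hk)
      push_cast at this ⊢
      linarith
  set r := min ε (1 / 2) with hr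
  have hr0 : 0 < r := lt_min hε (by norm_num)
  obtain ⟨C, hC, C0, Ck, -, C1⟩ := exists_step (H := fun t => (G t)⁻¹ * K t) (hG.inv.mul hK)
    (by simp [G0, K0])
    (fun t => by rw [mul_app, Ko, inv_fix (by simpa using hGk t 1)])
    (fun k => by rw [mul_app, hΦ, inv_fix (hGk 1 k)])
    (Triv.of_isotopy hG G0 hGk hΦ hT) (r₀ := r / 4) (r := r) (by positivity)
    (fun t z hz => by rw [mul_app, inv_app_eq, hGε t z (hz.trans_le (min_le_left _ _))])
    (fun k hk => by
      rcases eq_or_ne k 0 with rfl | hk'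
      · simpa using (by positivity : 0 ≤ r / 4)
      · rw [Complex.norm_intCast, ← Int.cast_abs] at hk
        have : ((1 : ℤ) : ℝ) ≤ (|k| : ℤ) := Int.cast_le.2 (Int.one_le_abs hk')
        push_cast at this hk
        linarith [min_le_right ε (1 / 2 : ℝ)]) (r' := r / 2) (by linarith) (by linarith) (3 / 2)
  have hΦ' : ∀ k : ℤ, ((G 1)⁻¹ * K 1 : ℂ ≃ₜ ℂ) k = k := fun k => by
    rw [mul_app, hΦ, inv_fix (hGk 1 k)]
  obtain ⟨F, hF, F0, F1, Fk⟩ := exists_isotopy_of_ball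
    (Φ := (C 1)⁻¹ * ((G 1)⁻¹ * K 1)) (fun k => by rw [mul_app, hΦ', inv_fix (Ck 1 k)])
    (Triv.of_isotopy hC C0 Ck hΦ' (Triv.of_isotopy hG G0 hGk hΦ hT))
    (fun z hz => by rw [mul_app, inv_app_eq, C1 z hz])
  refine ⟨fun t => G (symm t) * C (symm t) * F t,
    ((hG.comp continuous_symm).mul (hC.comp continuous_symm)).mul hF, ?_, ?_, fun t k => ?_⟩
  · simp only [symm_zero, F0]
    group
  · simp [G0, C0, F1]
  · rw [mul_app, mul_app, Fk, Ck, hGk]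

/-- The centraliser of the translation class, in complex coordinates. -/
theorem exists_commuting {H : I → ℂ ≃ₜ ℂ} (hH : JC H) (h0 : H 0 = 1) (π : ℤ ≃ ℤ)
    (hπ : ∀ i : ℤ, H 1 i = (π i : ℤ)) {f : I → ℂ ≃ₜ ℂ} (hf : JC f)
    (f0 : f 0 = H 1 * tau 2 * (H 1)⁻¹) (f1 : f 1 = tau 2)
    (hfix : ∀ t, ∀ i : ℤ, f t i = f 0 i) :
    ∃ F : I → ℂ ≃ₜ ℂ, JC F ∧ F 0 = H 1 ∧ F 1 * tau 2 = tau 2 * F 1 ∧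
      ∀ t, ∀ i : ℤ, F t i = H 1 i := by
  obtain ⟨K, hK, K0, Kc, HK, hT⟩ := exists_triv hH h0 π hπ hf f0 f1 hfix
  obtain ⟨F, hF, F0, F1, Fk⟩ := exists_isotopy_of_triv (H := fun t => H t * (K t)⁻¹)
    (hH.mul hK.inv) (by simp [h0, K0])
    (fun k => by
      obtain ⟨i, rfl⟩ := π.surjective k
      rw [mul_app, inv_app_eq.2 ((hπ i).symm.trans (HK i)), hπ]) hT
  refine ⟨fun t => F t * K 1, hF.mul (JC.const _), ?_, ?_, fun t i => ?_⟩
  · simp [F0]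
  · simpa [F1] using Kc
  · rw [mul_app, ← HK, hπ, Fk]

end PlaneTC

namespace PlaneTC
open unitInterval

/-- Coordinates carrying the two rows of integer points to the integers of parity `0` and `1`, and
the unit translation to the translation by `2`. -/
noncomputable def straighten : Plane ≃ₜ ℂ where
  toFun p := ⟨2 * p.1 + (p.2 - 1), p.2 - 1 - Real.sin (Real.pi * (2 * p.1 + (p.2 - 1)) / 2) ^ 2⟩
  invFun w := ((w.re - (w.im + Real.sin (Real.pi * w.re / 2) ^ 2)) / 2,
    w.im + Real.sin (Real.pi * w.re / 2) ^ 2 + 1)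
  left_inv p := by
    ext
    · simp only
      ring
    · simp only
      ring
  right_inv w := by
    have h : 2 * ((w.re - (w.im + Real.sin (Real.pi * w.re / 2) ^ 2)) / 2) +
        (w.im + Real.sin (Real.pi * w.re / 2) ^ 2 + 1 - 1) = w.re := by ring
    refine Complex.ext h ?_
    simp only [h]
    ring
  continuous_toFun := by
    refine Complex.equivRealProdCLM.symm.continuous.comp (f := fun p : Plane =>
      (2 * p.1 + (p.2 - 1), p.2 - 1 - Real.sin (Real.pi * (2 * p.1 + (p.2 - 1)) / 2) ^ 2)) ?_
    fun_prop
  continuous_invFun := by fun_prop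

lemma straighten_apply (p : Plane) : straighten p = ⟨2 * p.1 + (p.2 - 1),
    p.2 - 1 - Real.sin (Real.pi * (2 * p.1 + (p.2 - 1)) / 2) ^ 2⟩ := rfl

lemma straighten_T (p : Plane) : straighten (_root_.T p) = tau 2 (straighten p) := by
  rw [tau_app, straighten_apply, straighten_apply]
  have h : Real.pi * (2 * (p.1 + 1) + (p.2 - 1)) / 2 =
      Real.pi * (2 * p.1 + (p.2 - 1)) / 2 + Real.pi := by ring
  apply Complex.ext
  · simp [_root_.T, shear]
    ring
  · simp [_root_.T, shear, h]

lemma straighten_Z1 (n : ℤ) : straighten ((n : ℝ), 1) = ((2 * n : ℤ) : ℂ) := by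
  rw [straighten_apply]
  have h : Real.pi * (2 * n + (1 - 1)) / 2 = n * Real.pi := by ring
  apply Complex.ext <;> simp only [h, Real.sin_int_mul_pi] <;> simp

lemma straighten_Z2 (n : ℤ) : straighten ((n : ℝ), 2) = ((2 * n + 1 : ℤ) : ℂ) := by
  rw [straighten_apply]
  have h : Real.pi * (2 * n + (2 - 1)) / 2 = n * Real.pi + Real.pi / 2 := by ring
  have hs : Real.sin (n * Real.pi + Real.pi / 2) ^ 2 = 1 := by
    rw [Real.sin_add_pi_div_two, Real.cos_sq', Real.sin_int_mul_pi]
    norm_num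
  apply Complex.ext
  · simp
    norm_num
  · simp only [h, hs]
    norm_num

lemma image_straighten : straighten '' (Z1 ∪ Z2) = range fun i : ℤ => (i : ℂ) := by
  ext z
  constructor
  · rintro ⟨_, ⟨n, rfl⟩ | ⟨n, rfl⟩, rfl⟩
    · exact ⟨_, (straighten_Z1 n).symm⟩
    · exact ⟨_, (straighten_Z2 n).symm⟩
  · rintro ⟨i, rfl⟩
    rcases Int.even_or_odd' i with ⟨n, rfl | rfl⟩
    · exact ⟨_, Or.inl ⟨n, rfl⟩, straighten_Z1 n⟩
    · exact ⟨_, Or.inr ⟨n, rfl⟩, straighten_Z2 n⟩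

lemma exists_family_of_isotopicRel {g g' : Plane → Plane} {O : Set Plane}
    (h : IsotopicRel g g' O) : ∃ H : I → ℂ ≃ₜ ℂ, JC H ∧
      (∀ p, H 0 (straighten p) = straighten (g p)) ∧
      (∀ p, H 1 (straighten p) = straighten (g' p)) ∧
      ∀ t, ∀ p ∈ O, H t (straighten p) = straighten (g p) := by
  obtain ⟨F, hF, hh, h0, h1, hO⟩ := h
  choose! e he using hh
  have hs : ∀ (t : I) p, ((straighten.symm.trans (e t)).trans straighten) (straighten p) =
      straighten (F (t, p)) := fun t p => by simp [he t t.2]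
  refine ⟨fun t => (straighten.symm.trans (e t)).trans straighten, ?_,
    fun p => by rw [hs, ← h0]; rfl, fun p => by rw [hs, ← h1]; rfl,
    fun t p hp => by rw [hs, hO t t.2 p hp]⟩
  have hc : Continuous fun p : I × ℂ => straighten (F (p.1, straighten.symm p.2)) :=
    straighten.continuous.comp (hF.comp ((continuous_subtype_val.comp continuous_fst).prodMk
      (straighten.symm.continuous.comp continuous_snd)))
  exact hc.congr fun p => by simp [he p.1 p.1.2]

lemma isotopicRel_of_family {F : I → ℂ ≃ₜ ℂ} (hF : JC F) {g g' : Plane → Plane} {O : Set Plane}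
    (h0 : ∀ p, F 0 (straighten p) = straighten (g p))
    (h1 : ∀ p, F 1 (straighten p) = straighten (g' p))
    (hO : ∀ t, ∀ p ∈ O, F t (straighten p) = straighten (g p)) : IsotopicRel g g' O :=
  ⟨fun p => straighten.symm (F (projIcc 0 1 zero_le_one p.1) (straighten p.2)),
    straighten.symm.continuous.comp (hF.app (continuous_projIcc.comp continuous_fst)
      (straighten.continuous.comp continuous_snd)),
    fun t _ => ⟨(straighten.trans (F (projIcc 0 1 zero_le_one t))).trans straighten.symm,
      fun _ => rfl⟩,
    fun p => by simp only [projIcc_left]; exact (straighten.symm_apply_eq).2 (h0 p),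
    fun p => by simp only [projIcc_right]; exact (straighten.symm_apply_eq).2 (h1 p),
    fun _ _ p hp => (straighten.symm_apply_eq).2 (hO _ p hp)⟩

lemma exists_perm {Ψ : Plane ≃ₜ Plane} (h : Ψ '' (Z1 ∪ Z2) = Z1 ∪ Z2) :
    ∃ π : ℤ ≃ ℤ, ∀ p ∈ Z1 ∪ Z2, ∀ i : ℤ, straighten p = i → straighten (Ψ p) = (π i : ℤ) := by
  have hex : ∀ i : ℤ, ∃ p ∈ Z1 ∪ Z2, straighten p = i := fun i =>
    (image_straighten.symm.subset (mem_range_self i) :)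
  have hf : ∀ i : ℤ, ∃ j : ℤ, ∀ p ∈ Z1 ∪ Z2, straighten p = i → straighten (Ψ p) = j := fun i => by
    obtain ⟨p, hp, hpi⟩ := hex i
    obtain ⟨j, hj⟩ := image_straighten.subset
      (mem_image_of_mem _ (h.subset (mem_image_of_mem _ hp)))
    refine ⟨j, fun q hq hqi => ?_⟩
    rw [straighten.injective (hqi.trans hpi.symm)]
    exact hj.symm
  choose f hf using hf
  refine ⟨Equiv.ofBijective f ⟨fun i j hij => ?_, fun j => ?_⟩, fun p hp i hi => hf i p hp hi⟩
  · obtain ⟨p, hp, hpi⟩ := hex i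
    obtain ⟨q, hq, hqj⟩ := hex j
    have hpq : straighten (Ψ p) = straighten (Ψ q) := by rw [hf i p hp hpi, hf j q hq hqj, hij]
    rw [Ψ.injective (straighten.injective hpq), hqj] at hpi
    exact_mod_cast hpi.symm
  · obtain ⟨q, hq, hqj⟩ := hex j
    obtain ⟨p, hp, rfl⟩ := h.symm.subset hq
    obtain ⟨i, hi⟩ := image_straighten.subset (mem_image_of_mem _ hp)
    refine ⟨i, ?_⟩
    have := (hf i p hp hi.symm).symm.trans hqj
    exact_mod_cast this

end PlaneTC

/-- Centralizer of the translation class: every mapping class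
commuting with that of `T` is the mapping class of a homeomorphism commuting
with `T`. -/
theorem translation_centralizer
    (Ψ : Plane ≃ₜ Plane) (hOP : OrientationPreserving Ψ)
    (h1 : Ψ '' Z1 = Z1) (h2 : Ψ '' Z2 = Z2)
    (hcomm : IsotopicRel (⇑(conjH Ψ T)) (⇑T) (Z1 ∪ Z2)) :
    ∃ Ψ' : Plane ≃ₜ Plane, (∀ p, Ψ' (T p) = T (Ψ' p)) ∧
      Ψ' '' Z1 = Z1 ∧ Ψ' '' Z2 = Z2 ∧
      IsotopicRel (⇑Ψ) (⇑Ψ') (Z1 ∪ Z2) := by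
  obtain ⟨H, hH, H0, H1, -⟩ := PlaneTC.exists_family_of_isotopicRel hOP
  obtain ⟨f, hf, f0, f1, ffix⟩ := PlaneTC.exists_family_of_isotopicRel hcomm
  obtain ⟨π, hπ⟩ := PlaneTC.exists_perm (Ψ := Ψ) (by rw [image_union, h1, h2])
  have hcoe : ∀ i : ℤ, ∃ p ∈ Z1 ∪ Z2, PlaneTC.straighten p = i := fun i =>
    (PlaneTC.image_straighten.symm.subset (mem_range_self i) :)
  have hH0 : H 0 = 1 := Homeomorph.ext fun z => by
    obtain ⟨p, rfl⟩ := PlaneTC.straighten.surjective z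
    exact H0 p
  have hH1 : ∀ p, (H 1)⁻¹ (PlaneTC.straighten (Ψ p)) = PlaneTC.straighten p := fun p => by
    rw [PlaneTC.inv_app_eq, H1]
  obtain ⟨F, hF, F0, F1, Ffix⟩ := PlaneTC.exists_commuting hH hH0 π
    (fun i => by
      obtain ⟨p, hp, hpi⟩ := hcoe i
      rw [← hπ p hp i hpi, ← hpi, H1]) hf
    (Homeomorph.ext fun z => by
      obtain ⟨p, rfl⟩ := PlaneTC.straighten.surjective z
      obtain ⟨q, rfl⟩ := Ψ.surjective p
      rw [f0, PlaneTC.mul_app, PlaneTC.mul_app, hH1, ← PlaneTC.straighten_T, H1]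
      simp [conjH])
    (Homeomorph.ext fun z => by
      obtain ⟨p, rfl⟩ := PlaneTC.straighten.surjective z
      rw [f1, PlaneTC.straighten_T])
    (fun t i => by
      obtain ⟨p, hp, hpi⟩ := hcoe i
      rw [← hpi, ffix t p hp, f0])
  have hF' : ∀ t, ∀ p ∈ Z1 ∪ Z2, F t (PlaneTC.straighten p) = PlaneTC.straighten (Ψ p) :=
    fun t p hp => by
      obtain ⟨i, hi⟩ := PlaneTC.image_straighten.subset (mem_image_of_mem _ hp)
      rw [← H1, ← hi, Ffix]
  have hΨ : ∀ p ∈ Z1 ∪ Z2,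
      ((PlaneTC.straighten.trans (F 1)).trans PlaneTC.straighten.symm) p = Ψ p := fun p hp => by
    rw [Homeomorph.trans_apply, Homeomorph.trans_apply, hF' 1 p hp, Homeomorph.symm_apply_apply]
  refine ⟨(PlaneTC.straighten.trans (F 1)).trans PlaneTC.straighten.symm, fun p => ?_,
    (image_congr fun p hp => hΨ p (Or.inl hp)).trans h1,
    (image_congr fun p hp => hΨ p (Or.inr hp)).trans h2,
    PlaneTC.isotopicRel_of_family hF (fun p => by rw [F0, H1]) (fun p => by simp) hF'⟩
  rw [Homeomorph.trans_apply, Homeomorph.trans_apply, Homeomorph.trans_apply,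
    Homeomorph.trans_apply, Homeomorph.symm_apply_eq, PlaneTC.straighten_T, PlaneTC.straighten_T,
    Homeomorph.apply_symm_apply, ← PlaneTC.mul_app, F1, PlaneTC.mul_app]
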